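/- Let (T,M) be a complete Noetherian local ring. Then T is the completion of a noncatenary Noetherian local unique factorization domain if and only if: (i) no nonzero element of the prime subring of T is a zerodivisor, (ii) depth T > 1, and (iii) there exists a minimal prime P of T with 2 < dim(T/P) < dim T. -/

import Mathlib

open IsLocalRing

/-- A chain of primes indexed by `Fin (n+1)` is saturated if each step is a covering
relation in `Spec`. -/
def IsSaturatedChain {R : Type} [CommRing R] {n : ℕ} (f : Fin (n + 1) → PrimeSpectrum R) : Prop :=
  ∀ i : Fin n, f i.castSucc ⋖ f i.succ

/-- A ring is catenary if any two saturated chains of primes with the same endpoints have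
the same length. -/
def IsCatenary (R : Type) [CommRing R] : Prop :=
  ∀ (n m : ℕ) (f : Fin (n + 1) → PrimeSpectrum R) (g : Fin (m + 1) → PrimeSpectrum R),
    IsSaturatedChain f → IsSaturatedChain g → f 0 = g 0 →
    f (Fin.last n) = g (Fin.last m) → n = m

/-- The depth of a local ring: the supremum of lengths of regular sequences contained in
the maximal ideal. -/
noncomputable def ringDepth (R : Type) [CommRing R] [IsLocalRing R] : ℕ∞ :=
  sSup {n : ℕ∞ | ∃ rs : List R, (rs.length : ℕ∞) = n ∧
    (∀ r ∈ rs, r ∈ maximalIdeal R) ∧ RingTheory.Sequence.IsRegular R rs}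

/-- In characteristic `p`, a square-zero maximal ideal has a complementary subring. -/
theorem exists_subring_compl_of_sq_eq_bot {E : Type*} [CommRing E] {p : ℕ} [Fact p.Prime]
    [CharP E p] {N : Ideal E} [hN : N.IsMaximal] (hsq : N ^ 2 = ⊥) :
    ∃ K : Subring E, (∀ e ∈ K, e ∈ N → e = 0) ∧ ∀ e, ∃ a ∈ K, e - a ∈ N := by
  have hp2 : 2 ≤ p := (Fact.out : p.Prime).two_le
  have : Nontrivial E := ⟨0, 1, fun h => hN.ne_top ((Ideal.eq_top_iff_one N).2 (h ▸ N.zero_mem))⟩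
  let s : Set (Subring E) := {K | (∀ e ∈ K, e ∈ N → e = 0) ∧ ∀ e : E, e ^ p ∈ K}
  have hs0 : (frobenius E p).range ∈ s := by
    refine ⟨?_, fun e => ⟨e, rfl⟩⟩
    rintro _ ⟨e, rfl⟩ he
    have he' : e ∈ N := hN.isPrime.mem_of_pow_mem p he
    have h2 : e ^ 2 ∈ N ^ 2 := Ideal.pow_mem_pow he' 2
    rw [hsq, Ideal.mem_bot] at h2
    rw [frobenius_def, ← Nat.sub_add_cancel hp2, pow_add, h2, mul_zero]
  obtain ⟨K, -, hK⟩ := zorn_le_nonempty₀ s (by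
    intro c hc hchain K₀ hK₀
    have hdir : DirectedOn (· ≤ ·) c := hchain.directedOn
    refine ⟨sSup c, ⟨?_, fun e => ?_⟩, fun K hK => le_sSup hK⟩
    · intro e he heN
      obtain ⟨K, hKc, heK⟩ := (Subring.mem_sSup_of_directedOn ⟨K₀, hK₀⟩ hdir).1 he
      exact (hc hKc).1 e heK heN
    · exact (Subring.mem_sSup_of_directedOn ⟨K₀, hK₀⟩ hdir).2 ⟨K₀, hK₀, (hc hK₀).2 e⟩) _ hs0
  refine ⟨K, hK.prop.1, ?_⟩
  by_contra! hcon
  obtain ⟨t, ht⟩ := hcon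
  let k := E ⧸ N
  let _ : Field k := Ideal.Quotient.field N
  let q : E →+* k := Ideal.Quotient.mk N
  have : CharP k p := by
    have h0 : (p : k) = 0 := by
      rw [← map_natCast q, CharP.cast_eq_zero, map_zero]
    exact (CharP.charP_iff_prime_eq_zero (Fact.out : p.Prime)).2 h0
  -- the residue subfield
  let F : Subfield k :=
    { K.map q with
      inv_mem' := by
        rintro _ ⟨a, ha, rfl⟩
        by_cases h0 : q a = 0
        · exact ⟨0, K.zero_mem, by rw [h0, inv_zero, map_zero]⟩
        obtain ⟨b, hb⟩ := Ideal.Quotient.mk_surjective (q a)⁻¹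
        refine ⟨a ^ (p - 1) * b ^ p, K.mul_mem (K.pow_mem ha _) (hK.prop.2 b), ?_⟩
        rw [map_mul, map_pow, map_pow]
        change q a ^ (p - 1) * (Ideal.Quotient.mk N b) ^ p = _
        rw [hb, inv_pow]
        have : p = (p - 1) + 1 := by omega
        conv_lhs => rw [this]
        simp only [Nat.add_sub_cancel, pow_succ]
        field_simp }
  have hFmem : ∀ a ∈ K, q a ∈ F := fun a ha => ⟨a, ha, rfl⟩
  have htF : q t ∉ F := by
    rintro ⟨a, ha, hat⟩
    exact ht a ha ((Ideal.Quotient.eq).1 hat.symm)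
  -- reduction of coefficients
  let ρ : K →+* F := (q.comp K.subtype).codRestrict F (fun a => hFmem a a.2)
  have hρ : Function.Injective ρ := by
    rw [injective_iff_map_eq_zero]
    intro a ha
    have : q a = 0 := congrArg Subtype.val ha
    exact Subtype.ext (hK.prop.1 a a.2 (Ideal.Quotient.eq_zero_iff_mem.1 this))
  let a₀ : K := ⟨t ^ p, hK.prop.2 t⟩
  have hirr : Irreducible (Polynomial.X ^ p - Polynomial.C (ρ a₀) : Polynomial F) := by
    apply X_pow_sub_C_irreducible_of_prime Fact.out
    intro b hb
    have : (b : k) ^ p = (q t) ^ p := by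
      have h1 : (b : k) ^ p = q (t ^ p) := congrArg Subtype.val hb
      rw [h1, map_pow]
    have := frobenius_inj k p this
    exact htF (this ▸ b.2)
  let K' : Subring E := (Polynomial.eval₂RingHom K.subtype t).range
  have hKK' : K ≤ K' := fun a ha => ⟨Polynomial.C ⟨a, ha⟩, by simp⟩
  have htK' : t ∈ K' := ⟨Polynomial.X, by simp⟩
  have hK's : K' ∈ s := by
    refine ⟨?_, fun e => hKK' (hK.prop.2 e)⟩
    rintro _ ⟨f, rfl⟩ hf
    let g : Polynomial K := Polynomial.X ^ p - Polynomial.C a₀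
    have hg : g.Monic := Polynomial.monic_X_pow_sub_C _ (by omega)
    have hgt : Polynomial.eval₂ K.subtype t g = 0 := by
      simp [g, a₀]
    have hfr : Polynomial.eval₂ K.subtype t f = Polynomial.eval₂ K.subtype t (f %ₘ g) := by
      conv_lhs => rw [← Polynomial.modByMonic_add_div f g]
      rw [Polynomial.eval₂_add, Polynomial.eval₂_mul, hgt, zero_mul, add_zero]
    have hz : Polynomial.eval₂ F.subtype (q t) ((f %ₘ g).map ρ) = 0 := by
      rw [Polynomial.eval₂_map]
      have h1 : q (Polynomial.eval₂ K.subtype t (f %ₘ g)) = 0 := by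
        rw [← hfr]; exact Ideal.Quotient.eq_zero_iff_mem.2 hf
      rw [Polynomial.hom_eval₂] at h1
      exact h1
    have hgz : Polynomial.eval₂ F.subtype (q t) (g.map ρ) = 0 := by
      rw [Polynomial.eval₂_map]
      have h1 : q (Polynomial.eval₂ K.subtype t g) = 0 := by rw [hgt, map_zero]
      rw [Polynomial.hom_eval₂] at h1
      exact h1
    have hgirr : Irreducible (g.map ρ) := by
      simpa [g] using hirr
    have hr0 : (f %ₘ g).map ρ = 0 := by
      have hdvd : g.map ρ ∣ (f %ₘ g).map ρ := by
        have hm : g.map ρ = minpoly F (q t) :=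
          minpoly.eq_of_irreducible_of_monic hgirr hgz (hg.map ρ)
        rw [hm]
        exact minpoly.dvd F (q t) hz
      refine Polynomial.eq_zero_of_dvd_of_degree_lt hdvd ?_
      rw [Polynomial.degree_map_eq_of_injective hρ, Polynomial.degree_map_eq_of_injective hρ]
      exact Polynomial.degree_modByMonic_lt f hg
    have hr : f %ₘ g = 0 := (Polynomial.map_eq_zero_iff hρ).1 hr0
    change Polynomial.eval₂ K.subtype t f = 0
    rw [hfr, hr, Polynomial.eval₂_zero]
  have := hK.le_of_ge hK's hKK'
  exact ht t (this htK') (by simp)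

theorem exists_subring_compl {R : Type*} [CommRing R] {p : ℕ} [Fact p.Prime] {I J : Ideal R}
    [hJ : J.IsMaximal] (hIJ : I ≤ J) (hJ2 : J ^ 2 ≤ I) (hpI : (p : R) ∈ I) :
    ∃ K : Subring R, (∀ x ∈ I, x ∈ K) ∧ (∀ x ∈ K, x ∈ J → x ∈ I) ∧ ∀ x, ∃ a ∈ K, x - a ∈ J := by
  have hmks : Function.Surjective (Ideal.Quotient.mk I) := Ideal.Quotient.mk_surjective
  let N : Ideal (R ⧸ I) := J.map (Ideal.Quotient.mk I)
  have hNmem : ∀ w : R, Ideal.Quotient.mk I w ∈ N ↔ w ∈ J := by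
    intro w
    rw [← Ideal.mem_comap, Ideal.comap_map_of_surjective _ hmks, ← RingHom.ker_eq_comap_bot,
      Ideal.mk_ker, sup_eq_left.2 hIJ]
  have hNmax : N.IsMaximal :=
    Ideal.IsMaximal.map_of_surjective_of_ker_le hmks (by rwa [Ideal.mk_ker])
  have hN2 : N ^ 2 = ⊥ := by
    rw [← Ideal.map_pow, eq_bot_iff, Ideal.map_le_iff_le_comap]
    intro w hw
    rw [Ideal.mem_comap, Ideal.mem_bot, Ideal.Quotient.eq_zero_iff_mem]
    exact hJ2 hw
  have hI : I ≠ ⊤ := fun h => hJ.ne_top (top_le_iff.1 (h ▸ hIJ))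
  have : Nontrivial (R ⧸ I) := Ideal.Quotient.nontrivial_iff.2 hI
  have : CharP (R ⧸ I) p := by
    refine (CharP.charP_iff_prime_eq_zero (Fact.out : p.Prime)).2 ?_
    rw [← map_natCast (Ideal.Quotient.mk I)]
    exact Ideal.Quotient.eq_zero_iff_mem.2 hpI
  obtain ⟨K, hK1, hK2⟩ := exists_subring_compl_of_sq_eq_bot (p := p) hN2
  refine ⟨K.comap (Ideal.Quotient.mk I), ?_, ?_, ?_⟩
  · intro x hx
    rw [Subring.mem_comap, Ideal.Quotient.eq_zero_iff_mem.2 hx]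
    exact K.zero_mem
  · intro x hx hxJ
    exact Ideal.Quotient.eq_zero_iff_mem.1 (hK1 _ hx ((hNmem x).2 hxJ))
  · intro x
    obtain ⟨a, ha, hxa⟩ := hK2 (Ideal.Quotient.mk I x)
    obtain ⟨b, rfl⟩ := hmks a
    exact ⟨b, ha, by rwa [← map_sub, hNmem] at hxa⟩

/-- `W` is a coefficient ring modulo `m ^ n` for the prime `p`. -/
def IsCoeffSubring {D : Type*} [CommRing D] [IsLocalRing D] (p n : ℕ) (W : Subring D) : Prop :=
  (∀ x ∈ maximalIdeal D ^ n, x ∈ W) ∧ (∀ d, ∃ w ∈ W, d - w ∈ maximalIdeal D) ∧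
    ∀ w ∈ W, w ∈ maximalIdeal D → ∃ u ∈ W, w - p * u ∈ maximalIdeal D ^ n

theorem IsCoeffSubring.exists_succ_aux {D R : Type*} [CommRing D] [IsLocalRing D] [CommRing R]
    {p n : ℕ} [Fact p.Prime] (hp : (p : D) ∈ maximalIdeal D) (hn : n ≠ 0) {W : Subring D}
    (hW : IsCoeffSubring p n W) (i : R →+* D) (hi : ∀ x, x ∈ W ↔ ∃ r, i r = x) :
    ∃ W' : Subring D, IsCoeffSubring p (n + 1) W' ∧ W' ≤ W ∧
      ∀ w ∈ W, ∃ w' ∈ W', w - w' ∈ maximalIdeal D ^ n := by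
  obtain ⟨h1, h2, h3⟩ := hW
  set m := maximalIdeal D with hm
  let J : Ideal R := m.comap i
  let L : Ideal R := (m ^ (n + 1)).comap i
  let I : Ideal R := Ideal.span {(p : R)} ⊔ L
  have hpI : (p : R) ∈ I := Ideal.mem_sup_left (Ideal.mem_span_singleton_self _)
  have hIJ : I ≤ J := by
    refine sup_le ?_ ?_
    · rw [Ideal.span_le, Set.singleton_subset_iff]
      simpa [J] using hp
    · exact Ideal.comap_mono (Ideal.pow_le_self (by omega))
  have hJmax : J.IsMaximal := by
    have hs : Function.Surjective ((residue D).comp i) := by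
      intro x
      obtain ⟨d, rfl⟩ := residue_surjective x
      obtain ⟨w, hw, hd⟩ := h2 d
      obtain ⟨r, rfl⟩ := (hi w).1 hw
      refine ⟨r, ?_⟩
      have h0 : residue D (d - i r) = 0 := (residue_eq_zero_iff _).2 hd
      rw [map_sub, sub_eq_zero] at h0
      exact h0.symm
    have hker : RingHom.ker ((residue D).comp i) = J := by
      ext w
      simp [J, hm]
    exact hker ▸ RingHom.ker_isMaximal_of_surjective _ hs
  have hu : ∀ r ∈ J, ∃ u, i r - p * i u ∈ m ^ n := by
    intro r hr
    obtain ⟨u, hu, h⟩ := h3 _ ((hi _).2 ⟨r, rfl⟩) hr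
    obtain ⟨u, rfl⟩ := (hi _).1 hu
    exact ⟨u, h⟩
  have hJ2 : J ^ 2 ≤ I := by
    have hJ' : J ≤ Ideal.span {(p : R)} ⊔ (m ^ n).comap i := by
      intro w hw
      obtain ⟨u, hwu⟩ := hu w hw
      have : w = (p : R) * u + (w - (p : R) * u) := by ring
      rw [this]
      refine Ideal.add_mem _ (Ideal.mem_sup_left ?_) (Ideal.mem_sup_right ?_)
      · exact Ideal.mul_mem_right _ _ (Ideal.mem_span_singleton_self _)
      · simpa using hwu
    refine (Ideal.pow_right_mono hJ' 2).trans ?_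
    have hS : Ideal.span {(p : R)} ≤ I := le_sup_left
    have hL : L ≤ I := le_sup_right
    rw [sq, Ideal.mul_sup]
    refine sup_le (le_trans Ideal.mul_le_right hS) ?_
    rw [Ideal.sup_mul]
    refine sup_le (le_trans Ideal.mul_le_left hS) (le_trans ?_ hL)
    rw [Ideal.mul_le]
    intro r hr s hs
    have : i r * i s ∈ m ^ n * m ^ n := Ideal.mul_mem_mul hr hs
    rw [← pow_add, ← map_mul] at this
    exact Ideal.pow_le_pow_right (show n + 1 ≤ n + n by omega) this
  obtain ⟨K, hK0, hK1, hK2⟩ := exists_subring_compl (p := p) hIJ hJ2 hpI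
  have hK3 : ∀ r : R, ∃ s ∈ K, i r - i s ∈ m ^ n := by
    intro r
    obtain ⟨b, hb, hrb⟩ := hK2 r
    obtain ⟨u, hc⟩ := hu _ hrb
    refine ⟨b + p * u, K.add_mem hb (hK0 _ (I.mul_mem_right _ hpI)), ?_⟩
    convert hc using 1
    simp [sub_sub]
  refine ⟨K.map i, ⟨?_, ?_, ?_⟩, ?_, ?_⟩
  · intro x hx
    obtain ⟨r, rfl⟩ := (hi _).1 (h1 x (Ideal.pow_le_pow_right (Nat.le_succ n) hx))
    exact ⟨r, hK0 _ (Ideal.mem_sup_right hx), rfl⟩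
  · intro d
    obtain ⟨w, hw, hd⟩ := h2 d
    obtain ⟨r, rfl⟩ := (hi _).1 hw
    obtain ⟨s, hs, hww⟩ := hK3 r
    refine ⟨i s, ⟨s, hs, rfl⟩, ?_⟩
    have : d - i s = (d - i r) + (i r - i s) := by ring
    rw [this]
    exact Ideal.add_mem _ hd (Ideal.pow_le_self hn hww)
  · rintro _ ⟨w, hwK, rfl⟩ hwm
    obtain ⟨a, ha, b, hb, rfl⟩ := Submodule.mem_sup.1 (hK1 _ hwK hwm)
    obtain ⟨u, rfl⟩ := Ideal.mem_span_singleton'.1 ha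
    obtain ⟨s, hs, hus⟩ := hK3 u
    refine ⟨i s, ⟨s, hs, rfl⟩, ?_⟩
    have : i (u * (p : R) + b) - p * i s = i b + p * (i u - i s) := by
      simp only [map_add, map_mul, map_natCast]; ring
    rw [this]
    refine Ideal.add_mem _ hb ?_
    rw [pow_succ']
    exact Ideal.mul_mem_mul hp hus
  · rintro _ ⟨r, -, rfl⟩
    exact (hi _).2 ⟨r, rfl⟩
  · intro w hw
    obtain ⟨r, rfl⟩ := (hi _).1 hw
    obtain ⟨s, hs, h⟩ := hK3 r
    exact ⟨i s, ⟨s, hs, rfl⟩, h⟩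

theorem IsCoeffSubring.exists_succ {D : Type*} [CommRing D] [IsLocalRing D] {p n : ℕ}
    [Fact p.Prime] (hp : (p : D) ∈ maximalIdeal D) (hn : n ≠ 0) {W : Subring D}
    (hW : IsCoeffSubring p n W) :
    ∃ W' : Subring D, IsCoeffSubring p (n + 1) W' ∧ W' ≤ W ∧
      ∀ w ∈ W, ∃ w' ∈ W', w - w' ∈ maximalIdeal D ^ n :=
  hW.exists_succ_aux hp hn W.subtype fun x => by simp

theorem isCoeffSubring_one {D : Type*} [CommRing D] [IsLocalRing D] (p : ℕ) :
    IsCoeffSubring (D := D) p 1 ⊤ := by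
  refine ⟨fun x _ => Subring.mem_top x, fun d => ⟨d, Subring.mem_top d, by simp⟩,
    fun w _ hw => ⟨0, Subring.zero_mem _, by simpa using hw⟩⟩

theorem exists_adic_limit {D : Type*} [CommRing D] (I : Ideal D) [IsAdicComplete I D] (f : ℕ → D)
    (h : ∀ n, f n - f (n + 1) ∈ I ^ n) : ∃ L, ∀ n, f n - L ∈ I ^ n := by
  have h' : ∀ k n, f n - f (n + k) ∈ I ^ n := by
    intro k n
    induction k with
    | zero => simp
    | succ k ih =>
      have := Ideal.add_mem _ ih (Ideal.pow_le_pow_right (Nat.le_add_right n k) (h (n + k)))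
      simpa [add_assoc] using this
  obtain ⟨L, hL⟩ := IsPrecomplete.prec (I := I) (M := D) inferInstance (f := f) (by
    intro m n hmn
    rw [SModEq.sub_mem]
    obtain ⟨k, rfl⟩ := Nat.exists_eq_add_of_le hmn
    simpa using h' k m)
  refine ⟨L, fun n => ?_⟩
  have := hL n
  rw [SModEq.sub_mem] at this
  simpa using this

theorem eq_zero_of_forall_mem_pow {D : Type*} [CommRing D] (I : Ideal D) [IsHausdorff I D] {x : D}
    (h : ∀ n, x ∈ I ^ n) : x = 0 :=
  IsHausdorff.haus (I := I) inferInstance x fun n => by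
    rw [SModEq.sub_mem]; simpa using h n

theorem mem_of_forall_mem_sup_pow {D : Type*} [CommRing D] [IsLocalRing D] [IsNoetherianRing D]
    (I : Ideal D) {x : D} (h : ∀ n, x ∈ I ⊔ maximalIdeal D ^ n) : x ∈ I := by
  have : IsHausdorff (maximalIdeal D) (D ⧸ I) :=
    IsHausdorff.of_isLocalRing (maximalIdeal D) _ (IsLocalRing.maximalIdeal.isMaximal D).ne_top
  rw [← Ideal.Quotient.eq_zero_iff_mem]
  refine IsHausdorff.haus this _ fun n => ?_
  rw [SModEq.sub_mem, sub_zero]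
  obtain ⟨a, ha, b, hb, hx⟩ := Submodule.mem_sup.1 (h n)
  have : Ideal.Quotient.mk I x = b • (1 : D ⧸ I) := by
    rw [← hx, map_add, Ideal.Quotient.eq_zero_iff_mem.2 ha, zero_add, Algebra.smul_def, mul_one]
    rfl
  rw [this]
  exact Submodule.smul_mem_smul hb trivial

/-- The data of a coefficient ring of a local ring `D`. -/
structure CoeffRing (D : Type) [CommRing D] [IsLocalRing D] (V : Type) [CommRing V] where
  φ : V →+* D
  inj : Function.Injective φ
  ϖ : V
  mem : φ ϖ ∈ maximalIdeal D
  isDomain : IsDomain V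
  isPID : IsPrincipalIdealRing V
  isLocal : IsLocalRing V
  max : ∀ v, ¬ IsUnit v → ϖ ∣ v
  surj : ∀ d, ∃ v, d - φ v ∈ maximalIdeal D
  isAdicComplete : IsAdicComplete (Ideal.span {ϖ}) V

theorem exists_coeffRing_of_charZero (D : Type) [CommRing D] [IsLocalRing D]
    [IsAdicComplete (maximalIdeal D) D] (h : CharZero (ResidueField D)) :
    ∃ (V : Type) (_ : CommRing V), Nonempty (CoeffRing D V) := by
  have hu : ∀ n : ℕ, n ≠ 0 → IsUnit (n : D) := by
    intro n hn
    by_contra hc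
    have := (residue_eq_zero_iff (n : D)).2 hc
    rw [map_natCast] at this
    exact hn (Nat.cast_eq_zero.1 this)
  have hQ : ∃ _ : Algebra ℚ D, True := by
    have : ∀ n : nonZeroDivisors ℤ, IsUnit (Int.castRingHom D n) := by
      rintro ⟨n, hn⟩
      have hn0 : n ≠ 0 := nonZeroDivisors.ne_zero hn
      have := hu n.natAbs (by omega)
      change IsUnit (Int.castRingHom D n)
      rcases Int.natAbs_eq n with h | h <;> rw [h] <;> simpa using this
    exact ⟨(IsLocalization.lift (M := nonZeroDivisors ℤ) (S := ℚ) this).toAlgebra, trivial⟩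
  obtain ⟨_, -⟩ := hQ
  let k := ResidueField D
  have : Algebra.FormallySmooth ℚ k := by
    obtain ⟨s, hs⟩ := exists_isTranscendenceBasis ℚ k
    have halg : Algebra.IsAlgebraic
        (IntermediateField.adjoin ℚ (Set.range ((↑) : s → k))) k := by
      exact hs.isAlgebraic_field
    have : Algebra.IsSeparable (IntermediateField.adjoin ℚ (Set.range ((↑) : s → k))) k :=
      inferInstance
    exact .of_algebraicIndependent_of_isSeparable hs.1
  obtain ⟨g, hg⟩ := Algebra.FormallySmooth.exists_mkₐ_comp_eq_of_isAdicComplete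
    (R := ℚ) (S := D) (I := maximalIdeal D) (A := k)
    (RingHom.toRatAlgHom (RingHom.id k : k →+* D ⧸ maximalIdeal D))
  refine ⟨k, inferInstance, ⟨⟨g.toRingHom, g.toRingHom.injective, 0, by simp, inferInstance,
    inferInstance, inferInstance, ?_, ?_, ?_⟩⟩⟩
  · intro v hv
    rw [isUnit_iff_ne_zero, not_not] at hv
    rw [hv]
  · intro d
    refine ⟨residue D d, ?_⟩
    have h1 := AlgHom.congr_fun hg (residue D d)
    rw [← Ideal.Quotient.eq_zero_iff_mem, map_sub, sub_eq_zero]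
    exact h1.symm
  · rw [Ideal.span_singleton_zero]
    infer_instance

theorem exists_coeffRing_of_mem (D : Type) [CommRing D] [IsDomain D] [IsLocalRing D]
    [IsNoetherianRing D] [IsAdicComplete (maximalIdeal D) D] (p : ℕ) [Fact p.Prime]
    (hp : (p : D) ∈ maximalIdeal D) :
    ∃ (V : Type) (_ : CommRing V), Nonempty (CoeffRing D V) := by
  set m := maximalIdeal D with hm
  choose! nxt hnxt using fun (n : ℕ) (W : Subring D) (h : IsCoeffSubring p (n + 1) W) =>
    h.exists_succ hp n.succ_ne_zero
  let W : ℕ → Subring D := fun n => Nat.rec ⊤ (fun n W => nxt n W) n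
  have hW : ∀ n, IsCoeffSubring p (n + 1) (W n) := by
    intro n
    induction n with
    | zero => exact isCoeffSubring_one p
    | succ n ih => exact (hnxt n _ ih).1
  have hWle : ∀ n, W (n + 1) ≤ W n := fun n => (hnxt n _ (hW n)).2.1
  have hWanti : Antitone W := antitone_nat_of_succ_le hWle
  have hWs : ∀ n, ∀ w ∈ W n, ∃ w' ∈ W (n + 1), w - w' ∈ m ^ (n + 1) :=
    fun n => (hnxt n _ (hW n)).2.2
  let V : Subring D := ⨅ n, W n
  have hV : ∀ x, x ∈ V ↔ ∀ n, x ∈ W n := fun x => by simp [V, Subring.mem_iInf]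
  have approx : ∀ n, ∀ w ∈ W n, ∃ v ∈ V, w - v ∈ m ^ (n + 1) := by
    intro n w hw
    choose! g hg1 hg2 using hWs
    let f : ℕ → D := fun k => Nat.rec w (fun k x => g (n + k) x) k
    have hf : ∀ k, f k ∈ W (n + k) := by
      intro k
      induction k with
      | zero => exact hw
      | succ k ih => exact hg1 _ _ ih
    have hf2 : ∀ k, f k - f (k + 1) ∈ m ^ (n + k + 1) := fun k => hg2 _ _ (hf k)
    obtain ⟨L, hL⟩ := exists_adic_limit m f
      fun k => Ideal.pow_le_pow_right (by omega) (hf2 k)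
    refine ⟨L, (hV L).2 fun j => ?_, ?_⟩
    · have h1 := hL (j + 1)
      have h2 : f (j + 1) ∈ W j := hWanti (show j ≤ n + (j + 1) by omega) (hf (j + 1))
      have h3 := (hW j).1 _ h1
      simpa using (W j).sub_mem h2 h3
    · have h0 : ∀ k, f 0 - f k ∈ m ^ (n + 1) := by
        intro k
        induction k with
        | zero => simp
        | succ k ih =>
          have := Ideal.add_mem _ ih
            (Ideal.pow_le_pow_right (show n + 1 ≤ n + k + 1 by omega) (hf2 k))
          simpa using this
      have := Ideal.add_mem _ (h0 (n + 1)) (hL (n + 1))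
      rwa [sub_add_sub_cancel] at this
  have closed : ∀ x, (∀ n, ∃ v ∈ V, x - v ∈ m ^ n) → x ∈ V := by
    intro x hx
    refine (hV x).2 fun n => ?_
    obtain ⟨v, hv, h⟩ := hx (n + 1)
    simpa using (W n).add_mem ((hW n).1 _ h) ((hV v).1 hv n)
  have hVm : ∀ v ∈ V, v ∈ m → ∃ u ∈ V, v = p * u := by
    intro v hv hvm
    have h1 : ∀ n, ∃ u ∈ V, v - p * u ∈ m ^ (n + 1) := by
      intro n
      obtain ⟨u, hu, h⟩ := (hW n).2.2 v ((hV v).1 hv n) hvm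
      obtain ⟨u', hu', h'⟩ := approx n u hu
      refine ⟨u', hu', ?_⟩
      have := Ideal.add_mem _ h (Ideal.mul_mem_left _ (p : D) h')
      convert this using 1; ring
    choose u hu h1 using h1
    by_cases hp0 : (p : D) = 0
    · refine ⟨0, V.zero_mem, ?_⟩
      rw [mul_zero]
      refine eq_zero_of_forall_mem_pow m fun n => ?_
      have := h1 n
      rw [hp0, zero_mul, sub_zero] at this
      exact Ideal.pow_le_pow_right (Nat.le_succ n) this
    have h2 : v ∈ Ideal.span {(p : D)} := by
      refine mem_of_forall_mem_sup_pow _ fun n => ?_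
      have : v = p * u n + (v - p * u n) := by ring
      rw [this]
      exact Ideal.add_mem _
        (Ideal.mem_sup_left (Ideal.mul_mem_right _ _ (Ideal.mem_span_singleton_self _)))
        (Ideal.mem_sup_right (Ideal.pow_le_pow_right (Nat.le_succ n) (h1 n)))
    obtain ⟨d, hd⟩ := Ideal.mem_span_singleton'.1 h2
    refine ⟨d, closed d fun n => ?_, by rw [← hd, mul_comm]⟩
    obtain ⟨c, hc⟩ := Ideal.exists_pow_inf_eq_pow_smul m (Ideal.span {(p : D)} : Submodule D D)
    refine ⟨u (n + c), hu _, ?_⟩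
    have h3 : (p : D) * (d - u (n + c)) ∈
        (m ^ (n + c) • ⊤ ⊓ Ideal.span {(p : D)} : Submodule D D) := by
      refine ⟨?_, Ideal.mul_mem_right _ _ (Ideal.mem_span_singleton_self _)⟩
      have := h1 (n + c)
      rw [← hd] at this
      have := Ideal.pow_le_pow_right (Nat.le_succ (n + c)) this
      simp only [smul_eq_mul, Ideal.mul_top]
      rw [mul_sub, mul_comm _ d]
      exact this
    rw [hc _ (Nat.le_add_left c n), Nat.add_sub_cancel] at h3
    have h4 : (p : D) * (d - u (n + c)) ∈ m ^ n * Ideal.span {(p : D)} :=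
      Ideal.mul_mono_right inf_le_right h3
    rw [mul_comm (m ^ n), Ideal.mem_span_singleton_mul] at h4
    obtain ⟨z, hz, h5⟩ := h4
    rwa [← mul_left_cancel₀ hp0 h5]
  have hVs : ∀ d, ∃ v ∈ V, d - v ∈ m := by
    intro d
    obtain ⟨v, hv, h⟩ := approx 0 d (Subring.mem_top d)
    exact ⟨v, hv, by simpa using h⟩
  have hinv1 : ∀ t ∈ V, ∃ s ∈ V, (1 - p * t) * s = 1 := by
    intro t ht
    have hpt : (p : D) * t ∈ m := Ideal.mul_mem_right _ _ hp
    obtain ⟨s, hs⟩ := (isUnit_one_sub_self_of_mem_nonunits _ hpt).exists_right_inv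
    refine ⟨s, closed s fun n => ⟨∑ i ∈ Finset.range n, (p * t) ^ i, ?_, ?_⟩, hs⟩
    · exact sum_mem fun i _ => pow_mem (mul_mem (natCast_mem _ _) ht) _
    · have h2 := geom_sum_mul_neg ((p : D) * t) n
      have : s - ∑ i ∈ Finset.range n, ((p : D) * t) ^ i = (p * t) ^ n * s := by
        linear_combination (∑ i ∈ Finset.range n, ((p : D) * t) ^ i) * hs - s * h2
      rw [this]
      exact Ideal.mul_mem_right _ _ (Ideal.pow_mem_pow hpt n)
  have hinv : ∀ v ∈ V, v ∉ m → ∃ w ∈ V, v * w = 1 := by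
    intro v hv hvm
    have hvu : IsUnit v := by simpa [hm] using hvm
    obtain ⟨d, hd⟩ := hvu.exists_right_inv
    obtain ⟨w, hw, hdw⟩ := hVs d
    have h1 : 1 - v * w ∈ m := by
      have := Ideal.mul_mem_left _ v hdw
      rwa [mul_sub, hd] at this
    obtain ⟨t, ht, h2⟩ := hVm _ (V.sub_mem V.one_mem (V.mul_mem hv hw)) h1
    obtain ⟨s, hs, h3⟩ := hinv1 t ht
    refine ⟨w * s, V.mul_mem hw hs, ?_⟩
    rw [← h3, ← h2]; ring
  have hunit : ∀ v : V, IsUnit v ↔ (v : D) ∉ m := by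
    intro v
    constructor
    · intro h
      have := h.map V.subtype
      simpa [hm] using this
    · intro h
      obtain ⟨w, hw, h'⟩ := hinv v v.2 h
      exact IsUnit.of_mul_eq_one ⟨w, hw⟩ (Subtype.ext h')
  have hloc : IsLocalRing V := by
    refine IsLocalRing.of_nonunits_add fun a b ha hb => ?_
    simp only [mem_nonunits_iff, hunit, not_not] at ha hb ⊢
    exact Ideal.add_mem _ ha hb
  have hmax : ∀ v : V, ¬ IsUnit v → (p : V) ∣ v := by
    intro v hv
    rw [hunit, not_not] at hv
    obtain ⟨u, hu, h⟩ := hVm v v.2 hv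
    exact ⟨⟨u, hu⟩, Subtype.ext h⟩
  have hnat : (((p : V) : V) : D) = p := by simp
  have hPID : IsPrincipalIdealRing V := by
    by_cases hp0 : (p : D) = 0
    · have : IsField V := by
        refine ⟨⟨0, 1, zero_ne_one⟩, mul_comm, fun {a} ha => ?_⟩
        by_contra hc
        obtain ⟨u, hu⟩ := hmax a (fun h => hc h.exists_right_inv)
        refine ha ?_
        have hp0' : (p : V) = 0 := Subtype.ext (hnat.trans hp0)
        rw [hu, hp0', zero_mul]
      let _ := this.toField
      infer_instance
    · have hp0' : (p : V) ≠ 0 := fun h => hp0 (by rw [← hnat, h]; rfl)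
      have hpu : ¬ IsUnit (p : V) := by rw [hunit, not_not, hnat]; exact hp
      have hprime : Prime (p : V) := by
        refine ⟨hp0', hpu, fun a b hab => ?_⟩
        by_contra! hc
        have ha := not_imp_comm.1 (hmax a) hc.1
        have hb := not_imp_comm.1 (hmax b) hc.2
        exact hpu (isUnit_of_dvd_unit hab (ha.mul hb))
      have : IsDiscreteValuationRing V := by
        refine IsDiscreteValuationRing.ofHasUnitMulPowIrreducibleFactorization
          ⟨p, hprime.irreducible, fun {x} hx => ?_⟩
        by_contra! hc
        have : ∀ n, (p : V) ^ n ∣ x := by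
          intro n
          induction n with
          | zero => simp
          | succ n ih =>
            obtain ⟨y, rfl⟩ := ih
            by_cases hy : IsUnit y
            · exact absurd ⟨hy.unit, by simp⟩ (hc n)
            · rw [pow_succ]; exact mul_dvd_mul_left _ (hmax y hy)
        refine hx (Subtype.ext (eq_zero_of_forall_mem_pow m fun n => ?_))
        obtain ⟨y, hy⟩ := this n
        rw [hy, Subring.coe_mul, Subring.coe_pow, hnat]
        exact Ideal.mul_mem_right _ _ (Ideal.pow_mem_pow hp n)
      infer_instance
  refine ⟨V, inferInstance, ⟨⟨V.subtype, Subtype.val_injective, p, ?_, inferInstance, hPID, hloc,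
    hmax, ?_, ?_⟩⟩⟩
  · rw [Subring.subtype_apply, hnat]; exact hp
  · intro d
    obtain ⟨v, hv, h⟩ := hVs d
    exact ⟨⟨v, hv⟩, h⟩
  have hdiv : (p : D) ≠ 0 → ∀ n : ℕ, ∀ v : V, (v : D) ∈ Ideal.span {(p : D)} ^ n →
      v ∈ Ideal.span {(p : V)} ^ n := by
    intro hp0 n
    induction n with
    | zero => simp
    | succ n ih =>
      intro v hv
      rw [Ideal.span_singleton_pow, Ideal.mem_span_singleton] at hv
      have hpn : (p : D) ^ (n + 1) ∈ m := Ideal.pow_mem_of_mem _ hp _ n.succ_pos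
      obtain ⟨u, hu, h⟩ := hVm v v.2 (Ideal.mem_of_dvd _ hv hpn)
      rw [h, pow_succ', mul_dvd_mul_iff_left hp0] at hv
      have h1 := ih ⟨u, hu⟩ (by rwa [Ideal.span_singleton_pow, Ideal.mem_span_singleton])
      have h2 : v = (p : V) * ⟨u, hu⟩ := Subtype.ext h
      rw [h2, pow_succ']
      exact Ideal.mul_mem_mul (Ideal.mem_span_singleton_self _) h1
  by_cases hp0 : (p : D) = 0
  · have hp0' : (p : V) = 0 := Subtype.ext (hnat.trans hp0)
    rw [hp0', Ideal.span_singleton_zero]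
    infer_instance
  have hle : ∀ n : ℕ, Ideal.span {(p : V)} ^ n ≤ (Ideal.span {(p : D)} ^ n).comap V.subtype := by
    intro n
    rw [Ideal.span_singleton_pow, Ideal.span_singleton_pow, Ideal.span_le,
      Set.singleton_subset_iff]
    have h3 : V.subtype ((p : V) ^ n) = (p : D) ^ n := by rw [map_pow, Subring.subtype_apply, hnat]
    exact Ideal.mem_comap.2 (h3 ▸ Ideal.mem_span_singleton_self _)
  have hpm : ∀ n : ℕ, Ideal.span {(p : D)} ^ n ≤ m ^ n := fun n =>
    Ideal.pow_right_mono ((Ideal.span_singleton_le_iff_mem _).2 hp) n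
  refine @IsAdicComplete.mk _ _ _ _ _ _ ⟨fun x hx => ?_⟩ ⟨fun f hf => ?_⟩
  · refine Subtype.ext (eq_zero_of_forall_mem_pow m fun n => hpm n (hle n ?_))
    have := hx n
    rw [SModEq.sub_mem] at this
    simpa using this
  · have hf' : ∀ k n, k ≤ n → f k - f n ∈ Ideal.span {(p : V)} ^ k := by
      intro k n hkn
      have := hf hkn
      rw [SModEq.sub_mem] at this
      simpa using this
    obtain ⟨L, hL⟩ := exists_adic_limit m (fun n => (f n : D)) fun n =>
      hpm n (hle n (hf' n (n + 1) n.le_succ))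
    have hLV : L ∈ V := closed L fun n => ⟨f n, (f n).2, by
      rw [← neg_sub]; exact neg_mem (hL n)⟩
    refine ⟨⟨L, hLV⟩, fun n => ?_⟩
    rw [SModEq.sub_mem]
    simp only [smul_eq_mul, Ideal.mul_top]
    refine hdiv hp0 n _ (mem_of_forall_mem_sup_pow _ fun k => ?_)
    have h3 : ((f n - ⟨L, hLV⟩ : V) : D) = (f n - f (n + k)) + (f (n + k) - L) := by
      simp
    rw [h3]
    exact Ideal.add_mem _ (Ideal.mem_sup_left (hle n (hf' n _ (Nat.le_add_right n k))))
      (Ideal.mem_sup_right (Ideal.pow_le_pow_right (Nat.le_add_left k n) (hL _)))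

theorem exists_coeffRing (D : Type) [CommRing D] [IsDomain D] [IsLocalRing D]
    [IsNoetherianRing D] [IsAdicComplete (maximalIdeal D) D] :
    ∃ (V : Type) (_ : CommRing V), Nonempty (CoeffRing D V) := by
  obtain ⟨p, hp⟩ := CharP.exists (ResidueField D)
  rcases Nat.eq_zero_or_pos p with rfl | hpos
  · exact exists_coeffRing_of_charZero D (CharP.charP_to_charZero _)
  · have : Fact p.Prime := ⟨(CharP.char_is_prime_or_zero (ResidueField D) p).resolve_right hpos.ne'⟩
    refine exists_coeffRing_of_mem D p ?_
    rw [← residue_eq_zero_iff, map_natCast]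
    exact CharP.cast_eq_zero _ _

/-- An elementwise form of complete integral closedness. -/
def IsCIC (R : Type*) [CommRing R] : Prop :=
  ∀ a b c : R, b ≠ 0 → c ≠ 0 → (∀ n : ℕ, b ^ n ∣ c * a ^ n) → b ∣ a

theorem isCIC_of_ufm (R : Type*) [CommRing R] [IsDomain R] [UniqueFactorizationMonoid R] :
    IsCIC R := by
  intro a b c hb hc h
  obtain ⟨a', b', g, hrel, rfl, rfl⟩ := UniqueFactorizationMonoid.exists_reduced_factors' a b hb
  have hg : g ≠ 0 := fun h => hb (by rw [h, zero_mul])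
  refine mul_dvd_mul_left _ ?_
  have h1 : ∀ n : ℕ, b' ^ n ∣ c := by
    intro n
    have h2 := h n
    rw [mul_pow, mul_pow, mul_left_comm] at h2
    have h3 := (mul_dvd_mul_iff_left (pow_ne_zero n hg)).1 h2
    exact (hrel.symm.pow (m := n) (n := n)).dvd_of_dvd_mul_right h3
  have hu : IsUnit b' := by
    by_contra hu
    obtain ⟨n, hn⟩ := FiniteMultiplicity.of_not_isUnit hu hc
    exact hn (h1 (n + 1))
  exact hu.dvd

theorem IsCIC.isInteger {R K : Type*} [CommRing R] [IsDomain R] [Field K] [Algebra R K]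
    [IsFractionRing R K] (hR : IsCIC R) {c : R} (hc : c ≠ 0) {v : K}
    (h : ∀ n : ℕ, ∃ r : R, algebraMap R K r = algebraMap R K c * v ^ n) :
    ∃ r : R, algebraMap R K r = v := by
  obtain ⟨a, b, hb, rfl⟩ := IsFractionRing.div_surjective (A := R) v
  have hb0 : b ≠ 0 := nonZeroDivisors.ne_zero hb
  have hb1 : algebraMap R K b ≠ 0 := by simpa using hb0
  obtain ⟨r, rfl⟩ := hR a b c hb0 hc fun n => by
    obtain ⟨r, hr⟩ := h n
    refine ⟨r, IsFractionRing.injective R K ?_⟩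
    rw [map_mul, map_mul, map_pow, map_pow, hr, div_pow]
    field_simp
  exact ⟨r, by rw [map_mul]; field_simp⟩

theorem IsCIC.isIntegrallyClosed {R : Type*} [CommRing R] [IsDomain R] (hR : IsCIC R) :
    IsIntegrallyClosed R := by
  rw [isIntegrallyClosed_iff (FractionRing R)]
  intro x hx
  obtain ⟨c, hc, h⟩ := FractionalIdeal.isFractional_adjoin_integral (nonZeroDivisors R) x hx
  refine hR.isInteger (nonZeroDivisors.ne_zero hc) fun n => ?_
  obtain ⟨r, hr⟩ := h (x ^ n) (Subalgebra.pow_mem _ (Algebra.self_mem_adjoin_singleton R x) n)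
  exact ⟨r, by rw [hr, Algebra.smul_def]⟩

open PowerSeries in
theorem IsCIC.powerSeries {R : Type*} [CommRing R] [IsDomain R] (hR : IsCIC R) :
    IsCIC (PowerSeries R) := by
  intro a b c hb hc h
  let K := FractionRing R
  let i : R⟦X⟧ →+* K⟦X⟧ := PowerSeries.map (algebraMap R K)
  have hi : Function.Injective i := PowerSeries.map_injective _ (IsFractionRing.injective R K)
  have hrange : ∀ f : K⟦X⟧, f ∈ i.range ↔ ∀ n, ∃ r, algebraMap R K r = coeff n f := by
    intro f
    constructor
    · rintro ⟨g, rfl⟩ n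
      exact ⟨coeff n g, by simp [i]⟩
    · intro hf
      choose r hr using hf
      exact ⟨PowerSeries.mk r, by ext n; simp [i, hr]⟩
  have hb' : i b ≠ 0 := (map_ne_zero_iff i hi).2 hb
  have hc' : i c ≠ 0 := (map_ne_zero_iff i hi).2 hc
  obtain ⟨u, hu⟩ := isCIC_of_ufm K⟦X⟧ (i a) (i b) (i c) hb' hc' fun n => by
    simpa using map_dvd i (h n)
  have hcu : ∀ n : ℕ, i c * u ^ n ∈ i.range := by
    intro n
    obtain ⟨w, hw⟩ := h n
    refine ⟨w, mul_left_cancel₀ (pow_ne_zero n hb') ?_⟩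
    rw [← map_pow, ← map_mul, ← hw, map_mul, map_pow, map_pow, hu]
    ring
  have hu' : u ∈ i.range := by
    rw [hrange]
    intro k
    induction k using Nat.strong_induction_on with
    | _ k ih =>
      choose! r hr using ih
      let u0 : R⟦X⟧ := PowerSeries.mk fun n => if n < k then r n else 0
      obtain ⟨u', hu'⟩ : X ^ k ∣ u - i u0 := by
        rw [X_pow_dvd_iff]
        intro m hm
        simp [i, u0, hm, hr]
      have h1 : ∀ n : ℕ, i c * (u - i u0) ^ n ∈ i.range := by
        intro n
        rw [sub_eq_add_neg, add_pow, Finset.mul_sum]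
        refine sum_mem fun j _ => ?_
        have : i c * (u ^ j * (-i u0) ^ (n - j) * (n.choose j : K⟦X⟧)) =
            (i c * u ^ j) * i ((-u0) ^ (n - j) * (n.choose j : R⟦X⟧)) := by
          simp only [map_mul, map_pow, map_neg, map_natCast]; ring
        rw [this]
        exact mul_mem (hcu j) ⟨_, rfl⟩
      have h2 : ∀ n : ℕ, i c * u' ^ n ∈ i.range := by
        intro n
        rw [hrange]
        intro l
        obtain ⟨r, hr⟩ := (hrange _).1 (h1 n) (l + k * n)
        refine ⟨r, hr.trans ?_⟩
        rw [hu', mul_pow, ← pow_mul, mul_left_comm, coeff_X_pow_mul]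
      obtain ⟨c', hc1⟩ : ∃ c', c = X ^ c.order.toNat * c' := by
        exact X_pow_order_dvd
      set j := c.order.toNat
      have hc2 : coeff 0 c' ≠ 0 := by
        intro h0
        have hcj : coeff j c ≠ 0 := coeff_order hc
        rw [hc1, coeff_X_pow_mul'] at hcj
        simp [h0] at hcj
      have h3 : ∀ n : ℕ, ∃ r,
          algebraMap R K r = algebraMap R K (coeff 0 c') * (coeff 0 u') ^ n := by
        intro n
        obtain ⟨r, hr⟩ := (hrange _).1 (h2 n) j
        refine ⟨r, hr.trans ?_⟩
        have h4 : i c * u' ^ n = X ^ j * (i c' * u' ^ n) := by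
          rw [hc1, map_mul, map_pow]
          simp [i, mul_assoc]
        rw [h4, coeff_X_pow_mul']
        have h5 : constantCoeff (i c') = algebraMap R K (constantCoeff c') := by
          rw [← coeff_zero_eq_constantCoeff_apply, coeff_map, coeff_zero_eq_constantCoeff_apply]
        simp [h5]
      obtain ⟨r, hr⟩ := hR.isInteger hc2 h3
      refine ⟨r + coeff k u0, ?_⟩
      have : u = X ^ k * u' + i u0 := by rw [← hu']; ring
      rw [this, map_add, map_add, coeff_X_pow_mul', hr]
      simp [i]
  obtain ⟨w, rfl⟩ := hu'
  exact ⟨w, hi (by rw [hu, map_mul])⟩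

theorem exists_powerSeries_hom {S D : Type*} [CommRing S] [CommRing D] (ψ : S →+* D) {I : Ideal D}
    [IsAdicComplete I D] {x : D} (hx : x ∈ I) :
    ∃ ψ' : PowerSeries S →+* D, (∀ s, ψ' (PowerSeries.C s) = ψ s) ∧ ψ' PowerSeries.X = x := by
  let e : ℕ → PowerSeries S → D := fun n f => (PowerSeries.trunc n f).eval₂ ψ x
  have hdvd : ∀ n (q : Polynomial S), Polynomial.X ^ n ∣ q → q.eval₂ ψ x ∈ I ^ n := by
    rintro n _ ⟨q, rfl⟩
    rw [Polynomial.eval₂_mul, Polynomial.eval₂_X_pow]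
    exact Ideal.mul_mem_right _ _ (Ideal.pow_mem_pow hx n)
  have he : ∀ n (f : PowerSeries S) (q : Polynomial S), (∀ m < n, q.coeff m = f.coeff m) →
      e n f - q.eval₂ ψ x ∈ I ^ n := by
    intro n f q h
    rw [← Polynomial.eval₂_sub]
    refine hdvd n _ (Polynomial.X_pow_dvd_iff.2 fun m hm => ?_)
    rw [Polynomial.coeff_sub, PowerSeries.coeff_trunc, if_pos hm, h m hm, sub_self]
  have hlim : ∀ f, ∃ L, ∀ n, e n f - L ∈ I ^ n := fun f => by
    refine exists_adic_limit I (fun n => e n f) fun n => he n f _ fun m hm => ?_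
    rw [PowerSeries.coeff_trunc, if_pos (by omega)]
  choose L hL using hlim
  have huniq : ∀ f y, (∀ n, e n f - y ∈ I ^ n) → L f = y := by
    intro f y h
    rw [← sub_eq_zero]
    refine eq_zero_of_forall_mem_pow I fun n => ?_
    have := sub_mem (h n) (hL f n)
    rwa [sub_sub_sub_cancel_left] at this
  have hpoly : ∀ f (q : Polynomial S), (∀ m, q.coeff m = f.coeff m) → L f = q.eval₂ ψ x :=
    fun f q h => huniq f _ fun n => he n f q fun m _ => h m
  refine ⟨⟨⟨⟨L, ?_⟩, ?_⟩, ?_, ?_⟩, ?_, ?_⟩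
  · rw [hpoly 1 1 fun m => by simp [Polynomial.coeff_one, PowerSeries.coeff_one]]
    simp
  · intro f g
    refine huniq _ _ fun n => ?_
    have h1 := he n (f * g) (PowerSeries.trunc n f * PowerSeries.trunc n g) fun m hm => by
      rw [Polynomial.coeff_mul, PowerSeries.coeff_mul]
      refine Finset.sum_congr rfl fun ij hij => ?_
      have := Finset.HasAntidiagonal.mem_antidiagonal.1 hij
      rw [PowerSeries.coeff_trunc, PowerSeries.coeff_trunc, if_pos (by omega), if_pos (by omega)]
    rw [Polynomial.eval₂_mul] at h1
    have h2 : e n (f * g) - L f * L g = (e n (f * g) - e n f * e n g) +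
        ((e n f - L f) * e n g + L f * (e n g - L g)) := by ring
    rw [h2]
    exact add_mem h1 (add_mem (Ideal.mul_mem_right _ _ (hL f n)) (Ideal.mul_mem_left _ _ (hL g n)))
  · change L 0 = 0
    rw [hpoly 0 0 fun m => by simp]
    simp
  · intro f g
    refine huniq _ _ fun n => ?_
    have h2 : e n (f + g) - (L f + L g) = (e n f - L f) + (e n g - L g) := by
      simp only [e, map_add, Polynomial.eval₂_add]; ring
    rw [h2]
    exact add_mem (hL f n) (hL g n)
  · intro s
    change L _ = _
    rw [hpoly _ (Polynomial.C s) fun m => by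
      simp [Polynomial.coeff_C, PowerSeries.coeff_C]]
    simp
  · change L _ = _
    rw [hpoly _ Polynomial.X fun m => by
      simp [Polynomial.coeff_X, PowerSeries.coeff_X, eq_comm]]
    simp

/-- `D` is generated by the finite set `G` modulo `J` over the image of `ψ`. -/
def GenMod {S D : Type*} [CommRing S] [CommRing D] (ψ : S →+* D) (G : Finset D) (J : Ideal D) :
    Prop :=
  ∀ d, ∃ c : D → S, d - ∑ g ∈ G, ψ (c g) * g ∈ J

theorem GenMod.of_isAdicComplete {S D : Type*} [CommRing S] [CommRing D] [IsLocalRing D]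
    [IsNoetherianRing D] {ψ : S →+* D} {G : Finset D} {J : Ideal D} {x : S}
    [IsAdicComplete (Ideal.span {x}) S] (hx : ψ x ∈ maximalIdeal D)
    (h : GenMod ψ G (J ⊔ Ideal.span {ψ x})) : GenMod ψ G J := by
  have h' : ∀ d, ∃ c : D → S, ∃ d', d - ∑ g ∈ G, ψ (c g) * g - ψ x * d' ∈ J := by
    intro d
    obtain ⟨c, hc⟩ := h d
    obtain ⟨j, hj, b, hb, hjb⟩ := Submodule.mem_sup.1 hc
    obtain ⟨d', rfl⟩ := Ideal.mem_span_singleton'.1 hb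
    exact ⟨c, d', by rw [← hjb]; convert hj using 1; ring⟩
  choose c nx hc using h'
  intro d
  let it : ℕ → D := fun n => nx^[n] d
  let r : ℕ → D → S := fun n g => ∑ k ∈ Finset.range n, x ^ k * c (it k) g
  have hr : ∀ n, d - ∑ g ∈ G, ψ (r n g) * g - ψ x ^ n * it n ∈ J := by
    intro n
    induction n with
    | zero => simp [r, it]
    | succ n ih =>
      have h1 := add_mem ih (Ideal.mul_mem_left _ (ψ x ^ n) (hc (it n)))
      have h2 : it (n + 1) = nx (it n) := Function.iterate_succ_apply' nx n d
      have h3 : ∑ g ∈ G, ψ (r (n + 1) g) * g =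
          ∑ g ∈ G, ψ (r n g) * g + ψ x ^ n * ∑ g ∈ G, ψ (c (it n) g) * g := by
        rw [Finset.mul_sum, ← Finset.sum_add_distrib]
        refine Finset.sum_congr rfl fun g _ => ?_
        simp only [r, Finset.sum_range_succ, map_add, map_mul, map_pow]
        ring
      rw [h2, h3]
      convert h1 using 1; ring
  have hlim : ∀ g, ∃ L, ∀ n, r n g - L ∈ Ideal.span {x} ^ n := fun g =>
    exists_adic_limit _ (fun n => r n g) fun n => by
      simp only [r, Finset.sum_range_succ, sub_add_cancel_left, neg_mem_iff]
      exact Ideal.mul_mem_right _ _ (Ideal.pow_mem_pow (Ideal.mem_span_singleton_self x) n)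
  choose L hL using hlim
  refine ⟨L, mem_of_forall_mem_sup_pow _ fun n => ?_⟩
  have h4 : ∀ g, ψ (r n g) - ψ (L g) ∈ maximalIdeal D ^ n := by
    intro g
    have h5 := hL g n
    rw [Ideal.span_singleton_pow] at h5
    obtain ⟨y, hy⟩ := Ideal.mem_span_singleton.1 h5
    rw [← map_sub, hy, map_mul, map_pow]
    exact Ideal.mul_mem_right _ _ (Ideal.pow_mem_pow hx n)
  have h6 : d - ∑ g ∈ G, ψ (L g) * g = (d - ∑ g ∈ G, ψ (r n g) * g - ψ x ^ n * it n) +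
      (ψ x ^ n * it n + ∑ g ∈ G, (ψ (r n g) - ψ (L g)) * g) := by
    simp only [sub_mul, Finset.sum_sub_distrib]; ring
  rw [h6]
  exact add_mem (Ideal.mem_sup_left (hr n)) (Ideal.mem_sup_right (add_mem
    (Ideal.mul_mem_right _ _ (Ideal.pow_mem_pow hx n))
    (sum_mem fun g _ => Ideal.mul_mem_right _ _ (h4 g))))

theorem exists_genMod_of_pow_le {S D : Type*} [CommRing S] [CommRing D] [IsLocalRing D]
    [IsNoetherianRing D] {ψ : S →+* D} (hψ : ∀ d, ∃ s, d - ψ s ∈ maximalIdeal D) (n : ℕ) :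
    ∃ G : Finset D, GenMod ψ G (maximalIdeal D ^ n) := by
  classical
  induction n with
  | zero => exact ⟨∅, fun d => ⟨0, by simp⟩⟩
  | succ n ih =>
    obtain ⟨G, hG⟩ := ih
    obtain ⟨H, hH⟩ := (isNoetherian_def.1 inferInstance (maximalIdeal D ^ n) :
      (maximalIdeal D ^ n).FG)
    choose σ hσ using hψ
    refine ⟨G ∪ H, fun d => ?_⟩
    obtain ⟨c, hc⟩ := hG d
    rw [← hH] at hc
    obtain ⟨f, -, hf⟩ := Submodule.mem_span_finset.1 hc
    refine ⟨fun g => (if g ∈ G then c g else 0) + (if g ∈ H then σ (f g) else 0), ?_⟩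
    have h1 : ∑ g ∈ G ∪ H, ψ ((if g ∈ G then c g else 0) + (if g ∈ H then σ (f g) else 0)) * g =
        ∑ g ∈ G, ψ (c g) * g + ∑ g ∈ H, ψ (σ (f g)) * g := by
      simp only [map_add, add_mul, Finset.sum_add_distrib, apply_ite ψ, map_zero, ite_mul, zero_mul]
      congr 1
      · rw [← Finset.sum_filter]
        congr 1
        ext g
        simp only [Finset.mem_filter, Finset.mem_union]
        tauto
      · rw [← Finset.sum_filter]
        congr 1
        ext g
        simp only [Finset.mem_filter, Finset.mem_union]
        tauto
    rw [h1, ← sub_sub, ← hf, ← Finset.sum_sub_distrib]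
    refine sum_mem fun g hg => ?_
    rw [smul_eq_mul, ← sub_mul, pow_succ']
    exact Ideal.mul_mem_mul (hσ _) (hH ▸ Submodule.subset_span hg)

theorem PowerSeries.prime_C {R : Type*} [CommRing R] {p : R} (hp : Prime p) :
    Prime (PowerSeries.C p) := by
  have hI : (Ideal.span {p}).IsPrime := (Ideal.span_singleton_prime hp.ne_zero).2 hp
  let f : PowerSeries R →+* PowerSeries (R ⧸ Ideal.span {p}) :=
    PowerSeries.map (Ideal.Quotient.mk _)
  have hf : ∀ g, PowerSeries.C p ∣ g ↔ f g = 0 := by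
    intro g
    constructor
    · rintro ⟨h, rfl⟩
      rw [map_mul, PowerSeries.map_C, Ideal.Quotient.eq_zero_iff_mem.2
        (Ideal.mem_span_singleton_self p), map_zero, zero_mul]
    · intro h
      have h1 : ∀ n, p ∣ PowerSeries.coeff n g := by
        intro n
        have := congrArg (PowerSeries.coeff n) h
        rwa [PowerSeries.coeff_map, map_zero, Ideal.Quotient.eq_zero_iff_mem,
          Ideal.mem_span_singleton] at this
      choose c hc using h1
      exact ⟨PowerSeries.mk c, by ext n; simp [hc]⟩
  refine ⟨?_, ?_, fun a b hab => ?_⟩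
  · rw [Ne, map_eq_zero_iff _ PowerSeries.C_injective]
    exact hp.ne_zero
  · intro h
    have := h.map (PowerSeries.constantCoeff (R := R))
    rw [PowerSeries.constantCoeff_C] at this
    exact hp.not_isUnit this
  · rw [hf, map_mul, mul_eq_zero] at hab
    rwa [hf, hf]

theorem dim_le_dim_quotient_add_one {R : Type*} [CommRing R] [IsLocalRing R] [IsNoetherianRing R]
    {x : R} (hx : x ∈ maximalIdeal R) :
    ringKrullDim R ≤ ringKrullDim (R ⧸ Ideal.span {x}) + 1 := by
  have h := ringKrullDim_le_ringKrullDim_quotient_add_card ({x} : Finset R) (by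
    rw [IsLocalRing.ringJacobson_eq_maximalIdeal]; simpa using hx)
  rwa [Finset.coe_singleton, Finset.card_singleton, Nat.cast_one] at h

theorem ringKrullDim_powerSeries_le {R : Type*} [CommRing R] [IsLocalRing R] [IsNoetherianRing R] :
    ringKrullDim (PowerSeries R) ≤ ringKrullDim R + 1 := by
  have hX : (PowerSeries.X : PowerSeries R) ∈ maximalIdeal (PowerSeries R) := by
    rw [mem_maximalIdeal, mem_nonunits_iff]
    exact PowerSeries.isUnit_iff_constantCoeff.not.2 (by simp)
  have h1 := dim_le_dim_quotient_add_one hX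
  have h2 : ringKrullDim (PowerSeries R ⧸ Ideal.span {(PowerSeries.X : PowerSeries R)}) ≤
      ringKrullDim R := by
    have : ∃ f : R →+* PowerSeries R ⧸ Ideal.span {(PowerSeries.X : PowerSeries R)},
        Function.Surjective f := by
      refine ⟨(Ideal.Quotient.mk _).comp PowerSeries.C, fun y => ?_⟩
      obtain ⟨g, rfl⟩ := Ideal.Quotient.mk_surjective y
      refine ⟨PowerSeries.constantCoeff g, ?_⟩
      rw [RingHom.comp_apply, Ideal.Quotient.eq, ← neg_mem_iff, neg_sub,
        Ideal.mem_span_singleton, PowerSeries.X_dvd_iff]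
      simp
    obtain ⟨f, hf⟩ := this
    exact ringKrullDim_le_of_surjective f hf
  exact h1.trans (by gcongr)

theorem exists_powerSeries_frame {D : Type} [CommRing D] [IsLocalRing D] [IsNoetherianRing D]
    [IsAdicComplete (maximalIdeal D) D] (xs : List D) (hxs : ∀ x ∈ xs, x ∈ maximalIdeal D) :
    ∀ (S : Type) [CommRing S] [IsDomain S] [IsLocalRing S] [IsNoetherianRing S] (_ : IsCIC S)
      (ψ : S →+* D), ∃ (S' : Type) (_ : CommRing S') (_ : IsDomain S') (_ : IsLocalRing S')
      (_ : IsNoetherianRing S') (ψ' : S' →+* D) (ι : S →+* S'), IsCIC S' ∧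
      ringKrullDim S' ≤ ringKrullDim S + xs.length ∧ (∀ y, Prime y → Prime (ι y)) ∧
      (∀ s, ψ' (ι s) = ψ s) ∧
      (∀ G J, GenMod ψ G (J ⊔ Ideal.span {x | x ∈ xs}) → GenMod ψ' G J) ∧
      ∀ x ∈ xs, ∃ y, Prime y ∧ ψ' y = x := by
  induction xs with
  | nil =>
    intro S _ _ _ _ hS ψ
    exact ⟨S, _, ‹_›, ‹_›, ‹_›, ψ, RingHom.id S, hS, by simp, fun y hy => hy, fun s => rfl,
      fun G J h => by simpa using h, by simp⟩
  | cons x xs ih =>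
    intro S _ _ _ _ hS ψ
    have hx : x ∈ maximalIdeal D := hxs x (by simp)
    obtain ⟨ψ₁, h1, h2⟩ := exists_powerSeries_hom ψ hx
    obtain ⟨S', _, _, _, _, ψ', ι, hS', hdim, hpr, hι, hgen, hex⟩ :=
      ih (fun x h => hxs x (by simp [h])) (PowerSeries S) hS.powerSeries ψ₁
    refine ⟨S', _, ‹_›, ‹_›, ‹_›, ψ', ι.comp PowerSeries.C, hS', ?_,
      fun y hy => hpr _ (PowerSeries.prime_C hy), fun s => by simp [hι, h1], ?_, ?_⟩
    · refine hdim.trans ?_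
      have := ringKrullDim_powerSeries_le (R := S)
      rw [List.length_cons, Nat.cast_add, Nat.cast_one, add_comm (xs.length : WithBot ℕ∞),
        ← add_assoc]
      gcongr
    · intro G J h
      refine hgen G J ?_
      have h3 : GenMod ψ₁ G (J ⊔ Ideal.span {x | x ∈ xs} ⊔
          Ideal.span {ψ₁ PowerSeries.X}) := by
        intro d
        obtain ⟨c, hc⟩ := h d
        refine ⟨fun g => PowerSeries.C (c g), ?_⟩
        simp only [h1, h2]
        convert hc using 1
        rw [sup_assoc, ← Ideal.span_union, Set.union_singleton]
        congr 2
        ext y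
        simp
      exact h3.of_isAdicComplete (h2 ▸ hx)
    · intro z hz
      rcases List.mem_cons.1 hz with rfl | hz
      · exact ⟨ι PowerSeries.X, hpr _ PowerSeries.X_prime, by rw [hι, h2]⟩
      · exact hex z hz

theorem CoeffRing.exists_frame {D : Type} [CommRing D] [IsLocalRing D] [IsNoetherianRing D]
    [IsAdicComplete (maximalIdeal D) D] {V : Type} [CommRing V] (cr : CoeffRing D V)
    (xs : List D) (hxs : ∀ x ∈ xs, x ∈ maximalIdeal D) {N δ : ℕ} (hδ : cr.ϖ ≠ 0 → 1 ≤ δ)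
    (hN : maximalIdeal D ^ N ≤ Ideal.span {cr.φ cr.ϖ} ⊔ Ideal.span {x | x ∈ xs}) :
    ∃ (S : Type) (_ : CommRing S) (_ : IsDomain S) (_ : IsLocalRing S) (_ : IsNoetherianRing S)
      (ψ : S →+* D), IsCIC S ∧ ψ.Finite ∧
      ringKrullDim S ≤ δ + xs.length ∧
      (cr.ϖ ≠ 0 → ∃ y, Prime y ∧ ψ y = cr.φ cr.ϖ) ∧
      ∀ x ∈ xs, ∃ y, Prime y ∧ ψ y = x := by
  have := cr.isDomain
  have := cr.isPID
  have := cr.isLocal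
  have := cr.isAdicComplete
  have hnu : ¬ IsUnit cr.ϖ := fun h => (mem_maximalIdeal _).1 cr.mem (h.map cr.φ)
  have hprime : cr.ϖ ≠ 0 → Prime cr.ϖ := by
    refine fun h0 => ⟨h0, hnu, fun a b hab => ?_⟩
    by_contra! h
    have ha : IsUnit a := by_contra fun hc => h.1 (cr.max a hc)
    have hb : IsUnit b := by_contra fun hc => h.2 (cr.max b hc)
    exact hnu (isUnit_of_dvd_unit hab (ha.mul hb))
  have hdimV : ringKrullDim V ≤ δ := by
    by_cases h0 : cr.ϖ = 0
    · have : IsField V := by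
        refine ⟨⟨0, 1, zero_ne_one⟩, mul_comm, fun {a} ha => ?_⟩
        have : IsUnit a := by
          by_contra hc
          have := cr.max a hc
          rw [h0, zero_dvd_iff] at this
          exact ha this
        exact this.exists_right_inv
      rw [ringKrullDim_eq_zero_of_isField this]
      exact_mod_cast Nat.zero_le δ
    · refine (Order.krullDimLE_iff 1 _ |>.1 (inferInstance : Ring.KrullDimLE 1 V)).trans ?_
      exact_mod_cast hδ h0
  obtain ⟨S, _, _, _, _, ψ, ι, hS, hdim, hpr, hι, hgen, hex⟩ :=
    exists_powerSeries_frame xs hxs V (isCIC_of_ufm V) cr.φ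
  obtain ⟨G, hG⟩ := exists_genMod_of_pow_le cr.surj N
  have hG' : GenMod cr.φ G (Ideal.span {x | x ∈ xs} ⊔ Ideal.span {cr.φ cr.ϖ}) := fun d => by
    obtain ⟨c, hc⟩ := hG d
    exact ⟨c, by rw [sup_comm]; exact hN hc⟩
  have hG2 : GenMod ψ G ⊥ := hgen G ⊥ (by simpa using hG'.of_isAdicComplete cr.mem)
  refine ⟨S, _, ‹_›, ‹_›, ‹_›, ψ, hS, ?_, hdim.trans (by gcongr), fun h0 =>
    ⟨ι cr.ϖ, hpr _ (hprime h0), hι _⟩, hex⟩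
  let _ := ψ.toAlgebra
  refine (Module.Finite.of_fg_top ?_ : Module.Finite S D)
  refine ⟨G, ?_⟩
  rw [eq_top_iff]
  intro d _
  obtain ⟨c, hc⟩ := hG2 d
  rw [Ideal.mem_bot, sub_eq_zero] at hc
  rw [hc]
  exact sum_mem fun g hg => Submodule.smul_mem _ (c g) (Submodule.subset_span hg)

theorem ringKrullDim_quotient_succ_le_of_forall_minimalPrimes {R : Type*} [CommRing R] {I : Ideal R}
    (hI : ∀ q ∈ minimalPrimes R, ¬ I ≤ q) : ringKrullDim (R ⧸ I) + 1 ≤ ringKrullDim R := by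
  by_cases hr' : I = ⊤
  · rw [hr', ringKrullDim_eq_bot_of_subsingleton]
    simp
  have : Nonempty (PrimeSpectrum.zeroLocus (R := R) I) := by
    rwa [Set.nonempty_coe_sort, Set.nonempty_iff_ne_empty, ne_eq,
      PrimeSpectrum.zeroLocus_empty_iff_eq_top]
  have := Ideal.Quotient.nontrivial_iff.mpr hr'
  have := (Ideal.Quotient.mk I).domain_nontrivial
  rw [ringKrullDim_quotient, Order.krullDim_eq_iSup_length, ringKrullDim,
    Order.krullDim_eq_iSup_length, ← WithBot.coe_one, ← WithBot.coe_add,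
    ENat.iSup_add, WithBot.coe_le_coe, iSup_le_iff]
  intro l
  obtain ⟨p, hp, hp'⟩ := Ideal.exists_minimalPrimes_le (J := l.head.1.asIdeal) bot_le
  let p' : PrimeSpectrum R := ⟨p, hp.1.1⟩
  have hp' : p' < l.head := lt_of_le_of_ne hp' fun h => hI p hp <| by
    have h2 := l.head.2
    rw [← h] at h2
    exact h2
  let L : LTSeries (PrimeSpectrum R) := l.map Subtype.val (fun _ _ ↦ id)
  have hL' : (p', L.head) ∈ {(a, b) : PrimeSpectrum R × PrimeSpectrum R | a < b} := hp'
  have hL : (L.cons p' hL').length = l.length + 1 := by rw [RelSeries.cons_length]; rfl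
  refine le_trans ?_ (le_iSup _ (L.cons p' hL'))
  rw [hL, Nat.cast_add, Nat.cast_one]

theorem exists_pow_le_sup_span {D : Type*} [CommRing D] [IsLocalRing D] [IsNoetherianRing D]
    {I : Ideal D} (hI : I ≠ ⊤) {e : ℕ} (he : ringKrullDim (D ⧸ I) ≤ e) :
    ∃ xs : List D, (∀ x ∈ xs, x ∈ maximalIdeal D) ∧ xs.length ≤ e ∧
      ∃ N, maximalIdeal D ^ N ≤ I ⊔ Ideal.span {x | x ∈ xs} := by
  have : Nontrivial (D ⧸ I) := Ideal.Quotient.nontrivial_iff.2 hI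
  have : IsLocalRing (D ⧸ I) := IsLocalRing.of_surjective' _ Ideal.Quotient.mk_surjective
  obtain ⟨s, hs, hcard⟩ :=
    Ideal.exists_finset_card_eq_height_of_isNoetherianRing (maximalIdeal (D ⧸ I))
  choose g hg using Ideal.Quotient.mk_surjective (I := I)
  have hcomap : (maximalIdeal (D ⧸ I)).comap (Ideal.Quotient.mk I) = maximalIdeal D :=
    IsLocalRing.eq_maximalIdeal (Ideal.comap_isMaximal_of_surjective _
      Ideal.Quotient.mk_surjective)
  have hrad : maximalIdeal (D ⧸ I) ≤ (Ideal.span (s : Set (D ⧸ I))).radical := by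
    rw [Ideal.radical_eq_sInf, le_sInf_iff]
    rintro q ⟨hq, hqp⟩
    exact hs.2 ⟨hqp, hq⟩ (IsLocalRing.le_maximalIdeal hqp.ne_top)
  obtain ⟨N, hN⟩ := Ideal.exists_pow_le_of_le_radical_of_fg hrad
    (IsNoetherian.noetherian _)
  refine ⟨s.toList.map g, ?_, ?_, N, ?_⟩
  · intro x hx
    obtain ⟨y, hy, rfl⟩ := List.mem_map.1 hx
    rw [← hcomap, Ideal.mem_comap, hg]
    exact hs.1.2 (Ideal.subset_span (by simpa using hy))
  · rw [← maximalIdeal_height_eq_ringKrullDim, ← hcard] at he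
    simpa using he
  · intro z hz
    have h1 : Ideal.Quotient.mk I z ∈ Ideal.span (s : Set (D ⧸ I)) := by
      refine hN ?_
      rw [← Ideal.mem_comap]
      refine Ideal.le_comap_pow _ _ ?_
      rwa [hcomap]
    have h2 : (s : Set (D ⧸ I)) = Ideal.Quotient.mk I '' {x | x ∈ s.toList.map g} := by
      ext y
      simp only [List.mem_map, Finset.mem_toList, Set.mem_image, Set.mem_ofPred_eq,
        exists_exists_and_eq_and, hg, exists_eq_right, Finset.mem_coe]
    rw [h2, ← Ideal.map_span, ← Ideal.mem_comap, Ideal.comap_map_of_surjective' _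
        Ideal.Quotient.mk_surjective,
      Ideal.mk_ker, sup_comm] at h1
    exact h1

theorem ringKrullDim_le_of_isIntegral (R S : Type*) [CommRing R] [CommRing S] [Algebra R S]
    [Algebra.IsIntegral R S] : ringKrullDim S ≤ ringKrullDim R :=
  Order.krullDim_le_of_strictMono (PrimeSpectrum.comap (algebraMap R S)) fun _ _ h =>
    Ideal.IsIntegral.comap_lt_comap h

theorem ringKrullDim_le_of_isIntegral_of_injective {R S : Type*} [CommRing R] [CommRing S]
    [Algebra R S] [Algebra.IsIntegral R S] (h : Function.Injective (algebraMap R S)) :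
    ringKrullDim R ≤ ringKrullDim S := by
  refine iSup_le fun l => ?_
  obtain ⟨Q, -, hQ, hQl⟩ := Ideal.exists_ideal_over_prime_of_isIntegral (S := S)
    l.head.asIdeal ⊥ (by
      rw [← RingHom.ker_eq_comap_bot, (RingHom.injective_iff_ker_eq_bot _).1 h]; exact bot_le)
  have : Q.LiesOver l.head.asIdeal := ⟨hQl.symm⟩
  obtain ⟨L, hL, -⟩ := Ideal.exists_ltSeries_of_hasGoingUp l Q
  rw [← hL]
  exact le_iSup (fun L : LTSeries (PrimeSpectrum S) => ((L.length : ℕ∞) : WithBot ℕ∞)) L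

theorem exists_pow_mul_mem_of_mem_minimalPrimes {D : Type*} [CommRing D] {I P : Ideal D}
    (hP : P ∈ I.minimalPrimes) {f : D} (hf : f ∈ P) : ∃ g ∉ P, ∃ n, f ^ n * g ∈ I := by
  by_contra! h
  have := hP.1.1
  obtain ⟨g, hg, n, hx⟩ : ∃ g ∉ P, ∃ n, f ^ n * g ∈ I := by
    let M : Submonoid D := Submonoid.powers f ⊔ P.primeCompl
    have hdis : Disjoint (I : Set D) M := by
      rw [Set.disjoint_left]
      intro x hxI hxM
      obtain ⟨_, ⟨n, rfl⟩, g, hg, rfl⟩ := Submonoid.mem_sup.1 hxM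
      exact h g hg n hxI
    obtain ⟨Q, hQ, hIQ, hdQ⟩ := Ideal.exists_le_prime_disjoint I M hdis
    have hQP : Q ≤ P := fun x hx => by_contra fun hc =>
      Set.disjoint_left.1 hdQ hx (Submonoid.mem_sup_right (S := Submonoid.powers f)
          (T := P.primeCompl) hc)
    have := hP.2 ⟨hQ, hIQ⟩ hQP hf
    exact (Set.disjoint_left.1 hdQ this (Submonoid.mem_sup_left (S := Submonoid.powers f)
        (T := P.primeCompl)
      (Submonoid.mem_powers f))).elim
  exact h g hg n hx

theorem mem_minimalPrimes_span_singleton_of_height_le_one {D : Type*} [CommRing D] [IsDomain D]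
    {P : Ideal D} [P.IsPrime] (hP : P.height ≤ 1) {y : D} (hy : y ≠ 0) (hyP : y ∈ P) :
    P ∈ (Ideal.span {y}).minimalPrimes := by
  refine ⟨⟨‹_›, (Ideal.span_singleton_le_iff_mem _).2 hyP⟩, fun Q ⟨hQ, hyQ⟩ hQP => ?_⟩
  by_contra hPQ
  have hQ0 : (⊥ : Ideal D) < Q := bot_lt_iff_ne_bot.2 fun h => hy (by
    simpa [h] using (Ideal.span_singleton_le_iff_mem _).1 hyQ)
  have h1 : Q.height + 1 ≤ P.height :=
    Ideal.height_add_one_le_of_lt_of_isPrime (lt_of_le_not_ge hQP hPQ)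
  have h2 : (⊥ : Ideal D).height + 1 ≤ Q.height :=
    Ideal.height_add_one_le_of_lt_of_isPrime hQ0
  have h3 : (1 : ℕ∞) + 1 ≤ 1 := by
    calc (1 : ℕ∞) + 1 ≤ Q.height + 1 := by gcongr; exact le_trans (by simp) h2
      _ ≤ 1 := h1.trans hP
  exact absurd h3 (by decide)

/-- A height one prime of a domain finite over an integrally closed domain `S`, containing the
image of a prime element of `S`, contracts to the ideal generated by that element. -/
theorem dvd_of_mem_of_height_le_one {S D : Type*} [CommRing S] [IsDomain S] [IsIntegrallyClosed S]
    [CommRing D] [IsDomain D] [Algebra S D] [Algebra.IsIntegral S D]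
    (hinj : Function.Injective (algebraMap S D)) {P : Ideal D} [P.IsPrime] (hP : P.height ≤ 1)
    {y : S} (hy : Prime y) (hyP : algebraMap S D y ∈ P) {f : S} (hf : algebraMap S D f ∈ P) :
    y ∣ f := by
  have : FaithfulSMul S D := (faithfulSMul_iff_algebraMap_injective S D).2 hinj
  have hyD : algebraMap S D y ≠ 0 := by
    rw [Ne, map_eq_zero_iff _ hinj]
    exact hy.ne_zero
  obtain ⟨g, hg, n, hgn⟩ := exists_pow_mul_mem_of_mem_minimalPrimes
    (mem_minimalPrimes_span_singleton_of_height_le_one hP hyD hyP) hf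
  obtain ⟨h, hh⟩ := Ideal.mem_span_singleton'.1 hgn
  by_contra hyf
  have hfn0 : f ^ n ≠ 0 := fun h => hyf (by rw [eq_zero_of_pow_eq_zero h]; exact dvd_zero y)
  have hig : IsIntegral S g := Algebra.IsIntegral.isIntegral g
  have hih : IsIntegral S h := Algebra.IsIntegral.isIntegral h
  have hpoly : (minpoly S g).scaleRoots (f ^ n) = (minpoly S h).scaleRoots y := by
    rw [← IsIntegrallyClosed.minpoly_smul hfn0 hig,
        ← IsIntegrallyClosed.minpoly_smul hy.ne_zero hih,
      Algebra.smul_def, Algebra.smul_def, map_pow, ← hh, mul_comm h]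
  have hdeg : (minpoly S g).natDegree = (minpoly S h).natDegree := by
    rw [← Polynomial.natDegree_scaleRoots _ (f ^ n), hpoly, Polynomial.natDegree_scaleRoots]
  have hcoef : ∀ i < (minpoly S g).natDegree, y ∣ (minpoly S g).coeff i := by
    intro i hi
    have h1 := congrArg (fun p => p.coeff i) hpoly
    simp only [Polynomial.coeff_scaleRoots, ← hdeg] at h1
    have h2 : y ∣ (minpoly S g).coeff i * (f ^ n) ^ ((minpoly S g).natDegree - i) := by
      rw [h1]
      exact Dvd.dvd.mul_left (dvd_pow_self y (by omega)) _
    exact (hy.dvd_or_dvd h2).resolve_right fun h3 =>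
      hyf (hy.dvd_of_dvd_pow (hy.dvd_of_dvd_pow h3))
  have h4 := minpoly.aeval S g
  rw [Polynomial.aeval_eq_sum_range, Finset.sum_range_succ, (minpoly.monic hig).coeff_natDegree,
    one_smul] at h4
  refine hg (‹P.IsPrime›.mem_of_pow_mem (minpoly S g).natDegree ?_)
  rw [eq_neg_iff_add_eq_zero.2 ((add_comm _ _).trans h4)]
  refine neg_mem (sum_mem fun i hi => ?_)
  obtain ⟨c, hc⟩ := hcoef i (Finset.mem_range.1 hi)
  rw [hc, Algebra.smul_def, map_mul, mul_assoc]
  exact Ideal.mul_mem_right _ _ hyP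

/-- A height one prime of a local domain finite over an integrally closed domain `S` of the same
dimension, containing the image of a prime element of `S`, has the expected coheight. -/
theorem ringKrullDim_le_quotient_add_one_of_finite {S D : Type*} [CommRing S] [IsDomain S]
    [IsLocalRing S] [IsNoetherianRing S] [IsIntegrallyClosed S] [CommRing D] [IsDomain D]
    [IsLocalRing D] [IsNoetherianRing D]
    (ψ : S →+* D) (hfin : ψ.Finite) (hdim : ringKrullDim S ≤ ringKrullDim D) {P : Ideal D}
    [P.IsPrime] (hP : P.height ≤ 1) {y : S} (hy : Prime y) (hyP : ψ y ∈ P) :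
    ringKrullDim D ≤ ringKrullDim (D ⧸ P) + 1 := by
  let _ := ψ.toAlgebra
  have : Module.Finite S D := hfin
  have : Algebra.IsIntegral S D := Algebra.IsIntegral.of_finite S D
  have hinj : Function.Injective ψ := by
    rw [injective_iff_map_eq_zero]
    by_contra! h
    obtain ⟨a, ha, ha0⟩ := h
    let _ : Algebra (S ⧸ RingHom.ker ψ) D := (RingHom.kerLift ψ).toAlgebra
    have : IsScalarTower S (S ⧸ RingHom.ker ψ) D := .of_algebraMap_eq fun x => rfl
    have : Algebra.IsIntegral (S ⧸ RingHom.ker ψ) D := Algebra.IsIntegral.tower_top (R := S)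
    have h1 := ringKrullDim_le_of_isIntegral (S ⧸ RingHom.ker ψ) D
    have h2 : ringKrullDim (S ⧸ RingHom.ker ψ) + 1 ≤ ringKrullDim S :=
      ringKrullDim_succ_le_of_surjective (Ideal.Quotient.mk _) Ideal.Quotient.mk_surjective
        (mem_nonZeroDivisors_of_ne_zero ha0) (Ideal.Quotient.eq_zero_iff_mem.2 ha)
    have h3 : ringKrullDim D + 1 ≤ ringKrullDim D := by
      refine le_trans (by gcongr) (h2.trans hdim)
    have h4 := ringKrullDim_ne_top (R := D)
    have h5 := ringKrullDim_ne_bot (R := D)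
    generalize ringKrullDim D = d at h3 h4 h5
    induction d with
    | bot => exact h5 rfl
    | coe d =>
      induction d with
      | top => exact h4 rfl
      | coe d =>
        have : d + 1 ≤ d := by exact_mod_cast h3
        omega
  let _ : Algebra (S ⧸ Ideal.span {y}) (D ⧸ P) := (Ideal.quotientMap P ψ
    ((Ideal.span_singleton_le_iff_mem _).2 hyP)).toAlgebra
  have : IsScalarTower S (S ⧸ Ideal.span {y}) (D ⧸ P) := .of_algebraMap_eq fun x => rfl
  have : Algebra.IsIntegral (S ⧸ Ideal.span {y}) (D ⧸ P) := Algebra.IsIntegral.tower_top (R := S)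
  have h1 : ringKrullDim (S ⧸ Ideal.span {y}) ≤ ringKrullDim (D ⧸ P) := by
    refine ringKrullDim_le_of_isIntegral_of_injective ?_
    refine Ideal.quotientMap_injective' (I := P) (f := ψ) (J := Ideal.span {y})
      (H := (Ideal.span_singleton_le_iff_mem _).2 hyP) fun f hf => ?_
    exact Ideal.mem_span_singleton.2 (dvd_of_mem_of_height_le_one hinj hP hy hyP hf)
  calc ringKrullDim D ≤ ringKrullDim S := ringKrullDim_le_of_isIntegral S D
    _ ≤ ringKrullDim (S ⧸ Ideal.span {y}) + 1 := dim_le_dim_quotient_add_one (by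
      rw [mem_maximalIdeal, mem_nonunits_iff]; exact hy.not_isUnit)
    _ ≤ _ := by gcongr

theorem exists_mem_forall_notMem {R : Type*} [CommRing R] {s : Set (Ideal R)} (hs : s.Finite)
    (hp : ∀ q ∈ s, q.IsPrime) {I : Ideal R} (hI : ∀ q ∈ s, ¬ I ≤ q) :
    ∃ x ∈ I, ∀ q ∈ s, x ∉ q := by
  by_contra! h
  obtain ⟨q, hq, hIq⟩ := (Ideal.subset_union_prime_finite hs (f := id) ⊥ ⊥
    (fun q hq _ _ => hp q hq) (I := I)).1 fun x hx => by
      obtain ⟨q, hq, hxq⟩ := h x hx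
      exact Set.mem_biUnion hq hxq
  exact hI q hq hIq

theorem add_one_le_natCast_iff {a : WithBot ℕ∞} {n : ℕ} (h : a + 1 ≤ n) (h0 : 0 ≤ a) :
    1 ≤ n ∧ a ≤ ((n - 1 : ℕ) : WithBot ℕ∞) := by
  induction a with
  | bot => exact absurd h0 (by simp)
  | coe a =>
    induction a with
    | top =>
      have : (⊤ : ℕ∞) + 1 ≤ n := by exact_mod_cast h
      simp at this
    | coe a =>
      have h1 : a + 1 ≤ n := by exact_mod_cast h
      exact ⟨le_trans (Nat.le_add_left 1 a) h1, WithBot.coe_le_coe.2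
          (Nat.cast_le.2 (Nat.le_sub_of_add_le h1))⟩

theorem exists_ringKrullDim_eq_natCast (R : Type*) [CommRing R] [IsLocalRing R]
    [IsNoetherianRing R] : ∃ d : ℕ, ringKrullDim R = d := by
  have h4 := ringKrullDim_ne_top (R := R)
  have h5 := ringKrullDim_ne_bot (R := R)
  generalize ringKrullDim R = d at h4 h5
  induction d with
  | bot => exact absurd rfl h5
  | coe d =>
    induction d with
    | top => exact absurd rfl h4
    | coe d => exact ⟨d, rfl⟩

theorem ringKrullDim_le_quotient_add_one {D : Type} [CommRing D] [IsDomain D] [IsLocalRing D]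
    [IsNoetherianRing D] [IsAdicComplete (maximalIdeal D) D] {P : Ideal D} [P.IsPrime]
    (hP0 : P ≠ ⊥) (hP : P.height ≤ 1) : ringKrullDim D ≤ ringKrullDim (D ⧸ P) + 1 := by
  obtain ⟨V, _, ⟨cr⟩⟩ := exists_coeffRing D
  obtain ⟨d, hd⟩ := exists_ringKrullDim_eq_natCast D
  have hPm : P ≤ maximalIdeal D := IsLocalRing.le_maximalIdeal ‹P.IsPrime›.ne_top
  have hnn : ∀ I : Ideal D, I ≤ maximalIdeal D → I ≠ ⊤ ∧ 0 ≤ ringKrullDim (D ⧸ I) := by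
    intro I hI
    have hI' : I ≠ ⊤ := fun h => (maximalIdeal.isMaximal D).ne_top (top_le_iff.1 (h ▸ hI))
    have := Ideal.Quotient.nontrivial_iff.2 hI'
    exact ⟨hI', ringKrullDim_nonneg_of_nontrivial⟩
  have hbot : minimalPrimes D = {⊥} := IsDomain.minimalPrimes_eq_singleton_bot D
  have hdrop : ∀ x : D, x ≠ 0 → x ∈ maximalIdeal D → 1 ≤ d ∧
      ringKrullDim (D ⧸ Ideal.span {x}) ≤ ((d - 1 : ℕ) : WithBot ℕ∞) := by
    intro x hx hxm
    have h1 := ringKrullDim_quotient_succ_le_of_nonZeroDivisor (mem_nonZeroDivisors_of_ne_zero hx)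
    rw [hd] at h1
    exact add_one_le_natCast_iff h1 (hnn _ ((Ideal.span_singleton_le_iff_mem _).2 hxm)).2
  have hmem : ∀ {I : Ideal D} {N : ℕ} {xs : List D} {x : D},
      maximalIdeal D ^ N ≤ I ⊔ Ideal.span {x} ⊔ Ideal.span {z | z ∈ xs} →
      maximalIdeal D ^ N ≤ I ⊔ Ideal.span {z | z ∈ x :: xs} := by
    intro I N xs x h
    refine h.trans (le_of_eq ?_)
    rw [sup_assoc, ← Ideal.span_union]
    congr 2
    ext z
    simp
  by_cases hϖP : cr.φ cr.ϖ ∈ P ∧ cr.ϖ ≠ 0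
  · obtain ⟨hd1, hdim⟩ := hdrop _ ((map_ne_zero_iff _ cr.inj).2 hϖP.2) cr.mem
    obtain ⟨xs, hxs, hlen, N, hN⟩ := exists_pow_le_sup_span
      (hnn _ ((Ideal.span_singleton_le_iff_mem _).2 cr.mem)).1 hdim
    obtain ⟨S, _, _, _, _, ψ, hS, hfin, hSdim, hy, -⟩ :=
      cr.exists_frame xs hxs (δ := 1) (fun _ => le_rfl) hN
    obtain ⟨y, hy, hyψ⟩ := hy hϖP.2
    have := hS.isIntegrallyClosed
    refine ringKrullDim_le_quotient_add_one_of_finite ψ hfin ?_ hP hy (hyψ ▸ hϖP.1)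
    rw [hd]
    exact hSdim.trans (by exact_mod_cast (by omega : 1 + xs.length ≤ d))
  · obtain ⟨x, hxP, hx0, δ, e, hδ, hδe, hdim⟩ : ∃ x ∈ P, x ≠ 0 ∧ ∃ δ e : ℕ,
        (cr.ϖ ≠ 0 → 1 ≤ δ) ∧ δ + (e + 1) ≤ d ∧
        ringKrullDim (D ⧸ (Ideal.span {cr.φ cr.ϖ} ⊔ Ideal.span {x})) ≤ e := by
      by_cases h0 : cr.ϖ = 0
      · obtain ⟨x, hxP, hx0⟩ := Submodule.exists_mem_ne_zero_of_ne_bot hP0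
        obtain ⟨hd1, hdim⟩ := hdrop x hx0 (hPm hxP)
        refine ⟨x, hxP, hx0, 0, d - 1, fun h => absurd h0 h, by omega, ?_⟩
        rwa [h0, map_zero, Ideal.span_singleton_eq_bot.2 rfl, bot_sup_eq]
      · have h0' : cr.φ cr.ϖ ≠ 0 := (map_ne_zero_iff _ cr.inj).2 h0
        obtain ⟨hd1, hdim⟩ := hdrop _ h0' cr.mem
        have hP1 : 1 ≤ P.height := by
          have := Ideal.height_add_one_le_of_lt_of_isPrime (bot_lt_iff_ne_bot.2 hP0)
          exact le_trans (by simp) this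
        obtain ⟨x, hxP, hx⟩ := exists_mem_forall_notMem (I := P)
          (Ideal.finite_minimalPrimes_of_isNoetherianRing D (Ideal.span {cr.φ cr.ϖ}))
          (fun q hq => hq.1.1) (fun q hq hPq => by
            have := hq.1.1
            have hq1 := Ideal.height_le_one_of_isPrincipal_of_mem_minimalPrimes _ q hq
            have hne : P ≠ q := fun h => hϖP
              ⟨h ▸ (Ideal.span_singleton_le_iff_mem _).1 hq.1.2, h0⟩
            have h2 := Ideal.height_add_one_le_of_lt_of_isPrime (lt_of_le_of_ne hPq hne)
            have h3 : (1 : ℕ∞) + 1 ≤ 1 := le_trans (by gcongr) (h2.trans hq1)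
            exact absurd h3 (by decide))
        have hm : Ideal.span {cr.φ cr.ϖ} ⊔ Ideal.span {x} ≤ maximalIdeal D :=
          sup_le ((Ideal.span_singleton_le_iff_mem _).2 cr.mem)
            ((Ideal.span_singleton_le_iff_mem _).2 (hPm hxP))
        have h1 : ringKrullDim (D ⧸ (Ideal.span {cr.φ cr.ϖ} ⊔ Ideal.span {x})) + 1 ≤
            ringKrullDim (D ⧸ Ideal.span {cr.φ cr.ϖ}) := by
          rw [← ringKrullDim_eq_of_ringEquiv (DoubleQuot.quotQuotEquivQuotSup _ _)]
          refine ringKrullDim_quotient_succ_le_of_forall_minimalPrimes fun q hq hle => ?_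
          refine hx (q.comap (Ideal.Quotient.mk _)) ?_ ?_
          · rw [Ideal.minimalPrimes_eq_comap]
            exact ⟨q, hq, rfl⟩
          · exact hle (Ideal.mem_map_of_mem _ (Ideal.mem_span_singleton_self x))
        obtain ⟨h2, h3⟩ := add_one_le_natCast_iff (h1.trans hdim) (hnn _ hm).2
        refine ⟨x, hxP, ?_, 1, d - 1 - 1, fun _ => le_rfl, by omega, h3⟩
        rintro rfl
        obtain ⟨q, hq⟩ := Ideal.nonempty_minimalPrimes
          (hnn _ ((Ideal.span_singleton_le_iff_mem _).2 cr.mem)).1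
        exact hx q hq (zero_mem _)
    have hm : Ideal.span {cr.φ cr.ϖ} ⊔ Ideal.span {x} ≤ maximalIdeal D :=
      sup_le ((Ideal.span_singleton_le_iff_mem _).2 cr.mem)
        ((Ideal.span_singleton_le_iff_mem _).2 (hPm hxP))
    obtain ⟨xs, hxs, hlen, N, hN⟩ := exists_pow_le_sup_span (hnn _ hm).1 hdim
    obtain ⟨S, _, _, _, _, ψ, hS, hfin, hSdim, -, hy⟩ :=
      cr.exists_frame (x :: xs) (fun z hz => by
        rcases List.mem_cons.1 hz with rfl | hz
        exacts [hPm hxP, hxs z hz]) hδ (hmem hN)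
    obtain ⟨y, hy, hyψ⟩ := hy x (by simp)
    have := hS.isIntegrallyClosed
    refine ringKrullDim_le_quotient_add_one_of_finite ψ hfin ?_ hP hy (hyψ ▸ hxP)
    rw [hd]
    refine hSdim.trans ?_
    rw [List.length_cons]
    exact_mod_cast (by omega : δ + (xs.length + 1) ≤ d)


theorem isAdicComplete_quotient {R : Type*} [CommRing R] [IsLocalRing R] [IsNoetherianRing R]
    [IsAdicComplete (maximalIdeal R) R] (I : Ideal R) [IsLocalRing (R ⧸ I)] :
    IsAdicComplete (maximalIdeal (R ⧸ I)) (R ⧸ I) := by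
  have hmap : (maximalIdeal R).map (Ideal.Quotient.mk I) = maximalIdeal (R ⧸ I) :=
    IsLocalRing.map_maximalIdeal_of_surjective _ Ideal.Quotient.mk_surjective
  have hlift : ∀ n, ∀ z ∈ maximalIdeal (R ⧸ I) ^ n, ∃ w ∈ maximalIdeal R ^ n,
      Ideal.Quotient.mk I w = z := by
    intro n z hz
    rw [← hmap, ← Ideal.map_pow] at hz
    exact (Ideal.mem_map_iff_of_surjective _ Ideal.Quotient.mk_surjective).1 hz
  refine { toIsHausdorff := IsHausdorff.of_isLocalRing _ _ (maximalIdeal.isMaximal _).ne_top,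
           toIsPrecomplete := ⟨fun f hf => ?_⟩ }
  have hf' : ∀ n, ∃ w ∈ maximalIdeal R ^ n, Ideal.Quotient.mk I w = f (n + 1) - f n := by
    intro n
    have h1 := (hf n.le_succ).symm
    rw [SModEq.sub_mem, smul_eq_mul, Ideal.mul_top] at h1
    exact hlift n _ h1
  choose w hw hwf using hf'
  obtain ⟨g0, hg0⟩ := Ideal.Quotient.mk_surjective (f 0)
  let g : ℕ → R := fun n => g0 + ∑ i ∈ Finset.range n, w i
  have hg : ∀ n, Ideal.Quotient.mk I (g n) = f n := by
    intro n
    simp only [g, map_add, map_sum, hwf, Finset.sum_range_sub, hg0]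
    ring
  obtain ⟨L, hL⟩ := exists_adic_limit (maximalIdeal R) g fun n => by
    simp only [g, Finset.sum_range_succ]
    rw [← neg_mem_iff]
    convert hw n using 1
    ring
  refine ⟨Ideal.Quotient.mk I L, fun n => ?_⟩
  rw [SModEq.sub_mem, smul_eq_mul, Ideal.mul_top, ← hg, ← map_sub, ← hmap, ← Ideal.map_pow]
  exact Ideal.mem_map_of_mem _ (hL n)

/-- `CovChain n p q`: there is a saturated chain of length `n` from `p` to `q`. -/
inductive CovChain {α : Type*} [Preorder α] : ℕ → α → α → Prop
  | refl (p : α) : CovChain 0 p p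
  | head {n : ℕ} {p q r : α} : p ⋖ q → CovChain n q r → CovChain (n + 1) p r

theorem height_map_mk_le_one {R : Type*} [CommRing R] {p q : PrimeSpectrum R} (h : p ⋖ q) :
    ((q.asIdeal.map (Ideal.Quotient.mk p.asIdeal)).IsPrime ∧
      q.asIdeal.map (Ideal.Quotient.mk p.asIdeal) ≠ ⊥) ∧
      (q.asIdeal.map (Ideal.Quotient.mk p.asIdeal)).height ≤ 1 := by
  have hpq : p.asIdeal ≤ q.asIdeal := h.1.le
  have hcm : (q.asIdeal.map (Ideal.Quotient.mk p.asIdeal)).comap (Ideal.Quotient.mk p.asIdeal) =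
      q.asIdeal := by
    rw [Ideal.comap_map_of_surjective' _ Ideal.Quotient.mk_surjective, Ideal.mk_ker,
        sup_eq_left.2 hpq]
  have hprime : (q.asIdeal.map (Ideal.Quotient.mk p.asIdeal)).IsPrime :=
    Ideal.map_isPrime_of_surjective Ideal.Quotient.mk_surjective (by rwa [Ideal.mk_ker])
  refine ⟨⟨hprime, fun h0 => ?_⟩, ?_⟩
  · rw [h0, ← RingHom.ker_eq_comap_bot, Ideal.mk_ker] at hcm
    exact h.1.ne (PrimeSpectrum.ext hcm)
  · refine (Ideal.height_le_iff (n := 1)).2 fun Q hQ hlt => ?_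
    have h1 : p ≤ ⟨Q.comap (Ideal.Quotient.mk p.asIdeal), hQ.comap _⟩ := by
      change p.asIdeal ≤ Q.comap (Ideal.Quotient.mk p.asIdeal)
      intro x hx
      rw [Ideal.mem_comap, Ideal.Quotient.eq_zero_iff_mem.2 hx]
      exact zero_mem _
    have h2 : (⟨Q.comap (Ideal.Quotient.mk p.asIdeal), hQ.comap _⟩ : PrimeSpectrum R) < q := by
      change Q.comap (Ideal.Quotient.mk p.asIdeal) < q.asIdeal
      rw [← hcm]
      refine lt_of_le_of_ne (Ideal.comap_mono hlt.le) fun h => hlt.ne ?_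
      exact Ideal.comap_injective_of_surjective _ Ideal.Quotient.mk_surjective h
    have h3 : p = ⟨Q.comap (Ideal.Quotient.mk p.asIdeal), hQ.comap _⟩ :=
      h1.eq_of_not_lt fun h4 => h.2 h4 h2
    have h4 : Q = ⊥ := by
      have := congrArg PrimeSpectrum.asIdeal h3
      refine Ideal.comap_injective_of_surjective _ (Ideal.Quotient.mk_surjective (I := p.asIdeal))
          ?_
      rw [← RingHom.ker_eq_comap_bot, Ideal.mk_ker]
      exact this.symm
    rw [h4]
    simp

theorem ringKrullDim_le_of_covChain {T : Type} [CommRing T] [IsLocalRing T] [IsNoetherianRing T]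
    [IsAdicComplete (maximalIdeal T) T] {n : ℕ} {q r : PrimeSpectrum T} (h : CovChain n q r)
    (hr : r.asIdeal = maximalIdeal T) : ringKrullDim (T ⧸ q.asIdeal) ≤ n := by
  induction h with
  | refl p =>
    have : p.asIdeal.IsMaximal := hr ▸ maximalIdeal.isMaximal T
    let _ := Ideal.Quotient.field p.asIdeal
    rw [ringKrullDim_eq_zero_of_field]
    simp
  | @head n p q r hpq _ ih =>
    have : IsLocalRing (T ⧸ p.asIdeal) :=
      IsLocalRing.of_surjective' _ Ideal.Quotient.mk_surjective
    have := isAdicComplete_quotient p.asIdeal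
    obtain ⟨⟨_, h0⟩, h1⟩ := height_map_mk_le_one hpq
    refine (ringKrullDim_le_quotient_add_one h0 h1).trans ?_
    rw [ringKrullDim_eq_of_ringEquiv (DoubleQuot.quotQuotEquivQuotOfLE hpq.1.le)]
    rw [Nat.cast_add, Nat.cast_one]
    gcongr
    exact ih hr

theorem CovChain.trans {α : Type*} [Preorder α] {n m : ℕ} {p q r : α} (h : CovChain n p q)
    (h' : CovChain m q r) : CovChain (n + m) p r := by
  induction h with
  | refl p => simpa using h'
  | @head n p q s hpq _ ih =>
    have := CovChain.head hpq (ih h')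
    rwa [Nat.add_right_comm] at this

theorem exists_covChain {α : Type*} [PartialOrder α] [WellFoundedLT α] [WellFoundedGT α] {p q : α}
    (h : p ≤ q) : ∃ n, CovChain n p q := by
  induction p using WellFoundedGT.induction with
  | ind p ih =>
    rcases h.eq_or_lt with rfl | hlt
    · exact ⟨0, .refl p⟩
    · obtain ⟨x, hx, hxq⟩ := exists_covBy_le_of_lt hlt
      obtain ⟨n, hn⟩ := ih x hx.1 hxq
      exact ⟨n + 1, .head hx hn⟩

theorem covChain_of_forall_covBy {α : Type*} [Preorder α] (n : ℕ) (f : Fin (n + 1) → α)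
    (h : ∀ i : Fin n, f i.castSucc ⋖ f i.succ) : CovChain n (f 0) (f (Fin.last n)) := by
  induction n with
  | zero => exact .refl _
  | succ n ih =>
    refine .head (h 0) ?_
    exact ih (fun i => f i.succ) fun i => h i.succ

theorem CovChain.exists_fun {α : Type*} [Preorder α] {n : ℕ} {p q : α} (h : CovChain n p q) :
    ∃ f : Fin (n + 1) → α, (∀ i : Fin n, f i.castSucc ⋖ f i.succ) ∧ f 0 = p ∧
      f (Fin.last n) = q := by
  induction h with
  | refl p => exact ⟨fun _ => p, fun i => i.elim0, rfl, rfl⟩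
  | @head n p q r hpq _ ih =>
    obtain ⟨f, hf, h0, h1⟩ := ih
    refine ⟨Fin.cons p f, fun i => ?_, rfl, ?_⟩
    · induction i using Fin.cases with
      | zero => simpa [h0] using hpq
      | succ i => simpa [← Fin.succ_castSucc] using hf i
    · rw [← Fin.succ_last, Fin.cons_succ, h1]

instance wellFoundedGT_primeSpectrum {R : Type*} [CommRing R] [IsNoetherianRing R] :
    WellFoundedGT (PrimeSpectrum R) :=
  StrictMono.wellFoundedGT (f := fun p : PrimeSpectrum R => p.asIdeal) fun _ _ h => h

instance wellFoundedLT_primeSpectrum {R : Type*} [CommRing R] [IsNoetherianRing R] :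
    WellFoundedLT (PrimeSpectrum R) :=
  StrictMono.wellFoundedLT (f := fun p : PrimeSpectrum R => p.asIdeal.height) fun _ _ h =>
    Ideal.height_strict_mono_of_isPrime_of_isPrime h

theorem natCast_le_ringKrullDim_quotient_of_covChain {R : Type*} [CommRing R] {n : ℕ}
    {q r : PrimeSpectrum R} (h : CovChain n q r) :
    (n : WithBot ℕ∞) ≤ ringKrullDim (R ⧸ q.asIdeal) := by
  induction h with
  | refl p => simpa using ringKrullDim_nonneg_of_nontrivial
  | @head n p q r hpq _ ih =>
    obtain ⟨x, hxq, hxp⟩ := SetLike.exists_of_lt (show p.asIdeal < q.asIdeal from hpq.1)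
    have h1 : Ideal.Quotient.mk p.asIdeal x ∈ nonZeroDivisors (R ⧸ p.asIdeal) :=
      mem_nonZeroDivisors_of_ne_zero fun h => hxp (Ideal.Quotient.eq_zero_iff_mem.1 h)
    have h2 := ringKrullDim_succ_le_of_surjective
      (Ideal.Quotient.factor (show p.asIdeal ≤ q.asIdeal from hpq.1.le))
      (Ideal.Quotient.factor_surjective _) h1
      (by rw [Ideal.Quotient.factor_mk]; exact Ideal.Quotient.eq_zero_iff_mem.2 hxq)
    refine le_trans ?_ h2
    rw [Nat.cast_add, Nat.cast_one]
    gcongr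

theorem ringKrullDim_quotient_le_one_of_covBy {R : Type*} [CommRing R] [IsLocalRing R]
    [IsNoetherianRing R] {p r : PrimeSpectrum R} (h : p ⋖ r) (hr : r.asIdeal = maximalIdeal R) :
    ringKrullDim (R ⧸ p.asIdeal) ≤ 1 := by
  have : IsLocalRing (R ⧸ p.asIdeal) := IsLocalRing.of_surjective' _ Ideal.Quotient.mk_surjective
  obtain ⟨-, h1⟩ := height_map_mk_le_one h
  rw [← maximalIdeal_height_eq_ringKrullDim, ← IsLocalRing.map_maximalIdeal_of_surjective
    (Ideal.Quotient.mk p.asIdeal) Ideal.Quotient.mk_surjective, ← hr]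
  exact_mod_cast h1

theorem ringKrullDim_le_of_covChain_of_le_two {A : Type*} [CommRing A] [IsDomain A] [IsLocalRing A]
    [IsNoetherianRing A] [UniqueFactorizationMonoid A] {n : ℕ} {p r : PrimeSpectrum A}
    (hp : p.asIdeal = ⊥) (hr : r.asIdeal = maximalIdeal A) (h : CovChain n p r) (hn : n ≤ 2) :
    ringKrullDim A ≤ n := by
  have hbot : ringKrullDim (A ⧸ p.asIdeal) = ringKrullDim A := by
    rw [hp]; exact ringKrullDim_eq_of_ringEquiv (RingEquiv.quotientBot A)
  cases h with
  | refl p =>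
    have : p.asIdeal.IsMaximal := hr ▸ maximalIdeal.isMaximal A
    let _ := Ideal.Quotient.field p.asIdeal
    rw [← hbot, ringKrullDim_eq_zero_of_field]
    simp
  | @head n p q r hpq h =>
    cases h with
    | refl q => simpa [hbot] using ringKrullDim_quotient_le_one_of_covBy hpq hr
    | @head n q q' r hqq' h =>
      cases h with
      | head _ _ => omega
      | refl q' =>
        have hq0 : q.asIdeal ≠ ⊥ := fun h0 => hpq.1.ne (PrimeSpectrum.ext (hp.trans h0.symm))
        obtain ⟨x, hx, hxp⟩ := Ideal.IsPrime.exists_mem_prime_of_ne_bot q.2 hq0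
        have hxI : (Ideal.span {x}).IsPrime := (Ideal.span_singleton_prime hxp.ne_zero).2 hxp
        have hxq : q = ⟨Ideal.span {x}, hxI⟩ := by
          refine ((Ideal.span_singleton_le_iff_mem _).2 hx |>.eq_of_not_lt
            (b := q.asIdeal) (a := Ideal.span {x}) fun hlt => ?_) |> fun h =>
                PrimeSpectrum.ext h.symm
          refine hpq.2 (c := ⟨Ideal.span {x}, hxI⟩) ?_ hlt
          change p.asIdeal < Ideal.span {x}
          rw [hp, bot_lt_iff_ne_bot, Ne, Ideal.span_singleton_eq_bot]
          exact hxp.ne_zero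
        have h1 := ringKrullDim_quotient_le_one_of_covBy hqq' hr
        have hxm : x ∈ maximalIdeal A := hr ▸ hqq'.1.le hx
        refine (dim_le_dim_quotient_add_one hxm).trans ?_
        rw [hxq] at h1
        have : ((0 + 1 + 1 : ℕ) : WithBot ℕ∞) = 1 + 1 := by norm_num
        rw [this]
        gcongr

theorem exists_covChain_of_not_isCatenary {A : Type} [CommRing A] [IsDomain A] [IsLocalRing A]
    [IsNoetherianRing A] (h : ¬ IsCatenary A) :
    ∃ n : ℕ, CovChain n (⟨⊥, Ideal.isPrime_bot⟩ : PrimeSpectrum A) (closedPoint A) ∧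
      (n : WithBot ℕ∞) < ringKrullDim A := by
  have key : ∀ (n m : ℕ) (f : Fin (n + 1) → PrimeSpectrum A) (g : Fin (m + 1) → PrimeSpectrum A),
    IsSaturatedChain f → IsSaturatedChain g → f 0 = g 0 →
    f (Fin.last n) = g (Fin.last m) → n < m →
    ∃ n : ℕ, CovChain n (⟨⊥, Ideal.isPrime_bot⟩ : PrimeSpectrum A) (closedPoint A) ∧
      (n : WithBot ℕ∞) < ringKrullDim A := by
    intro n m f g hf hg h0 h1 hnm
    have hf' := covChain_of_forall_covBy n f hf
    have hg' := covChain_of_forall_covBy m g hg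
    rw [← h0, ← h1] at hg'
    obtain ⟨a, ha⟩ := exists_covChain (show (⟨⊥, Ideal.isPrime_bot⟩ : PrimeSpectrum A) ≤ f 0 from
      bot_le (a := (f 0).asIdeal))
    obtain ⟨b, hb⟩ := exists_covChain (show f (Fin.last n) ≤ closedPoint A from
      IsLocalRing.le_maximalIdeal (f (Fin.last n)).2.ne_top)
    refine ⟨_, (ha.trans hf').trans hb, lt_of_lt_of_le ?_
      ((natCast_le_ringKrullDim_quotient_of_covChain ((ha.trans hg').trans hb)).trans
        (ringKrullDim_quotient_le _))⟩
    exact_mod_cast (by omega : a + n + b < a + m + b)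
  simp only [IsCatenary] at h
  push Not at h
  obtain ⟨n, m, f, g, hf, hg, h0, h1, hnm⟩ := h
  rcases lt_or_gt_of_ne hnm with hlt | hlt
  · exact key n m f g hf hg h0 h1 hlt
  · exact key m n g f hg hf h0.symm h1.symm hlt

theorem comap_eq_of_mem_minimalPrimes_map {A T : Type*} [CommRing A] [CommRing T] [Algebra A T]
    [Algebra.HasGoingDown A T] {p : Ideal A} [p.IsPrime] {P : Ideal T}
    (hP : P ∈ (p.map (algebraMap A T)).minimalPrimes) : P.comap (algebraMap A T) = p := by
  have : P.IsPrime := hP.1.1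
  have hle : p ≤ P.under A := Ideal.map_le_iff_le_comap.1 hP.1.2
  have : P.LiesOver (P.under A) := ⟨rfl⟩
  obtain ⟨P', hP', hpr, hl⟩ := Ideal.exists_ideal_le_liesOver_of_le (p := p) (q := P.under A) P hle
  have h1 : p.map (algebraMap A T) ≤ P' := Ideal.map_le_iff_le_comap.2 hl.over.le
  have h2 : P ≤ P' := hP.2 ⟨hpr, h1⟩ hP'
  rw [le_antisymm h2 hP']
  exact hl.over.symm

theorem exists_covBy_of_covBy {A T : Type*} [CommRing A] [CommRing T] [IsNoetherianRing T]
    [Algebra A T] [Algebra.HasGoingDown A T] {p q : PrimeSpectrum A} (h : p ⋖ q)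
    {Q : PrimeSpectrum T} (hQ : Q.asIdeal ∈ (q.asIdeal.map (algebraMap A T)).minimalPrimes) :
    ∃ P : PrimeSpectrum T, P.asIdeal ∈ (p.asIdeal.map (algebraMap A T)).minimalPrimes ∧ P ⋖ Q := by
  have hpq : p.asIdeal ≤ q.asIdeal := h.1.le
  obtain ⟨P, hP, hPQ⟩ := Ideal.exists_minimalPrimes_le ((Ideal.map_mono hpq).trans hQ.1.2)
  have hPp := comap_eq_of_mem_minimalPrimes_map hP
  have hQq := comap_eq_of_mem_minimalPrimes_map hQ
  have hPprime : P.IsPrime := hP.1.1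
  have hlt : P < Q.asIdeal := by
    refine lt_of_le_of_ne hPQ fun he => h.1.ne (PrimeSpectrum.ext ?_)
    rw [← hPp, ← hQq, he]
  obtain ⟨a, haq, hap⟩ := SetLike.exists_of_lt (show p.asIdeal < q.asIdeal from h.1)
  -- a prime between `P` and `Q` containing `a` equals `Q`
  have key : ∀ Q' : Ideal T, Q'.IsPrime → P ≤ Q' → algebraMap A T a ∈ Q' → Q' ≤ Q.asIdeal →
      Q.asIdeal ≤ Q' := by
    intro Q' hQ' h1 h2 h3
    have h4 : p < ⟨Q'.comap (algebraMap A T), hQ'.comap _⟩ := by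
      change p.asIdeal < Q'.comap (algebraMap A T)
      refine lt_of_le_of_ne ?_ fun he => hap ?_
      · rw [← hPp]; exact Ideal.comap_mono h1
      · rw [he]; exact h2
    have h5 : (⟨Q'.comap (algebraMap A T), hQ'.comap _⟩ : PrimeSpectrum A) ≤ q := by
      change Q'.comap (algebraMap A T) ≤ q.asIdeal
      rw [← hQq]; exact Ideal.comap_mono h3
    have h6 : q.asIdeal ≤ Q'.comap (algebraMap A T) := by
      have := h5.eq_of_not_lt fun hl => h.2 h4 hl
      rw [← this]
    exact hQ.2 ⟨hQ', Ideal.map_le_iff_le_comap.2 h6⟩ h3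
  refine ⟨⟨P, hPprime⟩, hP, hlt, fun {P'} h1 h2 => ?_⟩
  have h1' : P < P'.asIdeal := h1
  have h2' : P'.asIdeal < Q.asIdeal := h2
  have hcm : ∀ I : Ideal T, P ≤ I → (I.map (Ideal.Quotient.mk P)).comap (Ideal.Quotient.mk P) = I :=
    fun I hI => by
      rw [Ideal.comap_map_of_surjective' _ Ideal.Quotient.mk_surjective, Ideal.mk_ker,
          sup_eq_left.2 hI]
  have hpr : ∀ I : Ideal T, I.IsPrime → P ≤ I → (I.map (Ideal.Quotient.mk P)).IsPrime :=
    fun I hI hle => Ideal.map_isPrime_of_surjective Ideal.Quotient.mk_surjective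
      (by rwa [Ideal.mk_ker])
  have hmin : Q.asIdeal.map (Ideal.Quotient.mk P) ∈
      (Ideal.span {Ideal.Quotient.mk P (algebraMap A T a)}).minimalPrimes := by
    refine ⟨⟨hpr _ Q.2 hlt.le, ?_⟩, fun I hI hle => ?_⟩
    · rw [Ideal.span_singleton_le_iff_mem]
      refine Ideal.mem_map_of_mem _ ?_
      have : a ∈ Q.asIdeal.comap (algebraMap A T) := by rw [hQq]; exact haq
      exact this
    · rw [Ideal.map_le_iff_le_comap]
      have := hI.1
      refine key _ (hI.1.comap _) ?_ (hI.2 (Ideal.mem_span_singleton_self _)) ?_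
      · intro x hx
        rw [Ideal.mem_comap, Ideal.Quotient.eq_zero_iff_mem.2 hx]
        exact zero_mem _
      · rw [← hcm Q.asIdeal hlt.le]; exact Ideal.comap_mono hle
  have hPm := hpr _ Q.2 hlt.le
  have hht := Ideal.height_le_one_of_isPrincipal_of_mem_minimalPrimes _ _ hmin
  have hP'm := hpr _ P'.2 h1'.le
  have hlt2 : P'.asIdeal.map (Ideal.Quotient.mk P) < Q.asIdeal.map (Ideal.Quotient.mk P) := by
    refine lt_of_le_of_ne (Ideal.map_mono h2'.le) fun he => h2'.ne ?_
    rw [← hcm _ h1'.le, he, hcm _ hlt.le]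
  have h0 := (Ideal.height_le_iff (n := 1)).1 hht _ hP'm hlt2
  have h00 : (P'.asIdeal.map (Ideal.Quotient.mk P)).height = 0 := Order.lt_one_iff.1 h0
  rw [Ideal.height_eq_zero_iff_eq_bot] at h00
  refine h1'.ne' ?_
  rw [← hcm _ h1'.le, h00, ← RingHom.ker_eq_comap_bot, Ideal.mk_ker]

theorem isWeaklyRegular_pair_iff {R : Type*} [CommRing R] {x y : R} :
    RingTheory.Sequence.IsWeaklyRegular R [x, y] ↔
      (∀ a, x * a = 0 → a = 0) ∧ ∀ a, y * a ∈ Ideal.span {x} → a ∈ Ideal.span {x} := by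
  rw [RingTheory.Sequence.isWeaklyRegular_cons_iff,
    RingTheory.Sequence.isWeaklyRegular_singleton_iff]
  refine and_congr ?_ ?_
  · rw [isSMulRegular_iff_right_eq_zero_of_smul]; rfl
  · rw [isSMulRegular_quotient_iff_mem_of_smul_mem]
    simp [Submodule.mem_smul_pointwise_iff_exists, Ideal.mem_span_singleton', mul_comm]

theorem exists_covChain_of_covChain {A T : Type*} [CommRing A] [CommRing T] [IsNoetherianRing T]
    [Algebra A T] [Algebra.HasGoingDown A T] {n : ℕ} {p q : PrimeSpectrum A} (h : CovChain n p q)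
    {Q : PrimeSpectrum T} (hQ : Q.asIdeal ∈ (q.asIdeal.map (algebraMap A T)).minimalPrimes) :
    ∃ P : PrimeSpectrum T, P.asIdeal ∈ (p.asIdeal.map (algebraMap A T)).minimalPrimes ∧
      CovChain n P Q := by
  induction h with
  | refl p => exact ⟨Q, hQ, .refl Q⟩
  | head hpq _ ih =>
    obtain ⟨P, hP, hc⟩ := ih hQ
    obtain ⟨P', hP', hc'⟩ := exists_covBy_of_covBy hpq hP
    exact ⟨P', hP', .head hc' hc⟩

section Flat

variable {A T : Type} [CommRing A] [IsDomain A] [IsLocalRing A] [IsNoetherianRing A] [CommRing T]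
  [IsLocalRing T] [IsNoetherianRing T] [Algebra A T] [Module.Flat A T]

theorem intCast_mem_nonZeroDivisors_of_flat (A T : Type*) [CommRing A] [IsDomain A] [CommRing T]
    [Algebra A T] [Module.Flat A T] (z : ℤ) (hz : (z : T) ≠ 0) : (z : T) ∈ nonZeroDivisors T := by
  have hzA : (z : A) ≠ 0 := fun h => hz (by simpa using congrArg (algebraMap A T) h)
  have h1 : RingTheory.Sequence.IsWeaklyRegular A [(z : A)] := by
    rw [RingTheory.Sequence.isWeaklyRegular_singleton_iff]
    intro x y hxy
    exact mul_left_cancel₀ hzA hxy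
  have h2 := h1.of_flat (S := T)
  rw [List.map_singleton, RingTheory.Sequence.isWeaklyRegular_singleton_iff] at h2
  rw [mem_nonZeroDivisors_iff_left]
  intro x hx
  refine h2 (a₁ := x) (a₂ := 0) ?_
  simpa using hx

omit [IsNoetherianRing T] in
theorem one_lt_ringDepth_of_flat [UniqueFactorizationMonoid A]
    (hm : (maximalIdeal A).map (algebraMap A T) = maximalIdeal T) (hd : 1 < ringKrullDim A) :
    1 < ringDepth T := by
  have hne : maximalIdeal A ≠ ⊥ := fun h0 => by
    rw [← maximalIdeal_height_eq_ringKrullDim, h0] at hd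
    simp at hd
    exact absurd hd (by decide)
  obtain ⟨x, hx, hxp⟩ := Ideal.IsPrime.exists_mem_prime_of_ne_bot (maximalIdeal.isMaximal A).isPrime
      hne
  have hxI : (Ideal.span {x}).IsPrime := (Ideal.span_singleton_prime hxp.ne_zero).2 hxp
  obtain ⟨y, hy, hyx⟩ : ∃ y ∈ maximalIdeal A, y ∉ Ideal.span {x} := by
    by_contra! h
    have h1 : Ideal.span {x} = maximalIdeal A :=
      le_antisymm ((Ideal.span_singleton_le_iff_mem _).2 hx) h
    have h2 : (maximalIdeal A).height ≤ 1 :=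
      Ideal.height_le_one_of_isPrincipal_of_mem_minimalPrimes (Ideal.span {x}) _
        ⟨⟨inferInstance, h1.le⟩, fun q hq _ => h1.ge.trans hq.2⟩
    rw [← maximalIdeal_height_eq_ringKrullDim] at hd
    exact absurd hd (not_lt_of_ge (by exact_mod_cast h2))
  have hreg : RingTheory.Sequence.IsWeaklyRegular A [x, y] := by
    rw [isWeaklyRegular_pair_iff]
    refine ⟨fun a h => (mul_eq_zero.1 h).resolve_left hxp.ne_zero, fun a h => ?_⟩
    exact (hxI.mem_or_mem h).resolve_left hyx
  have hreg' := hreg.of_flat (S := T)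
  have hmem : ∀ r ∈ [x, y].map (algebraMap A T), r ∈ maximalIdeal T := by
    intro r hr
    rw [List.mem_map] at hr
    obtain ⟨a, ha, rfl⟩ := hr
    rw [← hm]
    refine Ideal.mem_map_of_mem _ ?_
    simp only [List.mem_cons, List.not_mem_nil, or_false] at ha
    rcases ha with rfl | rfl <;> assumption
  have h2 : (2 : ℕ∞) ≤ ringDepth T := le_sSup
    ⟨[x, y].map (algebraMap A T), by simp, hmem,
      (IsLocalRing.isRegular_iff_isWeaklyRegular_of_subset_maximalIdeal hmem).2 hreg'⟩
  exact lt_of_lt_of_le (by norm_num) h2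

theorem exists_minimalPrimes_of_flat [UniqueFactorizationMonoid A]
    [IsAdicComplete (maximalIdeal T) T]
    (hm : (maximalIdeal A).map (algebraMap A T) = maximalIdeal T) (hA : ¬ IsCatenary A) :
    1 < ringKrullDim A ∧ ∃ P ∈ minimalPrimes T,
          2 < ringKrullDim (T ⧸ P) ∧ ringKrullDim (T ⧸ P) < ringKrullDim T := by
  obtain ⟨n, hn, hlt⟩ := exists_covChain_of_not_isCatenary hA
  have h3 : 3 ≤ n := by
    by_contra h
    exact absurd hlt (not_lt_of_ge
      (ringKrullDim_le_of_covChain_of_le_two rfl rfl hn (by omega)))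
  have : Algebra.HasGoingDown A T := Algebra.HasGoingDown.of_flat
  obtain ⟨P, hP, hc⟩ := exists_covChain_of_covChain hn (Q := closedPoint T) (by
    change maximalIdeal T ∈ ((maximalIdeal A).map (algebraMap A T)).minimalPrimes
    rw [hm, Ideal.minimalPrimes_eq_subsingleton_self]
    exact Set.mem_singleton _)
  have hdim : ringKrullDim A ≤ ringKrullDim T := by
    have : (maximalIdeal T).LiesOver (maximalIdeal A) := ⟨by
      refine (maximalIdeal.isMaximal A).eq_of_le (Ideal.IsPrime.ne_top inferInstance) ?_
      exact Ideal.map_le_iff_le_comap.1 hm.le⟩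
    rw [← maximalIdeal_height_eq_ringKrullDim, ← maximalIdeal_height_eq_ringKrullDim,
      Ideal.height_eq_height_add_of_liesOver_of_hasGoingDown (maximalIdeal A) (maximalIdeal T)]
    exact_mod_cast le_self_add
  have h3' : (3 : WithBot ℕ∞) ≤ n := by exact_mod_cast h3
  refine ⟨lt_of_le_of_lt (le_trans (by norm_num) h3') hlt, P.asIdeal, ?_, ?_, ?_⟩
  · simpa [Ideal.map_bot] using hP
  · refine lt_of_lt_of_le ?_ (natCast_le_ringKrullDim_quotient_of_covChain hc)
    exact_mod_cast (by omega : 2 < n)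
  · exact lt_of_le_of_lt (ringKrullDim_le_of_covChain hc rfl) (hlt.trans_le hdim)

end Flat

theorem conditions_of_completion (T : Type) [CommRing T] [IsLocalRing T] [IsNoetherianRing T]
    [IsAdicComplete (maximalIdeal T) T] (A : Type) [CommRing A] [IsDomain A] [IsLocalRing A]
    [IsNoetherianRing A] [UniqueFactorizationMonoid A] (hA : ¬ IsCatenary A)
    (e : AdicCompletion (maximalIdeal A) A ≃+* T) :
    (∀ z : ℤ, (z : T) ≠ 0 → (z : T) ∈ nonZeroDivisors T) ∧
        1 < ringDepth T ∧
        ∃ P ∈ minimalPrimes T,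
          2 < ringKrullDim (T ⧸ P) ∧ ringKrullDim (T ⧸ P) < ringKrullDim T := by
  let _ : Algebra A T := (e.toRingHom.comp (algebraMap A
      (AdicCompletion (maximalIdeal A) A))).toAlgebra
  let e' : AdicCompletion (maximalIdeal A) A ≃ₗ[A] T :=
    { e with
      map_smul' := fun a x => by
        rw [Algebra.smul_def, Algebra.smul_def]
        exact map_mul e _ _ }
  have : Module.Flat A T := Module.Flat.of_linearEquiv e'.symm
  have hm : (maximalIdeal A).map (algebraMap A T) = maximalIdeal T := by
    change (maximalIdeal A).map (e.toRingHom.comp (algebraMap A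
        (AdicCompletion (maximalIdeal A) A)))
      = maximalIdeal T
    rw [← Ideal.map_map, ← AdicCompletion.maximalIdeal_eq_map]
    exact IsLocalRing.map_maximalIdeal_of_surjective _ e.surjective
  obtain ⟨h1, h2⟩ := exists_minimalPrimes_of_flat hm hA
  exact ⟨fun z hz => intCast_mem_nonZeroDivisors_of_flat A T z hz,
    one_lt_ringDepth_of_flat hm h1, h2⟩

section NSubring

variable {T : Type} [CommRing T]

/-- A nonzero nonunit `p` of `R` which is prime for products of an element of `R` and an element
of `T`. -/
structure IsStrongPrime (R : Subring T) (p : T) : Prop where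
  mem : p ∈ R
  not_isUnit : ¬ IsUnit p
  ne_zero : p ≠ 0
  dvd_or_dvd : ∀ r ∈ R, ∀ t, p ∣ r * t → p ∣ r ∨ p ∣ t

/-- A subring of `T` closed under quotients, whose nonzero elements are nonzerodivisors of `T`, and
whose elements are products of units and strong primes. -/
structure IsNSubring (R : Subring T) : Prop where
  regular : ∀ r ∈ R, r ≠ 0 → r ∈ nonZeroDivisors T
  closed : ∀ g ∈ R, g ≠ 0 → ∀ s, s * g ∈ R → s ∈ R
  factor : ∀ r ∈ R, r ≠ 0 → r ∈ Submonoid.closure {x | x ∈ R ∧ (IsUnit x ∨ IsStrongPrime R x)}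

/-- The elements of `T` that are fractions of elements of `R`. -/
def fracClosure (R : Subring T) : Subring T where
  carrier := {s | ∃ f ∈ R, ∃ g ∈ R, g ∈ nonZeroDivisors T ∧ s * g = f}
  mul_mem' := by
    rintro s s' ⟨f, hf, g, hg, hgr, h⟩ ⟨f', hf', g', hg', hgr', h'⟩
    exact ⟨f * f', R.mul_mem hf hf', g * g', R.mul_mem hg hg', mul_mem hgr hgr',
      by rw [← h, ← h']; ring⟩
  one_mem' := ⟨1, R.one_mem, 1, R.one_mem, one_mem _, by ring⟩
  add_mem' := by
    rintro s s' ⟨f, hf, g, hg, hgr, h⟩ ⟨f', hf', g', hg', hgr', h'⟩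
    exact ⟨f * g' + f' * g, R.add_mem (R.mul_mem hf hg') (R.mul_mem hf' hg), g * g',
      R.mul_mem hg hg', mul_mem hgr hgr', by rw [← h, ← h']; ring⟩
  zero_mem' := ⟨0, R.zero_mem, 1, R.one_mem, one_mem _, by ring⟩
  neg_mem' := by
    rintro s ⟨f, hf, g, hg, hgr, h⟩
    exact ⟨-f, R.neg_mem hf, g, hg, hgr, by rw [← h]; ring⟩

theorem mem_fracClosure {R : Subring T} {s : T} :
    s ∈ fracClosure R ↔ ∃ f ∈ R, ∃ g ∈ R, g ∈ nonZeroDivisors T ∧ s * g = f := Iff.rfl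

theorem le_fracClosure (R : Subring T) : R ≤ fracClosure R := fun x hx =>
  ⟨x, hx, 1, R.one_mem, one_mem _, mul_one x⟩

theorem mem_fracClosure_of_mul_mem {R : Subring T} {g s : T} (hg : g ∈ fracClosure R)
    (hgr : g ∈ nonZeroDivisors T) (h : s * g ∈ fracClosure R) : s ∈ fracClosure R := by
  obtain ⟨a, ha, b, hb, hbr, hab⟩ := hg
  obtain ⟨c, hc, d, hd, hdr, hcd⟩ := h
  refine ⟨b * c, R.mul_mem hb hc, a * d, R.mul_mem ha hd, ?_, ?_⟩
  · rw [← hab]; exact mul_mem (mul_mem hgr hbr) hdr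
  · rw [← hab, ← hcd]; ring

theorem fracClosure_le_of_le {R S : Subring T} (h : R ≤ fracClosure S) :
    fracClosure R ≤ fracClosure S := by
  rintro s ⟨f, hf, g, hg, hgr, hfg⟩
  exact mem_fracClosure_of_mul_mem (h hg) hgr (hfg ▸ h hf)

namespace IsNSubring

variable {R : Subring T} (hR : IsNSubring R)

include hR

theorem eq_zero_of_mul_eq_zero {r t : T} (hr : r ∈ R) (hr0 : r ≠ 0) (h : r * t = 0) : t = 0 := by
  have := (mem_nonZeroDivisors_iff_left.1 (hR.regular r hr hr0)) t h
  exact this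

theorem isDomain [Nontrivial T] : IsDomain R := by
  have : NoZeroDivisors R := ⟨fun {a b} h => by
    by_contra! hab
    refine hab.2 (Subtype.ext ?_)
    exact hR.eq_zero_of_mul_eq_zero a.2 (fun h => hab.1 (Subtype.ext h)) (congrArg Subtype.val h)⟩
  exact NoZeroDivisors.to_isDomain R

theorem dvd_iff {a b : R} : a ∣ b ↔ (a : T) ∣ b := by
  refine ⟨fun ⟨c, hc⟩ => ⟨c, by rw [hc]; rfl⟩, fun ⟨c, hc⟩ => ?_⟩
  by_cases ha : (a : T) = 0
  · refine ⟨0, Subtype.ext ?_⟩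
    rw [hc, ha]; simp
  · exact ⟨⟨c, hR.closed a a.2 ha c (by rw [mul_comm, ← hc]; exact b.2)⟩, Subtype.ext hc⟩

theorem isUnit_iff [Nontrivial T] {a : R} : IsUnit a ↔ IsUnit (a : T) := by
  rw [isUnit_iff_dvd_one, isUnit_iff_dvd_one, hR.dvd_iff]; rfl

theorem prime_of_isStrongPrime [Nontrivial T] {p : R} (hp : IsStrongPrime R (p : T)) : Prime p := by
  refine ⟨fun h => hp.ne_zero (congrArg Subtype.val h), fun h => hp.not_isUnit (hR.isUnit_iff.1 h),
    fun a b h => ?_⟩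
  rw [hR.dvd_iff] at h ⊢
  rw [hR.dvd_iff]
  exact hp.dvd_or_dvd a a.2 b h

omit hR in
theorem closure_le :
    ((Submonoid.closure {x | x ∈ R ∧ (IsUnit x ∨ IsStrongPrime R x)} : Submonoid T) :
    Set T) ⊆ R := by
  have : Submonoid.closure {x | x ∈ R ∧ (IsUnit x ∨ IsStrongPrime R x)} ≤ R.toSubmonoid :=
    Submonoid.closure_le.2 fun x hx => hx.1
  exact this

theorem uniqueFactorizationMonoid [Nontrivial T] : UniqueFactorizationMonoid R := by
  have := hR.isDomain
  rw [UniqueFactorizationMonoid.iff_exists_prime_mem_of_isPrime]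
  intro P hP hP'
  obtain ⟨r, hr, hr0⟩ := Submodule.exists_mem_ne_zero_of_ne_bot hP
  have key : ∀ x ∈ Submonoid.closure {x | x ∈ R ∧ (IsUnit x ∨ IsStrongPrime R x)},
      ∀ hx : x ∈ R, (⟨x, hx⟩ : R) ∈ P → ∃ p ∈ P, Prime p := by
    intro x hx
    induction hx using Submonoid.closure_induction with
    | mem x h =>
      intro hx hxP
      rcases h.2 with hu | hs
      · exact absurd (P.eq_top_of_isUnit_mem hxP (hR.isUnit_iff.2 hu)) hP'.ne_top
      · exact ⟨_, hxP, hR.prime_of_isStrongPrime hs⟩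
    | one =>
      intro hx hxP
      exact absurd (P.eq_top_of_isUnit_mem hxP (hR.isUnit_iff.2 isUnit_one)) hP'.ne_top
    | mul x y hx hy ihx ihy =>
      intro hxy hxyP
      have : (⟨x, closure_le hx⟩ * ⟨y, closure_le hy⟩ : R) ∈ P := hxyP
      rcases hP'.mem_or_mem this with h | h
      · exact ihx _ h
      · exact ihy _ h
  obtain ⟨p, hp, hpp⟩ := key r (hR.factor r r.2 fun h => hr0 (Subtype.ext h)) r.2 hr
  exact ⟨p, hp, hpp⟩

theorem isStrongPrime_of_prime [Nontrivial T] {p : R} (hp : Prime p) : IsStrongPrime R (p : T) := by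
  have := hR.isDomain
  have key : ∀ x ∈ Submonoid.closure {x | x ∈ R ∧ (IsUnit x ∨ IsStrongPrime R x)},
      (p : T) ∣ x → IsStrongPrime R (p : T) := by
    intro x hx
    induction hx using Submonoid.closure_induction with
    | mem x h =>
      intro hdvd
      rcases h.2 with hu | hs
      · exact absurd (hR.isUnit_iff.2 (isUnit_of_dvd_unit hdvd hu)) hp.not_isUnit
      · have h1 : p ∣ ⟨x, h.1⟩ := hR.dvd_iff.2 hdvd
        have h2 : x ∣ p := hR.dvd_iff.1
          ((hp.irreducible.dvd_comm (hR.prime_of_isStrongPrime (p := ⟨x, h.1⟩) hs).irreducible).1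
              h1)
        exact ⟨p.2, fun h => hp.not_isUnit (hR.isUnit_iff.2 h), fun h => hp.ne_zero (Subtype.ext h),
          fun r hr t hrt => (hs.dvd_or_dvd r hr t (h2.trans hrt)).imp hdvd.trans hdvd.trans⟩
    | one => exact fun h => absurd (hR.isUnit_iff.2 (isUnit_of_dvd_one h)) hp.not_isUnit
    | mul x y hx hy ihx ihy =>
      intro hdvd
      have : p ∣ ⟨x, closure_le hx⟩ * ⟨y, closure_le hy⟩ := hR.dvd_iff.2 hdvd
      rcases hp.dvd_or_dvd this with h | h
      · exact ihx (hR.dvd_iff.1 h)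
      · exact ihy (hR.dvd_iff.1 h)
  exact key p (hR.factor p p.2 fun h => hp.ne_zero (Subtype.ext h)) dvd_rfl

end IsNSubring

/-- Factorability is inherited by divisors. -/
theorem mem_closure_of_mul_mem_closure {S : Subring T}
    (hreg : ∀ r ∈ S, r ≠ 0 → r ∈ nonZeroDivisors T)
    (hcl : ∀ g ∈ S, g ≠ 0 → ∀ s, s * g ∈ S → s ∈ S) {w : T} (hw0 : w ≠ 0)
    (hw : w ∈ Submonoid.closure {x | x ∈ S ∧ (IsUnit x ∨ IsStrongPrime S x)}) :
    ∀ s ∈ S, ∀ g ∈ S, s * g = w →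
      s ∈ Submonoid.closure {x | x ∈ S ∧ (IsUnit x ∨ IsStrongPrime S x)} := by
  have hcan : ∀ r ∈ S, r ≠ 0 → ∀ a b, r * a = r * b → a = b := fun r hr hr0 a b h => by
    have := (mem_nonZeroDivisors_iff_left.1 (hreg r hr hr0)) (a - b) (by rw [mul_sub, h, sub_self])
    exact sub_eq_zero.1 this
  induction hw using Submonoid.closure_induction_left with
  | one => exact fun s hs g hg h => Submonoid.subset_closure ⟨hs, Or.inl (.of_mul_eq_one g h)⟩
  | mul_left x hx y hy ih =>
    have hx0 : x ≠ 0 := fun h => hw0 (by rw [h, zero_mul])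
    have hy0 : y ≠ 0 := fun h => hw0 (by rw [h, mul_zero])
    intro s hs g hg hsg
    rcases hx.2 with hu | hp
    · obtain ⟨v, hv⟩ := hu.exists_left_inv
      have hvS : v ∈ S := hcl x hx.1 hx0 v (hv ▸ S.one_mem)
      refine ih hy0 s hs (v * g) (S.mul_mem hvS hg) ?_
      calc s * (v * g) = v * (s * g) := by ring
        _ = (v * x) * y := by rw [hsg]; ring
        _ = y := by rw [hv, one_mul]
    · rcases hp.dvd_or_dvd s hs g ⟨y, hsg⟩ with ⟨s', rfl⟩ | ⟨g', rfl⟩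
      · have hs' : s' ∈ S := hcl x hx.1 hx0 s' (mul_comm x s' ▸ hs)
        refine mul_mem (Submonoid.subset_closure hx) (ih hy0 s' hs' g hg ?_)
        exact hcan x hx.1 hx0 _ _ (by rw [← hsg]; ring)
      · have hg' : g' ∈ S := hcl x hx.1 hx0 g' (mul_comm x g' ▸ hg)
        exact ih hy0 s hs g' hg' (hcan x hx.1 hx0 _ _ (by rw [← hsg]; ring))

section Map

variable {B : Type} [CommRing B] [IsDomain B] [UniqueFactorizationMonoid B] {φ : B →+* T}
  (hφ : ∀ b, b ≠ 0 → φ b ∈ nonZeroDivisors T)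

include hφ

omit [IsDomain B] [UniqueFactorizationMonoid B] in
theorem fracClosure_range_regular [Nontrivial T] :
    ∀ r ∈ fracClosure φ.range, r ≠ 0 → r ∈ nonZeroDivisors T := by
  rintro r ⟨_, ⟨f, rfl⟩, _, ⟨g, rfl⟩, hgr, h⟩ hr0
  have hf0 : f ≠ 0 := by
    rintro rfl
    rw [map_zero] at h
    exact hr0 ((mem_nonZeroDivisors_iff_right.1 hgr) r h)
  exact (mul_mem_nonZeroDivisors.1 (h ▸ hφ f hf0)).1

omit [IsDomain B] [UniqueFactorizationMonoid B] in
theorem fracClosure_range_closed [Nontrivial T] :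
    ∀ g ∈ fracClosure φ.range, g ≠ 0 → ∀ s, s * g ∈ fracClosure φ.range → s ∈ fracClosure φ.range :=
  fun g hg hg0 _ h => mem_fracClosure_of_mul_mem hg (fracClosure_range_regular hφ g hg hg0) h

theorem exists_isRelPrime_of_mem_fracClosure {s : T} (hs : s ∈ fracClosure φ.range) :
    ∃ f g : B, g ≠ 0 ∧ IsRelPrime f g ∧ s * φ g = φ f := by
  obtain ⟨_, ⟨f, rfl⟩, _, ⟨g, rfl⟩, hgr, h⟩ := hs
  by_cases hg0 : g = 0
  · refine ⟨0, 1, one_ne_zero, isRelPrime_one_right, ?_⟩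
    rw [hg0, map_zero] at hgr
    have : ∀ x : T, x = 0 := fun x => (mem_nonZeroDivisors_iff_right.1 hgr) x (mul_zero x)
    rw [this (φ 0)]; exact this _
  obtain ⟨f', g', c, hrel, hf, hg⟩ := UniqueFactorizationMonoid.exists_reduced_factors' f g hg0
  have hc0 : c ≠ 0 := by rintro rfl; exact hg0 (by rw [← hg, zero_mul])
  refine ⟨f', g', fun h0 => hg0 (by rw [← hg, h0, mul_zero]), hrel, ?_⟩
  have h2 : φ c * (s * φ g' - φ f') = 0 := by
    rw [← hf, ← hg, map_mul, map_mul] at h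
    linear_combination h
  exact sub_eq_zero.1 ((mem_nonZeroDivisors_iff_left.1 (hφ c hc0)) _ h2)

omit [IsDomain B] in
theorem isNSubring_fracClosure_range [Nontrivial T]
    (h : ∀ p : B, Prime p → φ p ∈ Submonoid.closure {x | x ∈ fracClosure φ.range ∧
      (IsUnit x ∨ IsStrongPrime (fracClosure φ.range) x)}) : IsNSubring (fracClosure φ.range) := by
  refine ⟨fracClosure_range_regular hφ, fracClosure_range_closed hφ, ?_⟩
  have hmem : ∀ b, φ b ∈ fracClosure φ.range := fun b => le_fracClosure _ ⟨b, rfl⟩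
  have key : ∀ b : B, b ≠ 0 → φ b ∈ Submonoid.closure {x | x ∈ fracClosure φ.range ∧
      (IsUnit x ∨ IsStrongPrime (fracClosure φ.range) x)} := by
    intro b
    induction b using UniqueFactorizationMonoid.induction_on_prime with
    | h₁ => exact fun h => absurd rfl h
    | h₂ u hu => exact fun _ => Submonoid.subset_closure ⟨hmem u, Or.inl (hu.map φ)⟩
    | h₃ a p ha hp ih =>
      intro _
      rw [map_mul]
      exact mul_mem (h p hp) (ih ha)
  intro s hs hs0
  obtain ⟨_, ⟨f, rfl⟩, _, ⟨g, rfl⟩, hgr, hsg⟩ := id hs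
  have hf0 : φ f ≠ 0 := by
    intro h0
    rw [h0] at hsg
    exact hs0 ((mem_nonZeroDivisors_iff_right.1 hgr) s hsg)
  exact mem_closure_of_mul_mem_closure (fracClosure_range_regular hφ) (fracClosure_range_closed hφ)
      hf0
    (key f fun h => hf0 (by rw [h, map_zero])) s hs (φ g) (hmem g) hsg

theorem isStrongPrime_fracClosure_range [Nontrivial T] {p : B} (hp : Prime p) (hu : ¬ IsUnit (φ p))
    (h : ∀ f, ¬ p ∣ f → ∀ t, φ p ∣ φ f * t → φ p ∣ t) :
    IsStrongPrime (fracClosure φ.range) (φ p) := by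
  refine ⟨le_fracClosure _ ⟨p, rfl⟩, hu, nonZeroDivisors.ne_zero (hφ p hp.ne_zero), ?_⟩
  intro s hs t hst
  obtain ⟨f, g, -, hrel, hsg⟩ := exists_isRelPrime_of_mem_fracClosure hφ hs
  by_cases hpf : p ∣ f
  · have hpg : ¬ p ∣ g := fun hpg => hp.not_isUnit (hrel hpf hpg)
    refine Or.inl (h g hpg s ?_)
    rw [mul_comm, hsg]
    exact map_dvd φ hpf
  · refine Or.inr (h f hpf t ?_)
    rw [← hsg]
    exact (hst.mul_left (φ g)).trans (dvd_of_eq (by ring))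

end Map

end NSubring

open Polynomial in
theorem exists_C_mem_span_pair {R : Type} [CommRing R] [IsDomain R] {h f : R[X]} (hp : Prime h)
    (hd : h.natDegree ≠ 0) (hf : ¬ h ∣ f) : ∃ d : R, d ≠ 0 ∧ C d ∈ Ideal.span {h, f} := by
  let K := FractionRing R
  let M : Submonoid R[X] := (nonZeroDivisors R).map (C : R →+* R[X])
  let _ : Algebra R[X] K[X] := Polynomial.algebra R K
  have : IsLocalization M K[X] := Polynomial.isLocalization (nonZeroDivisors R) K
  have hprime : (Ideal.span {h}).IsPrime := (Ideal.span_singleton_prime hp.ne_zero).2 hp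
  have hdisj : Disjoint (M : Set R[X]) (Ideal.span {h} : Ideal R[X]) := by
    rw [Set.disjoint_left]
    rintro _ ⟨d, hd', rfl⟩ hmem
    have h1 : h ∣ C d := Ideal.mem_span_singleton.1 hmem
    have hd0 : C d ≠ 0 := C_ne_zero.2 (nonZeroDivisors.ne_zero hd')
    have := natDegree_le_of_dvd h1 hd0
    rw [natDegree_C] at this
    exact hd (Nat.le_zero.1 this)
  have hP := IsLocalization.isPrime_of_isPrime_disjoint M K[X] _ hprime hdisj
  have hcomap := IsLocalization.under_map_of_isPrime_disjoint M K[X] hprime hdisj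
  have hfn : algebraMap R[X] K[X] f ∉ Ideal.map (algebraMap R[X] K[X]) (Ideal.span {h}) := by
    intro hmem
    have : f ∈ Ideal.under R[X] (Ideal.map (algebraMap R[X] K[X]) (Ideal.span {h})) := hmem
    rw [hcomap] at this
    exact hf (Ideal.mem_span_singleton.1 this)
  have hne : Ideal.map (algebraMap R[X] K[X]) (Ideal.span {h}) ≠ ⊥ := by
    intro hb
    have : h ∈ (Ideal.map (algebraMap R[X] K[X]) (Ideal.span {h})).comap (algebraMap R[X] K[X]) :=
      Ideal.mem_map_of_mem _ (Ideal.mem_span_singleton_self h)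
    have h2 := (Ideal.mem_bot.1 (hb ▸ this : algebraMap R[X] K[X] h ∈ (⊥ : Ideal K[X])))
    have h3 : Function.Injective (algebraMap R[X] K[X]) :=
      Polynomial.map_injective _ (IsFractionRing.injective R K)
    exact hp.ne_zero (h3 (by rw [h2, map_zero]))
  have hmax : (Ideal.map (algebraMap R[X] K[X]) (Ideal.span {h})).IsMaximal :=
    hP.isMaximal hne
  have htop : Ideal.map (algebraMap R[X] K[X]) (Ideal.span {h, f}) = ⊤ := by
    by_contra htop
    have hle : Ideal.map (algebraMap R[X] K[X]) (Ideal.span {h}) ≤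
        Ideal.map (algebraMap R[X] K[X]) (Ideal.span {h, f}) :=
      Ideal.map_mono (Ideal.span_mono (by simp))
    exact hfn (hmax.eq_of_le htop hle ▸ Ideal.mem_map_of_mem _ (Ideal.subset_span (by simp)))
  by_contra! hcon
  refine ((IsLocalization.map_algebraMap_ne_top_iff_disjoint M K[X] (Ideal.span {h, f})).2 ?_) htop
  rw [Set.disjoint_left]
  rintro _ ⟨d, hd', rfl⟩ hmem
  exact hcon d (nonZeroDivisors.ne_zero hd') hmem


section Adjoin

variable {T : Type} [CommRing T] {R : Subring T}

/-- Evaluation at `x` of polynomials with coefficients in a subring. -/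
noncomputable def evalHom (R : Subring T) (x : T) : Polynomial R →+* T :=
  Polynomial.eval₂RingHom R.subtype x

/-- The fractions of elements of `R[x]`. -/
noncomputable def adjoinFrac (R : Subring T) (x : T) : Subring T := fracClosure (evalHom R x).range

@[simp] theorem evalHom_C (x : T) (r : R) : evalHom R x (Polynomial.C r) = r := by
  simp [evalHom]

@[simp] theorem evalHom_X (x : T) : evalHom R x Polynomial.X = x := by
  simp [evalHom]

theorem le_adjoinFrac (x : T) : R ≤ adjoinFrac R x :=
  fun r hr => le_fracClosure _ ⟨Polynomial.C ⟨r, hr⟩, evalHom_C x _⟩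

theorem mem_adjoinFrac (x : T) : x ∈ adjoinFrac R x :=
  le_fracClosure _ ⟨Polynomial.X, evalHom_X x⟩

theorem evalHom_mem {S : Subring T} (h : R ≤ S) {x : T} (hx : x ∈ S) (f : Polynomial R) :
    evalHom R x f ∈ S := by
  rw [evalHom, Polynomial.coe_eval₂RingHom, Polynomial.eval₂_eq_sum]
  exact Subring.sum_mem _ fun i _ => S.mul_mem (h (f.coeff i).2) (S.pow_mem hx i)

theorem adjoinFrac_le {y x : T} (hy : y ∈ adjoinFrac R x) : adjoinFrac R y ≤ adjoinFrac R x := by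
  refine fracClosure_le_of_le ?_
  rintro _ ⟨f, rfl⟩
  exact evalHom_mem (le_adjoinFrac x) hy f

variable [Nontrivial T]

theorem IsNSubring.isStrongPrime_adjoinFrac (hR : IsNSubring R) {x p : T}
    (hx : ∀ f, f ≠ 0 → evalHom R x f ∈ nonZeroDivisors T) (hp : IsStrongPrime R p)
    (hpx : ∀ f, ¬ Polynomial.C ⟨p, hp.mem⟩ ∣ f → ∀ t, p ∣ evalHom R x f * t → p ∣ t) :
    IsStrongPrime (adjoinFrac R x) p := by
  have := hR.isDomain
  have := hR.uniqueFactorizationMonoid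
  have hp' : Prime (⟨p, hp.mem⟩ : R) := hR.prime_of_isStrongPrime hp
  have := isStrongPrime_fracClosure_range hx (Polynomial.prime_C_iff.2 hp')
    (by rw [evalHom_C]; exact hp.not_isUnit) (by rw [evalHom_C]; exact hpx)
  rwa [evalHom_C] at this

variable [IsNoetherianRing T]

omit [Nontrivial T] in
theorem exists_mul_eq_forall_not_dvd {S : Subring T}
    (hreg : ∀ r ∈ S, r ≠ 0 → r ∈ nonZeroDivisors T)
    (hcl : ∀ g ∈ S, g ≠ 0 → ∀ s, s * g ∈ S → s ∈ S) {P : Set T} (hPS : P ⊆ S)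
    (hP0 : ∀ p ∈ P, p ≠ 0) (hPu : ∀ p ∈ P, ¬ IsUnit p) {w : T} (hw : w ∈ S) (hw0 : w ≠ 0) :
    ∃ d ∈ Submonoid.closure P, ∃ w' ∈ S, w = d * w' ∧ ∀ p ∈ P, ¬ p ∣ w' := by
  induction hI : Ideal.span {w} using WellFoundedGT.induction generalizing w with
  | ind I ih =>
    by_cases h : ∃ p ∈ P, p ∣ w
    · obtain ⟨p, hp, w', rfl⟩ := h
      have hw' : w' ∈ S := hcl p (hPS hp) (hP0 p hp) w' (mul_comm p w' ▸ hw)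
      have hw'0 : w' ≠ 0 := fun h => hw0 (by rw [h, mul_zero])
      have hlt : I < Ideal.span {w'} := by
        rw [← hI, SetLike.lt_iff_le_and_exists]
        refine ⟨Ideal.span_singleton_le_span_singleton.2 ⟨p, mul_comm _ _⟩, w',
          Ideal.mem_span_singleton_self w', fun hmem => ?_⟩
        obtain ⟨c, hc⟩ := Ideal.mem_span_singleton.1 hmem
        have h0 : w' * (p * c - 1) = 0 := by linear_combination -hc
        have := (mem_nonZeroDivisors_iff_left.1 (hreg w' hw' hw'0)) _ h0
        exact hPu p hp (.of_mul_eq_one c (sub_eq_zero.1 this))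
      obtain ⟨d, hd, w'', hw'', hdw, hn⟩ := ih _ hlt hw' hw'0 rfl
      exact ⟨p * d, mul_mem (Submonoid.subset_closure hp) hd, w'', hw'',
        by rw [hdw, mul_assoc], hn⟩
    · push Not at h
      exact ⟨1, one_mem _, w, hw, (one_mul w).symm, h⟩

theorem IsNSubring.isNSubring_adjoinFrac (hR : IsNSubring R) {x : T}
    (hx : ∀ f, f ≠ 0 → evalHom R x f ∈ nonZeroDivisors T)
    (hS : ∀ p, IsStrongPrime R p → IsStrongPrime (adjoinFrac R x) p) :
    IsNSubring (adjoinFrac R x) := by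
  have := hR.isDomain
  have := hR.uniqueFactorizationMonoid
  have hreg : ∀ r ∈ adjoinFrac R x, r ≠ 0 → r ∈ nonZeroDivisors T :=
    fracClosure_range_regular hx
  have hcl : ∀ g ∈ adjoinFrac R x, g ≠ 0 → ∀ s, s * g ∈ adjoinFrac R x →
    s ∈ adjoinFrac R x := fracClosure_range_closed hx
  refine isNSubring_fracClosure_range hx fun h hh => ?_
  by_cases hdeg : h.natDegree = 0
  · rw [Polynomial.eq_C_of_natDegree_eq_zero hdeg] at hh ⊢
    rw [evalHom_C]
    have h1 : Prime (h.coeff 0) := Polynomial.prime_C_iff.1 hh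
    have h2 := hS _ (hR.isStrongPrime_of_prime h1)
    exact Submonoid.subset_closure ⟨h2.mem, Or.inr h2⟩
  have hmem : ∀ f, evalHom R x f ∈ adjoinFrac R x := fun f => le_fracClosure _ ⟨f, rfl⟩
  obtain ⟨d, hd, h', hh', hdh, hn⟩ := exists_mul_eq_forall_not_dvd hreg hcl
    (P := {p | IsStrongPrime R p}) (fun p hp => le_adjoinFrac x hp.mem) (fun p hp => hp.ne_zero)
    (fun p hp => hp.not_isUnit) (hmem h) (nonZeroDivisors.ne_zero (hx h hh.ne_zero))
  have hcancel : ∀ r ∈ Submonoid.closure {x | x ∈ R ∧ (IsUnit x ∨ IsStrongPrime R x)}, ∀ t,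
      h' ∣ r * t → h' ∣ t := by
    intro r hr
    induction hr using Submonoid.closure_induction with
    | one => intro t ht; rwa [one_mul] at ht
    | mul a b ha hb iha ihb => intro t ht; rw [mul_assoc] at ht; exact ihb t (iha _ ht)
    | mem p hp =>
      intro t ht
      rcases hp.2 with hu | hp'
      · exact (hu.dvd_mul_left).1 ht
      · obtain ⟨w, hw⟩ := ht
        rcases (hS p hp').dvd_or_dvd h' hh' w ⟨t, hw.symm⟩ with h1 | ⟨w', rfl⟩
        · exact absurd h1 (hn p hp')
        · have h0 : p * (t - h' * w') = 0 := by linear_combination hw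
          exact ⟨w', sub_eq_zero.1 (hR.eq_zero_of_mul_eq_zero hp'.mem hp'.ne_zero h0)⟩
  have hK : ∀ f, ¬ h ∣ f → ∀ t, h' ∣ evalHom R x f * t → h' ∣ t := by
    intro f hf t ht
    obtain ⟨c, hc0, hc⟩ := exists_C_mem_span_pair hh hdeg hf
    obtain ⟨v, u, huv⟩ := Ideal.mem_span_pair.1 hc
    refine hcancel c (hR.factor c c.2 fun h => hc0 (Subtype.ext h)) t ?_
    have h1 : (c : T) = evalHom R x v * evalHom R x h + evalHom R x u * evalHom R x f := by
      rw [← evalHom_C (R := R) x c, ← huv]; simp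
    rw [h1, hdh]
    obtain ⟨w, hw⟩ := ht
    exact ⟨evalHom R x v * d * t + evalHom R x u * w, by linear_combination evalHom R x u * hw⟩
  have hd' : d ∈ Submonoid.closure {y | y ∈ adjoinFrac R x ∧
      (IsUnit y ∨ IsStrongPrime (adjoinFrac R x) y)} :=
    Submonoid.closure_mono (by exact fun p (hp : IsStrongPrime R p) =>
      ⟨le_adjoinFrac x hp.mem, Or.inr (hS p hp)⟩) hd
  suffices hs : IsUnit h' ∨ IsStrongPrime (adjoinFrac R x) h' by
    rw [hdh]
    exact mul_mem hd' (Submonoid.subset_closure ⟨hh', hs⟩)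
  by_cases hu : IsUnit h'
  · exact Or.inl hu
  refine .inr ⟨hh', hu, ?_, ?_⟩
  · rintro rfl
    rw [mul_zero] at hdh
    exact nonZeroDivisors.ne_zero (hx h hh.ne_zero) hdh
  intro s hs t hst
  obtain ⟨f, g, -, hrel, hsg⟩ := exists_isRelPrime_of_mem_fracClosure hx hs
  by_cases hf : h ∣ f
  · refine Or.inl (hK g (fun hg => hh.not_isUnit (hrel hf hg)) s ?_)
    rw [mul_comm, hsg]
    exact (Dvd.intro_left d hdh.symm).trans (map_dvd _ hf)
  · refine Or.inr (hK f hf t ?_)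
    rw [← hsg]
    exact (hst.mul_left (evalHom R x g)).trans (dvd_of_eq (by ring))

end Adjoin

section Avoidance

variable {T : Type} [CommRing T] [IsLocalRing T] [IsNoetherianRing T]

theorem exists_mem_forall_sub_notMem_of_nat [IsAdicComplete (maximalIdeal T) T] (P : ℕ → Ideal T)
    [hP : ∀ n, (P n).IsPrime] (hPM : ∀ n, P n ≠ maximalIdeal T) (d : ℕ → T) (I : Ideal T)
    (hI : ∀ n, ¬ I ≤ P n) : ∃ v ∈ I, ∀ n, v - d n ∉ P n := by
  have step : ∀ n, ∀ s : {s : T × ℕ // s.1 ∈ I}, ∃ s' : {s : T × ℕ // s.1 ∈ I},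
      s.1.2 < s'.1.2 ∧ s'.1.1 - s.1.1 ∈ maximalIdeal T ^ s.1.2 ∧
        s'.1.1 - d n ∉ P n ⊔ maximalIdeal T ^ s'.1.2 := by
    rintro n ⟨⟨v, k⟩, hv⟩
    change v ∈ I at hv
    have h1 : ∃ w ∈ maximalIdeal T ^ k * I, v + w - d n ∉ P n := by
      by_cases hvd : v - d n ∈ P n
      · have h2 : ¬ maximalIdeal T ^ k * I ≤ P n := by
          rw [(hP n).mul_le]
          rintro (h | h)
          · have h3 : maximalIdeal T ≤ P n := (hP n).le_of_pow_le h
            exact hPM n (le_antisymm (le_maximalIdeal (hP n).ne_top) h3)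
          · exact hI n h
        obtain ⟨w, hw, hwP⟩ := SetLike.not_le_iff_exists.1 h2
        refine ⟨w, hw, fun h => hwP ?_⟩
        have := (P n).sub_mem h hvd
        rwa [show v + w - d n - (v - d n) = w by ring] at this
      · exact ⟨0, zero_mem _, by rwa [add_zero]⟩
    obtain ⟨w, hw, hwd⟩ := h1
    have h2 : ∃ j, v + w - d n ∉ P n ⊔ maximalIdeal T ^ j := by
      by_contra! h
      exact hwd (mem_of_forall_mem_sup_pow _ h)
    obtain ⟨j, hj⟩ := h2
    have hle : maximalIdeal T ^ k * I ≤ I := Ideal.mul_le_right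
    have hle' : maximalIdeal T ^ k * I ≤ maximalIdeal T ^ k := Ideal.mul_le_left
    have h3 : v + w ∈ I := I.add_mem hv (hle hw)
    refine ⟨⟨(v + w, max (k + 1) j), h3⟩, ?_, ?_, ?_⟩
    · exact lt_of_lt_of_le (Nat.lt_succ_self k) (le_max_left _ _)
    · change v + w - v ∈ _
      rw [add_sub_cancel_left]
      exact hle' hw
    · have h4 : P n ⊔ maximalIdeal T ^ max (k + 1) j ≤ P n ⊔ maximalIdeal T ^ j :=
        sup_le_sup_left (Ideal.pow_le_pow_right (le_max_right _ _)) _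
      exact fun h => hj (h4 h)
  choose F hF1 hF2 hF3 using step
  let s : ℕ → {s : T × ℕ // s.1 ∈ I} := fun n => Nat.rec ⟨⟨0, 0⟩, I.zero_mem⟩ (fun n s => F n s) n
  have hs : ∀ n, s (n + 1) = F n (s n) := fun n => rfl
  have hmono : StrictMono fun n => (s n).1.2 := strictMono_nat_of_lt_succ fun n => by
    rw [hs]; exact hF1 n (s n)
  have hk : ∀ n, n ≤ (s n).1.2 := fun n => hmono.le_apply
  have hdiff : ∀ n m, n ≤ m → (s m).1.1 - (s n).1.1 ∈ maximalIdeal T ^ (s n).1.2 := by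
    intro n m hnm
    induction m, hnm using Nat.le_induction with
    | base => rw [sub_self]; exact zero_mem _
    | succ m hnm ih =>
      have h1 := hF2 m (s m)
      rw [← hs] at h1
      have h2 := Ideal.add_mem _ (Ideal.pow_le_pow_right (hmono.monotone hnm) h1) ih
      rwa [sub_add_sub_cancel] at h2
  obtain ⟨v, hv⟩ := exists_adic_limit (maximalIdeal T) (fun n => (s n).1.1) fun n => by
    have h1 := hF2 n (s n)
    rw [← hs] at h1
    have h2 := neg_mem h1
    rw [neg_sub] at h2
    exact Ideal.pow_le_pow_right (hk n) h2
  refine ⟨v, mem_of_forall_mem_sup_pow _ fun n => ?_, fun n hmem => ?_⟩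
  · have h1 := Submodule.add_mem_sup (s n).2 (neg_mem (hv n))
    rwa [neg_sub, add_sub_cancel] at h1
  · have h1 := hF3 n (s n)
    rw [← hs] at h1
    refine h1 ?_
    set j := (s (n + 1)).1.2 with hj
    have h2 : v - (s (n + 1)).1.1 ∈ maximalIdeal T ^ j := by
      have h3 := hv (max j (n + 1))
      have h4 := hdiff (n + 1) (max j (n + 1)) (le_max_right _ _)
      have h5 := Ideal.sub_mem _ h4 (Ideal.pow_le_pow_right (le_max_left _ _) h3)
      convert h5 using 1
      ring
    have h6 := Submodule.add_mem_sup hmem (neg_mem h2)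
    convert h6 using 1
    ring

open Cardinal

theorem exists_mem_forall_sub_notMem_of_lt {Γ : Type} (hΓ : #Γ < #(ResidueField T))
    (hk : ℵ₀ < #(ResidueField T)) (P : Γ → Ideal T) [hP : ∀ n, (P n).IsPrime] (d : Γ → T)
    (I : Ideal T) (hI : ∀ n, ¬ I ≤ P n) : ∃ v ∈ I, ∀ n, v - d n ∉ P n := by
  obtain ⟨m, a, ha⟩ := Submodule.fg_iff_exists_fin_generating_family.1
      (IsNoetherian.noetherian I : I.FG)
  let σ : ResidueField T → T := Function.surjInv (residue_surjective (R := T))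
  have hσ : ∀ u, residue T (σ u) = u := Function.surjInv_eq _
  let v : T → T := fun u => ∑ i : Fin m, a i * u ^ (i.1 + 1)
  have hv : ∀ u, v u ∈ I := fun u => Ideal.sum_mem _ fun i _ => I.mul_mem_right _
    (ha ▸ Submodule.subset_span ⟨i, rfl⟩)
  have hfin : ∀ n, {u | v (σ u) - d n ∈ P n}.Finite := by
    intro n
    let f : Polynomial (T ⧸ P n) := ∑ i : Fin m, Polynomial.monomial (i.1 + 1)
        (Ideal.Quotient.mk (P n) (a i))
      - Polynomial.C (Ideal.Quotient.mk (P n) (d n))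
    have hf0 : f ≠ 0 := by
      intro hf
      refine hI n ?_
      rw [← ha]
      refine Ideal.span_le.2 ?_
      rintro _ ⟨j, rfl⟩
      have h1 : f.coeff (j.1 + 1) = Ideal.Quotient.mk (P n) (a j) := by
        simp [f, Polynomial.coeff_sub, Polynomial.coeff_monomial, Fin.val_inj]
      rw [hf, Polynomial.coeff_zero] at h1
      exact Ideal.Quotient.eq_zero_iff_mem.1 h1.symm
    have hinj : Function.Injective fun u => Ideal.Quotient.mk (P n) (σ u) := by
      intro u u' h
      rw [← hσ u, ← hσ u', ← sub_eq_zero, ← map_sub, residue_eq_zero_iff]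
      exact le_maximalIdeal (hP n).ne_top (Ideal.Quotient.eq.1 h)
    refine Set.Finite.of_finite_image (f := fun u => Ideal.Quotient.mk (P n) (σ u)) ?_ hinj.injOn
    refine (Polynomial.finite_setOfPred_isRoot hf0).subset ?_
    rintro _ ⟨u, hu, rfl⟩
    have h2 := Ideal.Quotient.eq_zero_iff_mem.2 hu
    simp only [v, map_sub, map_sum, map_mul, map_pow] at h2
    change f.eval _ = 0
    simpa [f, Polynomial.eval_finsetSum] using h2
  by_contra! hcon
  have hcov : (Set.univ : Set (ResidueField T)) ⊆ ⋃ n, {u | v (σ u) - d n ∈ P n} := by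
    intro u _
    obtain ⟨n, hn⟩ := hcon _ (hv (σ u))
    exact Set.mem_iUnion.2 ⟨n, hn⟩
  have h1 : #(ResidueField T) ≤ #(⋃ n, {u | v (σ u) - d n ∈ P n}) := by
    rw [← mk_univ]; exact mk_le_mk_of_subset hcov
  have h2 : #(⋃ n, {u | v (σ u) - d n ∈ P n}) ≤ #Γ * ℵ₀ :=
    (mk_iUnion_le _).trans (mul_le_mul_right (ciSup_le' fun n => ((hfin n).countable.le_aleph0)) _)
  have h3 : #Γ * ℵ₀ < #(ResidueField T) := by
    exact mul_lt_of_lt hk.le hΓ hk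
  exact absurd (h1.trans h2) (not_le.2 h3)

/-- The least size of a subring not considered small. -/
noncomputable def smallBound (T : Type) [CommRing T] [IsLocalRing T] : Cardinal :=
  max (Order.succ ℵ₀) #(ResidueField T)

theorem exists_mem_forall_sub_notMem [IsAdicComplete (maximalIdeal T) T] {Γ : Type}
    (hΓ : #Γ < smallBound T) (P : Γ → Ideal T) (hP : ∀ n, (P n).IsPrime)
    (hPM : ∀ n, P n ≠ maximalIdeal T) (d : Γ → T) (I : Ideal T)
    (hI : ∀ n, ¬ I ≤ P n) : ∃ v ∈ I, ∀ n, v - d n ∉ P n := by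
  by_cases hc : #Γ ≤ ℵ₀
  · rcases isEmpty_or_nonempty Γ with h | h
    · exact ⟨0, zero_mem _, fun n => h.elim n⟩
    · have : Countable Γ := mk_le_aleph0_iff.1 hc
      obtain ⟨f, hf⟩ := exists_surjective_nat Γ
      obtain ⟨v, hv, h⟩ := exists_mem_forall_sub_notMem_of_nat (P ∘ f) (hP := fun n => hP _)
          (fun n => hPM _) (d ∘ f) I
        fun n => hI _
      refine ⟨v, hv, fun n => ?_⟩
      obtain ⟨k, rfl⟩ := hf n
      exact h k
  · rw [not_le] at hc
    have h1 : #Γ < #(ResidueField T) := by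
      rcases lt_max_iff.1 hΓ with h | h
      · exact absurd hc (not_lt.2 (Order.lt_succ_iff.1 h))
      · exact h
    exact exists_mem_forall_sub_notMem_of_lt h1 (hc.trans h1) P d I hI


end Avoidance

section AssPrimes

variable {T : Type} [CommRing T]

/-- The associated primes of `T / r T`. -/
def assPrimes (r : T) : Set (Ideal T) := {Q | Q.IsPrime ∧ ∃ w, ∀ a, a ∈ Q ↔ r ∣ a * w}

theorem mem_assPrimes {r : T} {Q : Ideal T} :
    Q ∈ assPrimes r ↔ Q.IsPrime ∧ ∃ w, ∀ a, a ∈ Q ↔ r ∣ a * w := Iff.rfl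

variable [IsNoetherianRing T]

theorem assPrimes_eq (r : T) : assPrimes r = associatedPrimes T (T ⧸ Ideal.span {r}) := by
  ext Q
  rw [AssociatedPrimes.mem_iff, isAssociatedPrime_iff, mem_assPrimes]
  refine and_congr_right fun _ => ⟨?_, ?_⟩
  · rintro ⟨w, hw⟩
    refine ⟨Ideal.Quotient.mk _ w, ?_⟩
    ext a
    rw [hw, Submodule.mem_colon_singleton, ← Ideal.mem_span_singleton, Submodule.mem_bot,
      ← Ideal.Quotient.eq_zero_iff_mem, Algebra.smul_def, map_mul]
    rfl
  · rintro ⟨w, hw⟩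
    obtain ⟨w, rfl⟩ := Ideal.Quotient.mk_surjective w
    refine ⟨w, fun a => ?_⟩
    rw [hw, Submodule.mem_colon_singleton, ← Ideal.mem_span_singleton, Submodule.mem_bot,
      ← Ideal.Quotient.eq_zero_iff_mem, Algebra.smul_def, map_mul]
    rfl

theorem finite_assPrimes (r : T) : (assPrimes r).Finite := by
  rw [assPrimes_eq]; exact associatedPrimes.finite T _

theorem dvd_of_dvd_mul_of_forall_notMem {r y t : T} (hy : ∀ Q ∈ assPrimes r, y ∉ Q)
    (h : r ∣ y * t) : r ∣ t := by
  by_contra hrt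
  have h1 : Ideal.Quotient.mk (Ideal.span {r}) t ≠ 0 := by
    rwa [Ne, Ideal.Quotient.eq_zero_iff_mem, Ideal.mem_span_singleton]
  obtain ⟨Q, hQ, hle⟩ := exists_le_isAssociatedPrime_of_isNoetherianRing T _ h1
  refine hy Q (by rw [assPrimes_eq]; exact hQ) (hle ?_)
  rw [Submodule.mem_colon_singleton, Submodule.mem_bot, Algebra.smul_def]
  change Ideal.Quotient.mk _ y * Ideal.Quotient.mk _ t = 0
  rw [← map_mul, Ideal.Quotient.eq_zero_iff_mem, Ideal.mem_span_singleton]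
  exact h

end AssPrimes

section Generic

variable {T : Type} [CommRing T] {R : Subring T}

/-- The associated primes of the quotients of `T` by zero or by a strong prime of `R`. -/
def badPrimes (R : Subring T) : Set (Ideal T) :=
  {Q | ∃ r, (r = 0 ∨ IsStrongPrime R r) ∧ Q ∈ assPrimes r}

/-- The element `x` is transcendental over `R` modulo `Q`. -/
def IsGenericAt (R : Subring T) (x : T) (Q : Ideal T) : Prop :=
  ∀ f : Polynomial R, evalHom R x f ∈ Q → ∀ i, (f.coeff i : T) ∈ Q

namespace IsNSubring

variable (hR : IsNSubring R)

theorem eq_zero_of_mem_assPrimes (hR : IsNSubring R) {Q : Ideal T} (hQ : Q ∈ assPrimes (0 : T))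
    {a : T} (ha : a ∈ R) (haQ : a ∈ Q) : a = 0 := by
  by_contra ha0
  obtain ⟨hQ, w, hw⟩ := hQ
  have h1 : w = 0 := hR.eq_zero_of_mul_eq_zero ha ha0 (zero_dvd_iff.1 ((hw a).1 haQ))
  exact hQ.ne_top ((Ideal.eq_top_iff_one Q).2 ((hw 1).2 (by rw [h1, mul_zero])))

theorem _root_.IsStrongPrime.dvd_of_mem_assPrimes {p : T} (hp : IsStrongPrime R p) {Q : Ideal T}
    (hQ : Q ∈ assPrimes p) {a : T} (ha : a ∈ R) (haQ : a ∈ Q) : p ∣ a := by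
  obtain ⟨hQ, w, hw⟩ := hQ
  refine (hp.dvd_or_dvd a ha w ((hw a).1 haQ)).resolve_right fun h => ?_
  exact hQ.ne_top ((Ideal.eq_top_iff_one Q).2 ((hw 1).2 (by rwa [one_mul])))

variable [IsNoetherianRing T]

theorem evalHom_mem_nonZeroDivisors (hR : IsNSubring R) {x : T}
    (hx : ∀ Q ∈ assPrimes (0 : T), IsGenericAt R x Q) (f : Polynomial R) (hf : f ≠ 0) :
    evalHom R x f ∈ nonZeroDivisors T := by
  rw [mem_nonZeroDivisors_iff_left]
  intro t ht
  refine zero_dvd_iff.1 (dvd_of_dvd_mul_of_forall_notMem (fun Q hQ hmem => hf ?_)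
      (zero_dvd_iff.2 ht))
  ext i
  exact hR.eq_zero_of_mem_assPrimes hQ (f.coeff i).2 (hx Q hQ f hmem i)

theorem dvd_of_dvd_evalHom_mul (hR : IsNSubring R) {x p : T} (hp : IsStrongPrime R p)
    (hx : ∀ Q ∈ assPrimes p, IsGenericAt R x Q) (f : Polynomial R)
    (hf : ¬ Polynomial.C ⟨p, hp.mem⟩ ∣ f) (t : T) (h : p ∣ evalHom R x f * t) : p ∣ t := by
  refine dvd_of_dvd_mul_of_forall_notMem (fun Q hQ hmem => hf ?_) h
  rw [Polynomial.C_dvd_iff_dvd_coeff]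
  intro i
  rw [hR.dvd_iff]
  exact hp.dvd_of_mem_assPrimes hQ (f.coeff i).2 (hx Q hQ f hmem i)

end IsNSubring

end Generic

section Exists

open Cardinal

theorem mk_fracClosure_le {T : Type} [CommRing T] (R : Subring T) :
    #(fracClosure R) ≤ max ℵ₀ #R := by
  choose f hf g hg hgr hfg using fun s : fracClosure R => mem_fracClosure.1 s.2
  have h1 : #(fracClosure R) ≤ #(R × R) := by
    refine mk_le_of_injective (f := fun s => (⟨f s, hf s⟩, ⟨g s, hg s⟩)) fun s s' h => ?_
    have h1 : f s = f s' := congrArg (fun z : R × R => (z.1 : T)) h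
    have h2 : g s = g s' := congrArg (fun z : R × R => (z.2 : T)) h
    refine Subtype.ext (sub_eq_zero.1 ((mem_nonZeroDivisors_iff_right.1 (hgr s)) _ ?_))
    rw [sub_mul, hfg, h1, ← hfg s', h2, sub_self]
  refine h1.trans ?_
  rw [mk_prod]
  simp only [lift_id]
  refine (mul_le_max _ _).trans ?_
  rw [max_self, max_comm]

theorem mk_adjoinFrac_le {T : Type} [CommRing T] (R : Subring T) (x : T) :
    #(adjoinFrac R x) ≤ max ℵ₀ #R := by
  refine (mk_fracClosure_le _).trans (max_le (le_max_left _ _) ?_)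
  have h1 : #(evalHom R x).range ≤ #(Polynomial R) :=
    mk_le_of_surjective (evalHom R x).rangeRestrict_surjective
  exact h1.trans (Polynomial.cardinalMk_le_max.trans (max_comm _ _).le)

variable {T : Type} [CommRing T] [IsNoetherianRing T] {R : Subring T}

theorem mk_badPrimes_le : #(badPrimes R) ≤ max ℵ₀ #R := by
  have h0 : badPrimes R ⊆ ⋃ r : R, assPrimes (r : T) := by
    rintro Q ⟨r, hr, hQ⟩
    have hrR : r ∈ R := by
      rcases hr with rfl | h
      · exact R.zero_mem
      · exact h.mem
    exact Set.mem_iUnion.2 ⟨⟨r, hrR⟩, hQ⟩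
  calc #(badPrimes R) ≤ #(⋃ r : R, assPrimes (r : T)) := mk_le_mk_of_subset h0
    _ ≤ #R * ℵ₀ := (mk_iUnion_le _).trans
      (mul_le_mul_right (ciSup_le' fun r : R => ((finite_assPrimes (r : T)).countable.le_aleph0)) _)
    _ ≤ max ℵ₀ #R := (mul_le_max _ _).trans (max_le (max_le (le_max_right _ _) (le_max_left _ _))
      (le_max_left _ _))

theorem exists_forall_isGenericAt [IsLocalRing T] [IsAdicComplete (maximalIdeal T) T]
    (hR : #R < smallBound T) (hM : maximalIdeal T ∉ badPrimes R) {ι : Type} [Finite ι] (u b : ι → T)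
    {I : Ideal T} (hI : ∀ Q ∈ badPrimes R, ¬ I ≤ Q) :
    ∃ t ∈ I, ∀ Q ∈ badPrimes R, ∀ i, b i ∉ Q → IsGenericAt R (u i + b i * t) Q := by
  have hprime : ∀ Q : badPrimes R, Q.1.IsPrime := fun ⟨Q, r, hr, hQ⟩ => hQ.1
  let g : (k : badPrimes R × ι × Polynomial R) → Polynomial (T ⧸ k.1.1) := fun k =>
    (k.2.2.map ((Ideal.Quotient.mk k.1.1).comp R.subtype)).comp
      (Polynomial.C (Ideal.Quotient.mk _ (b k.2.1)) * Polynomial.X +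
        Polynomial.C (Ideal.Quotient.mk _ (u k.2.1)))
  let Γ := Σ k : badPrimes R × ι × Polynomial R, {z : T ⧸ k.1.1 // g k ≠ 0 ∧ (g k).IsRoot z}
  let d : Γ → T := fun γ => Function.surjInv Ideal.Quotient.mk_surjective γ.2.1
  have hd : ∀ γ : Γ, Ideal.Quotient.mk γ.1.1.1 (d γ) = γ.2.1 := fun γ => Function.surjInv_eq _ _
  have hΓ : #Γ < smallBound T := by
    have h0 : ℵ₀ < smallBound T := lt_of_lt_of_le (Order.lt_succ _) (le_max_left _ _)
    refine lt_of_le_of_lt ?_ (max_lt h0 hR)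
    set c := max ℵ₀ #R with hc
    have hc0 : ℵ₀ ≤ c := le_max_left _ _
    have h1 : #(badPrimes R × ι × Polynomial R) ≤ c := by
      rw [mk_prod, mk_prod, lift_id, lift_id, lift_id, lift_id]
      refine (mul_le_mul' mk_badPrimes_le (mul_le_mul' ((mk_le_aleph0 (α := ι)).trans hc0)
        (Polynomial.cardinalMk_le_max.trans (max_comm _ _).le))).trans ?_
      rw [← hc, mul_eq_self hc0, mul_eq_self hc0]
    have h2 : ∀ k, #{z : T ⧸ k.1.1 // g k ≠ 0 ∧ (g k).IsRoot z} ≤ ℵ₀ := by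
      intro k
      have := hprime k.1
      by_cases hk : g k = 0
      · have : IsEmpty {z : T ⧸ k.1.1 // g k ≠ 0 ∧ (g k).IsRoot z} := ⟨fun z => z.2.1 hk⟩
        rw [mk_eq_zero]; exact zero_le
      · have h3 := (Polynomial.finite_setOfPred_isRoot hk).countable
        have h4 : {z | g k ≠ 0 ∧ (g k).IsRoot z}.Countable := h3.mono fun z hz => hz.2
        exact h4.le_aleph0
    rw [mk_sigma]
    refine (sum_le_mk_mul_iSup _).trans ?_
    refine (mul_le_mul' h1 ((ciSup_le' h2).trans hc0)).trans ?_
    rw [mul_eq_self hc0]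
  obtain ⟨t, htI, ht⟩ := exists_mem_forall_sub_notMem hΓ (fun γ => γ.1.1.1) (fun γ => hprime _)
    (fun γ h => hM (h ▸ γ.1.1.2)) d I fun γ => hI _ γ.1.1.2
  refine ⟨t, htI, fun Q hQ i hb f hf j => ?_⟩
  by_contra hj
  have := hprime ⟨Q, hQ⟩
  have hg : g (⟨Q, hQ⟩, i, f) ≠ 0 := by
    intro h0
    rcases Polynomial.comp_eq_zero_iff.1 h0 with h1 | ⟨-, h1⟩
    · have h2 := congrArg (fun p => p.coeff j) h1
      simp only [Polynomial.coeff_map, Polynomial.coeff_zero] at h2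
      exact hj (Ideal.Quotient.eq_zero_iff_mem.1 h2)
    · have h2 := congrArg (fun p => p.coeff 1) h1
      simp only [Polynomial.coeff_add, Polynomial.coeff_C_mul, Polynomial.coeff_X_one, mul_one,
        Polynomial.coeff_C_succ, add_zero] at h2
      exact hb (Ideal.Quotient.eq_zero_iff_mem.1 h2)
  have hroot : (g (⟨Q, hQ⟩, i, f)).IsRoot (Ideal.Quotient.mk Q t) := by
    have h0 := Ideal.Quotient.eq_zero_iff_mem.2 hf
    rw [evalHom, Polynomial.coe_eval₂RingHom, Polynomial.hom_eval₂] at h0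
    change Polynomial.eval _ _ = 0
    simp only [g, Polynomial.eval_comp, Polynomial.eval_add, Polynomial.eval_mul, Polynomial.eval_C,
      Polynomial.eval_X, Polynomial.eval_map]
    rw [← h0, map_add, map_mul, add_comm]
  refine ht ⟨(⟨Q, hQ⟩, i, f), ⟨_, hg, hroot⟩⟩ ?_
  rw [← Ideal.Quotient.eq, hd]

end Exists

section Extension

open Cardinal

variable {T : Type} [CommRing T]

/-- Every prime of `R` that is strong remains strong in the larger N-subring `S`. -/
structure IsNExt (R S : Subring T) : Prop where
  le : R ≤ S
  isNSubring : IsNSubring S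
  isStrongPrime : ∀ p, IsStrongPrime R p → IsStrongPrime S p

theorem IsNSubring.isNExt_refl {R : Subring T} (hR : IsNSubring R) : IsNExt R R :=
  ⟨le_rfl, hR, fun _ h => h⟩

theorem IsNExt.trans {R S S' : Subring T} (h : IsNExt R S) (h' : IsNExt S S') : IsNExt R S' :=
  ⟨h.le.trans h'.le, h'.isNSubring, fun p hp => h'.isStrongPrime p (h.isStrongPrime p hp)⟩

/-- An ideal contained in no associated prime of `T / r T`, for `r` zero or regular. -/
def IsGoodIdeal (I : Ideal T) : Prop :=
  ∀ r, r = 0 ∨ r ∈ nonZeroDivisors T → ∀ Q ∈ assPrimes r, ¬ I ≤ Q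

theorem IsGoodIdeal.mul {I J : Ideal T} (hI : IsGoodIdeal I) (hJ : IsGoodIdeal J) :
    IsGoodIdeal (I * J) := fun r hr Q hQ h =>
  ((hQ.1.mul_le).1 h).elim (hI r hr Q hQ) (hJ r hr Q hQ)

theorem IsGoodIdeal.not_le_of_mem_badPrimes {I Q : Ideal T} (hI : IsGoodIdeal I) {R : Subring T}
    (hR : IsNSubring R) (hQ : Q ∈ badPrimes R) : ¬ I ≤ Q := by
  obtain ⟨r, hr, hQ⟩ := hQ
  exact hI r (hr.imp_right fun h => hR.regular r h.mem h.ne_zero) Q hQ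

theorem span_singleton_mul_lt {p w : T} (hp : ¬ IsUnit p) (hw : w ∈ nonZeroDivisors T) :
    Ideal.span {p * w} < Ideal.span {w} := by
  rw [SetLike.lt_iff_le_and_exists]
  refine ⟨Ideal.span_singleton_le_span_singleton.2 ⟨p, mul_comm _ _⟩, w,
    Ideal.mem_span_singleton_self w, fun hmem => ?_⟩
  obtain ⟨c, hc⟩ := Ideal.mem_span_singleton.1 hmem
  have h0 : w * (p * c - 1) = 0 := by linear_combination -hc
  have := (mem_nonZeroDivisors_iff_left.1 hw) _ h0
  exact hp (.of_mul_eq_one c (sub_eq_zero.1 this))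

section Gcd

variable [IsNoetherianRing T] {R : Subring T} (hR : IsNSubring R)

include hR

theorem IsNSubring.exists_map_eq {l : List T} (hl : ∀ a ∈ l, a ∈ R) (hl0 : ∃ a ∈ l, a ≠ 0) :
    ∃ d ∈ R, d ≠ 0 ∧ ∃ l' : List T, (∀ a ∈ l', a ∈ R) ∧ l = l'.map (d * ·) ∧
      ∀ p, IsStrongPrime R p → ∃ a ∈ l', ¬ p ∣ a := by
  obtain ⟨w, hw, hw0⟩ := hl0
  induction hI : Ideal.span {w} using WellFoundedGT.induction generalizing w l with
  | ind I ih =>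
    by_cases h : ∃ p, IsStrongPrime R p ∧ ∀ a ∈ l, p ∣ a
    · obtain ⟨p, hp, hpl⟩ := h
      have hpr := hR.regular p hp.mem hp.ne_zero
      choose f hf using hpl
      have hmap : l = (l.attach.map fun a => f a.1 a.2).map (p * ·) := by
        rw [List.map_map]
        conv_lhs => rw [← List.attach_map_subtype_val l]
        refine List.map_congr_left fun a _ => hf a.1 a.2
      have hmem : ∀ a ∈ l.attach.map (fun a => f a.1 a.2), a ∈ R := by
        intro a ha
        obtain ⟨b, -, rfl⟩ := List.mem_map.1 ha
        refine hR.closed p hp.mem hp.ne_zero _ ?_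
        rw [mul_comm, ← hf b.1 b.2]
        exact hl b.1 b.2
      have hw'0 : f w hw ≠ 0 := fun h => hw0 (by rw [hf w hw, h, mul_zero])
      have hw' : f w hw ∈ l.attach.map (fun a => f a.1 a.2) :=
        List.mem_map.2 ⟨⟨w, hw⟩, List.mem_attach _ _, rfl⟩
      have hlt : I < Ideal.span {f w hw} := by
        rw [← hI]
        conv_lhs => rw [hf w hw]
        exact span_singleton_mul_lt hp.not_isUnit (hR.regular _ (hmem _ hw') hw'0)
      obtain ⟨d, hd, hd0, l', hl', hll', hdvd⟩ := ih _ hlt hmem _ hw' hw'0 rfl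
      refine ⟨p * d, R.mul_mem hp.mem hd, fun h => hd0 ((mem_nonZeroDivisors_iff_left.1 hpr) d h),
        l', hl', ?_, hdvd⟩
      rw [hmap, hll', List.map_map]
      exact List.map_congr_left fun a _ => (mul_assoc _ _ _).symm
    · push Not at h
      exact ⟨1, R.one_mem, fun h1 => hw0 (by rw [← one_mul w, h1, zero_mul]), l, hl, by simp, h⟩

end Gcd

variable [IsLocalRing T] [IsNoetherianRing T] [IsAdicComplete (maximalIdeal T) T]
  (hM : IsGoodIdeal (maximalIdeal T))

include hM

omit [IsNoetherianRing T] [IsAdicComplete (maximalIdeal T) T] in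
theorem maximalIdeal_notMem_badPrimes {R : Subring T} (hR : IsNSubring R) :
    maximalIdeal T ∉ badPrimes R := fun h => hM.not_le_of_mem_badPrimes hR h le_rfl

theorem IsNSubring.exists_isNExt_sub_mem {R : Subring T} (hR : IsNSubring R)
    (hc : #R < smallBound T) {I : Ideal T} (hI : ∀ Q ∈ badPrimes R, ¬ I ≤ Q) (u : T) :
    ∃ S, IsNExt R S ∧ #S ≤ max ℵ₀ #R ∧ ∃ x ∈ S, x - u ∈ I := by
  obtain ⟨t, ht, h⟩ := exists_forall_isGenericAt hc (maximalIdeal_notMem_badPrimes hM hR)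
    (fun _ : Unit => u) (fun _ => 1) hI
  have hprime : ∀ Q ∈ badPrimes R, (1 : T) ∉ Q := fun Q ⟨r, _, hQ⟩ h =>
    hQ.1.ne_top ((Ideal.eq_top_iff_one Q).2 h)
  have hgen : ∀ Q ∈ badPrimes R, IsGenericAt R (u + 1 * t) Q := fun Q hQ => h Q hQ () (hprime Q hQ)
  have h0 := hR.evalHom_mem_nonZeroDivisors fun Q hQ => hgen Q ⟨0, Or.inl rfl, hQ⟩
  have hst : ∀ p, IsStrongPrime R p → IsStrongPrime (adjoinFrac R (u + 1 * t)) p := fun p hp =>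
    hR.isStrongPrime_adjoinFrac h0 hp
      (hR.dvd_of_dvd_evalHom_mul hp fun Q hQ => hgen Q ⟨p, Or.inr hp, hQ⟩)
  exact ⟨_, ⟨le_adjoinFrac _, hR.isNSubring_adjoinFrac h0 hst, hst⟩, mk_adjoinFrac_le _ _, _,
    mem_adjoinFrac _, by simpa using ht⟩

theorem IsNSubring.exists_isNExt_add_eq {R : Subring T} (hR : IsNSubring R)
    (hc : #R < smallBound T) {I : Ideal T} (hI : ∀ Q ∈ badPrimes R, ¬ I ≤ Q) {a b c : T}
    (ha : a ∈ R) (hb : b ∈ R) (hcR : c ∈ R) (ha0 : a ≠ 0) (hb0 : b ≠ 0)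
    (hab : ∀ p, IsStrongPrime R p → p ∣ a → ¬ p ∣ b) {t₁ t₂ : T} (ht : c = a * t₁ + b * t₂)
    (ht₂ : t₂ ∈ I) : ∃ S, IsNExt R S ∧ #S ≤ max ℵ₀ #R ∧ ∃ x ∈ S, ∃ y ∈ S, c = a * x + b * y ∧
      y ∈ I := by
  obtain ⟨t, htI, h⟩ := exists_forall_isGenericAt hc (maximalIdeal_notMem_badPrimes hM hR)
    (fun i : Bool => if i then t₁ else t₂) (fun i => if i then b else -a) hI
  have h1 : ∀ Q ∈ badPrimes R, b ∉ Q → IsGenericAt R (t₁ + b * t) Q := fun Q hQ => h Q hQ true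
  have h2 : ∀ Q ∈ badPrimes R, a ∉ Q → IsGenericAt R (t₂ + -a * t) Q := fun Q hQ ha =>
    h Q hQ false (by simpa using ha)
  set x := t₁ + b * t with hx
  set y := t₂ + -a * t with hy
  have hxy : c = a * x + b * y := by rw [hx, hy, ht]; ring
  have hx0 := hR.evalHom_mem_nonZeroDivisors (x := x) fun Q hQ =>
      h1 Q ⟨0, Or.inl rfl, hQ⟩ fun hbQ =>
    hb0 (hR.eq_zero_of_mem_assPrimes hQ hb hbQ)
  have hy0 := hR.evalHom_mem_nonZeroDivisors (x := y) fun Q hQ =>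
      h2 Q ⟨0, Or.inl rfl, hQ⟩ fun haQ =>
    ha0 (hR.eq_zero_of_mem_assPrimes hQ ha haQ)
  have hyx : y ∈ adjoinFrac R x := by
    refine fracClosure_range_closed hx0 b (le_adjoinFrac x hb) hb0 y ?_
    rw [show y * b = c - a * x by rw [hxy]; ring]
    exact sub_mem (le_adjoinFrac x hcR) (mul_mem (le_adjoinFrac x ha) (mem_adjoinFrac x))
  have hxy' : x ∈ adjoinFrac R y := by
    refine fracClosure_range_closed hy0 a (le_adjoinFrac y ha) ha0 x ?_
    rw [show x * a = c - b * y by rw [hxy]; ring]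
    exact sub_mem (le_adjoinFrac y hcR) (mul_mem (le_adjoinFrac y hb) (mem_adjoinFrac y))
  have heq : adjoinFrac R x = adjoinFrac R y := le_antisymm (adjoinFrac_le hxy') (adjoinFrac_le hyx)
  have hst : ∀ p, IsStrongPrime R p → IsStrongPrime (adjoinFrac R x) p := by
    intro p hp
    by_cases hpb : p ∣ b
    · rw [heq]
      refine hR.isStrongPrime_adjoinFrac hy0 hp
        (hR.dvd_of_dvd_evalHom_mul hp fun Q hQ => h2 Q ⟨p, Or.inr hp, hQ⟩ fun haQ => ?_)
      exact hab p hp (hp.dvd_of_mem_assPrimes hQ ha haQ) hpb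
    · exact hR.isStrongPrime_adjoinFrac hx0 hp
        (hR.dvd_of_dvd_evalHom_mul hp fun Q hQ => h1 Q ⟨p, Or.inr hp, hQ⟩ fun hbQ =>
          hpb (hp.dvd_of_mem_assPrimes hQ hb hbQ))
  exact ⟨_, ⟨le_adjoinFrac _, hR.isNSubring_adjoinFrac hx0 hst, hst⟩, mk_adjoinFrac_le _ _, x,
    mem_adjoinFrac _, y, hyx, hxy, I.add_mem ht₂ (I.mul_mem_left _ htI)⟩

end Extension

section Comb

variable {T : Type} [CommRing T]

/-- The element `c` is a linear combination of the entries of `l` with coefficients in `S`. -/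
def IsComb (S : Subring T) : List T → T → Prop
  | [], c => c = 0
  | a :: l, c => ∃ x ∈ S, IsComb S l (c - a * x)

theorem IsComb.mono {S S' : Subring T} (h : S ≤ S') {l : List T} {c : T} (hc : IsComb S l c) :
    IsComb S' l c := by
  induction l generalizing c with
  | nil => exact hc
  | cons a l ih =>
    obtain ⟨x, hx, hl⟩ := hc
    exact ⟨x, h hx, ih hl⟩

theorem IsComb.map_mul {S : Subring T} {l : List T} {c : T} (d : T) (hc : IsComb S l c) :
    IsComb S (l.map (d * ·)) (d * c) := by
  induction l generalizing c with
  | nil => rw [show c = 0 from hc, mul_zero]; rfl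
  | cons a l ih =>
    obtain ⟨x, hx, hl⟩ := hc
    refine ⟨x, hx, ?_⟩
    convert ih hl using 1
    ring

theorem isComb_top_iff {l : List T} {c : T} : IsComb ⊤ l c ↔ c ∈ Ideal.ofList l := by
  induction l generalizing c with
  | nil => rw [Ideal.ofList_nil, Submodule.mem_bot]; rfl
  | cons a l ih =>
    rw [Ideal.ofList_cons, Submodule.mem_sup]
    constructor
    · rintro ⟨x, -, hx⟩
      exact ⟨a * x, Ideal.mem_span_singleton.2 ⟨x, rfl⟩, _, ih.1 hx, add_sub_cancel _ _⟩
    · rintro ⟨y, hy, z, hz, rfl⟩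
      obtain ⟨x, rfl⟩ := Ideal.mem_span_singleton.1 hy
      exact ⟨x, trivial, ih.2 (by rwa [add_sub_cancel_left])⟩

theorem exists_eq_mul_of_mem_ofList_map {l : List T} {d e : T}
    (he : e ∈ Ideal.ofList (l.map (d * ·))) : ∃ e' ∈ Ideal.ofList l, e = d * e' := by
  induction l generalizing e with
  | nil =>
    rw [List.map_nil, Ideal.ofList_nil, Submodule.mem_bot] at he
    exact ⟨0, zero_mem _, by rw [he, mul_zero]⟩
  | cons a l ih =>
    rw [List.map_cons, Ideal.ofList_cons, Submodule.mem_sup] at he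
    obtain ⟨y, hy, z, hz, rfl⟩ := he
    obtain ⟨x, rfl⟩ := Ideal.mem_span_singleton.1 hy
    obtain ⟨e', he', rfl⟩ := ih hz
    refine ⟨a * x + e', ?_, by ring⟩
    rw [Ideal.ofList_cons]
    exact Submodule.add_mem_sup (Ideal.mem_span_singleton.2 ⟨x, rfl⟩) he'

theorem isComb_zero (S : Subring T) (l : List T) : IsComb S l 0 := by
  induction l with
  | nil => rfl
  | cons a l ih => exact ⟨0, S.zero_mem, by rwa [mul_zero, sub_zero]⟩

end Comb

section Closing

open Cardinal

variable {T : Type} [CommRing T] [IsLocalRing T] [IsNoetherianRing T]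
  [IsAdicComplete (maximalIdeal T) T] (hM : IsGoodIdeal (maximalIdeal T))

include hM

theorem IsNSubring.exists_isNExt_span_eq {R : Subring T} (hR : IsNSubring R)
    (hc : #R < smallBound T) {I : Ideal T} (hI : IsGoodIdeal I) :
    ∃ S, IsNExt R S ∧ #S ≤ max ℵ₀ #R ∧ Ideal.span ((S : Set T) ∩ I) = I := by
  have hMI := hM.mul hI
  have key : ∀ l : List T, ∃ S, IsNExt R S ∧ #S ≤ max ℵ₀ #R ∧
      ∀ y ∈ l, ∃ x ∈ S, x - y ∈ maximalIdeal T * I := by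
    intro l
    induction l with
    | nil => exact ⟨R, hR.isNExt_refl, le_max_right _ _, by simp⟩
    | cons y l ih =>
      obtain ⟨S, hS, hSc, hSl⟩ := ih
      have hSc' : #S < smallBound T := lt_of_le_of_lt hSc
        (max_lt (lt_of_lt_of_le (Order.lt_succ _) (le_max_left _ _)) hc)
      obtain ⟨S', hS', hSc'', x, hx, hxy⟩ := hS.isNSubring.exists_isNExt_sub_mem hM hSc'
        (fun Q hQ => hMI.not_le_of_mem_badPrimes hS.isNSubring hQ) y
      refine ⟨S', hS.trans hS', hSc''.trans (max_le (le_max_left _ _) hSc), fun z hz => ?_⟩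
      rcases List.mem_cons.1 hz with rfl | hz
      · exact ⟨x, hx, hxy⟩
      · obtain ⟨w, hw, h⟩ := hSl z hz
        exact ⟨w, hS'.le hw, h⟩
  obtain ⟨s, hs⟩ := (IsNoetherian.noetherian I : I.FG)
  obtain ⟨S, hS, hSc, h⟩ := key s.toList
  refine ⟨S, hS, hSc, le_antisymm (Ideal.span_le.2 Set.inter_subset_right) ?_⟩
  refine Submodule.le_of_le_smul_of_le_jacobson_bot (I := maximalIdeal T)
    (IsNoetherian.noetherian I) (maximalIdeal_le_jacobson _) ?_
  rw [smul_eq_mul]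
  conv_lhs => rw [← hs]
  refine Submodule.span_le.2 fun y hy => ?_
  obtain ⟨x, hx, hxy⟩ := h y (Finset.mem_toList.2 hy)
  have hyI : y ∈ I := hs ▸ Submodule.subset_span hy
  have hle : maximalIdeal T * I ≤ I := Ideal.mul_le_right
  have hxI : x ∈ I := by
    have := I.add_mem (hle hxy) hyI
    rwa [sub_add_cancel] at this
  have := Submodule.add_mem_sup (Ideal.subset_span ⟨hx, hxI⟩ : x ∈ Ideal.span ((S : Set T) ∩ I))
    (neg_mem hxy)
  rwa [neg_sub, add_sub_cancel] at this

theorem IsNSubring.exists_isNExt_isComb (n : ℕ) {R : Subring T} (hR : IsNSubring R)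
    (hc : #R < smallBound T) {l : List T} (hn : l.length = n) (hl : ∀ a ∈ l, a ∈ R) {c : T}
    (hcR : c ∈ R) (h : c ∈ Ideal.ofList l) :
    ∃ S, IsNExt R S ∧ #S ≤ max ℵ₀ #R ∧ IsComb S l c := by
  induction n generalizing R l c with
  | zero =>
    obtain rfl := List.length_eq_zero_iff.1 hn
    exact ⟨R, hR.isNExt_refl, le_max_right _ _, isComb_top_iff.2 h⟩
  | succ n ih =>
    obtain ⟨a, l, rfl⟩ := List.exists_cons_of_length_eq_add_one hn
    rw [List.length_cons, Nat.add_right_cancel_iff] at hn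
    have haR : a ∈ R := hl a (by simp)
    have hlR : ∀ b ∈ l, b ∈ R := fun b hb => hl b (by simp [hb])
    by_cases ha0 : a = 0
    · rw [Ideal.ofList_cons, ha0, Ideal.span_singleton_zero, bot_sup_eq] at h
      obtain ⟨S, hS, hSc, hcomb⟩ := ih hR hc hn hlR hcR h
      exact ⟨S, hS, hSc, 0, S.zero_mem, by rwa [mul_zero, sub_zero]⟩
    obtain ⟨x, -, hx⟩ := isComb_top_iff.2 h
    rw [isComb_top_iff] at hx
    by_cases hl0 : ∃ b ∈ l, b ≠ 0
    · obtain ⟨d, hd, hd0, l', hl', rfl, hdvd⟩ := hR.exists_map_eq hlR hl0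
      obtain ⟨e, he, hce⟩ := exists_eq_mul_of_mem_ofList_map hx
      obtain ⟨g, hg, hg0, m, hm, had, hgdvd⟩ := hR.exists_map_eq (l := [a, d])
        (by simp [haR, hd]) ⟨a, by simp, ha0⟩
      have hmlen : m.length = 2 := by simpa using (congrArg List.length had).symm
      obtain ⟨a', d', rfl⟩ := List.length_eq_two.1 hmlen
      simp only [List.map_cons, List.map_nil, List.cons.injEq, and_true] at had
      obtain ⟨rfl, rfl⟩ := had
      have ha'0 : a' ≠ 0 := fun h => ha0 (by rw [h, mul_zero])
      have hd'0 : d' ≠ 0 := fun h => hd0 (by rw [h, mul_zero])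
      have hcg : c = g * (a' * x + d' * e) := by linear_combination hce
      have hc' : a' * x + d' * e ∈ R := hR.closed g hg hg0 _ (by rwa [mul_comm, ← hcg])
      have hI : ∀ Q ∈ badPrimes R, ¬ Ideal.ofList l' ≤ Q := by
        rintro Q ⟨r, hr, hQ⟩ hle
        have hle' : ∀ b ∈ l', b ∈ Q := fun b hb => hle (Ideal.subset_span hb)
        rcases hr with rfl | hp
        · obtain ⟨b, hb, hb0⟩ := hl0
          obtain ⟨b', hb', rfl⟩ := List.mem_map.1 hb
          exact hb0 (by rw [hR.eq_zero_of_mem_assPrimes hQ (hl' b' hb') (hle' b' hb'), mul_zero])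
        · obtain ⟨b, hb, hpb⟩ := hdvd r hp
          exact hpb (hp.dvd_of_mem_assPrimes hQ (hl' b hb) (hle' b hb))
      obtain ⟨S, hS, hSc, x', hx', y, hy, hxy, hyI⟩ := hR.exists_isNExt_add_eq hM hc hI
        (hm a' (by simp)) (hm d' (by simp)) hc' ha'0 hd'0 (fun p hp hpa hpd => by
          obtain ⟨b, hb, hpb⟩ := hgdvd p hp
          simp only [List.mem_cons, List.not_mem_nil, or_false] at hb
          rcases hb with rfl | rfl
          · exact hpb hpa
          · exact hpb hpd) rfl he
      have hSc' : #S < smallBound T := lt_of_le_of_lt hSc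
        (max_lt (lt_of_lt_of_le (Order.lt_succ _) (le_max_left _ _)) hc)
      obtain ⟨S', hS', hSc'', hcomb⟩ := ih hS.isNSubring hSc' (by simpa using hn)
        (fun b hb => hS.le (hl' b hb)) hy hyI
      refine ⟨S', hS.trans hS', hSc''.trans (max_le (le_max_left _ _) hSc), x', hS'.le hx', ?_⟩
      convert hcomb.map_mul (g * d') using 1
      rw [hcg, hxy]
      ring
    · push Not at hl0
      have h0 : c - a * x = 0 := by
        have : Ideal.ofList l = ⊥ := (Ideal.span_eq_bot).2 hl0
        rwa [this, Submodule.mem_bot] at hx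
      have hxR : x ∈ R := hR.closed a haR ha0 x (by rwa [mul_comm, ← sub_eq_zero.1 h0])
      exact ⟨R, hR.isNExt_refl, le_max_right _ _, x, hxR, h0 ▸ isComb_zero R l⟩

end Closing

section Chain

open Cardinal Set

variable {T : Type} [CommRing T]

section Union

variable {ι : Type} [LinearOrder ι] [Nonempty ι] {F : ι → Subring T}
  (hF : ∀ i j, i ≤ j → IsNExt (F i) (F j))

include hF

theorem mem_iSup_iff_of_isNExt {x : T} : x ∈ ⨆ i, F i ↔ ∃ i, x ∈ F i :=
  Subring.mem_iSup_of_directed (Monotone.directed_le fun i j h => (hF i j h).le)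

theorem isNExt_iSup (i : ι) : IsNExt (F i) (⨆ i, F i) := by
  have hstrong : ∀ i p, IsStrongPrime (F i) p → IsStrongPrime (⨆ i, F i) p := by
    intro i p hp
    refine ⟨le_iSup F i hp.mem, hp.not_isUnit, hp.ne_zero, fun r hr => ?_⟩
    obtain ⟨j, hj⟩ := (mem_iSup_iff_of_isNExt hF).1 hr
    exact ((hF i _ (le_max_left i j)).isStrongPrime p hp).dvd_or_dvd r
      ((hF j _ (le_max_right i j)).le hj)
  have hN : ∀ i, IsNSubring (F i) := fun i => (hF i i le_rfl).isNSubring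
  refine ⟨le_iSup F i, ⟨fun r hr => ?_, fun g hg hg0 s hs => ?_, fun r hr hr0 => ?_⟩, hstrong i⟩
  · obtain ⟨j, hj⟩ := (mem_iSup_iff_of_isNExt hF).1 hr
    exact (hN j).regular r hj
  · obtain ⟨j, hj⟩ := (mem_iSup_iff_of_isNExt hF).1 hg
    obtain ⟨k, hk⟩ := (mem_iSup_iff_of_isNExt hF).1 hs
    exact le_iSup F (max j k) ((hN _).closed g ((hF j _ (le_max_left j k)).le hj) hg0 s
      ((hF k _ (le_max_right j k)).le hk))
  · obtain ⟨j, hj⟩ := (mem_iSup_iff_of_isNExt hF).1 hr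
    refine Submonoid.closure_mono ?_ ((hN j).factor r hj hr0)
    rintro x ⟨hx, h⟩
    exact ⟨le_iSup F j hx, h.imp_right (hstrong j x)⟩

theorem mk_iSup_le_of_isNExt {c : Cardinal} (hc : ℵ₀ ≤ c) (hι : #ι ≤ c) (h : ∀ i, #(F i) ≤ c) :
    #(⨆ i, F i : Subring T) ≤ c := by
  have h1 : #(⨆ i, F i : Subring T) ≤ #(⋃ i, (F i : Set T)) :=
    mk_le_mk_of_subset fun x hx => mem_iUnion.2 ((mem_iSup_iff_of_isNExt hF).1 hx)
  refine h1.trans ((mk_iUnion_le _).trans ((mul_le_mul' hι (ciSup_le' h)).trans ?_))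
  rw [mul_eq_self hc]

end Union

section Bot

variable {ι : Type} [LinearOrder ι] {R : Subring T} (hR : IsNSubring R) {F : ι → Subring T}
  (hRF : ∀ i, IsNExt R (F i)) (hF : ∀ i j, i < j → IsNExt (F i) (F j))

/-- The union of `R` and of the rings `F i`. -/
def chainUnion (R : Subring T) (F : ι → Subring T) : Subring T :=
  ⨆ i : WithBot ι, WithBot.recBotCoe R F i

include hR hRF hF

theorem isNExt_recBotCoe (i j : WithBot ι) (h : i ≤ j) :
    IsNExt (WithBot.recBotCoe R F i : Subring T) (WithBot.recBotCoe R F j) := by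
  induction i using WithBot.recBotCoe with
  | bot =>
    induction j using WithBot.recBotCoe with
    | bot => exact hR.isNExt_refl
    | coe j => exact hRF j
  | coe i =>
    induction j using WithBot.recBotCoe with
    | bot => exact absurd h (by simp)
    | coe j =>
      rcases (WithBot.coe_le_coe.1 h).eq_or_lt with rfl | h
      · exact (hRF i).isNSubring.isNExt_refl
      · exact hF i j h

theorem isNExt_chainUnion : IsNExt R (chainUnion R F) :=
  isNExt_iSup (isNExt_recBotCoe hR hRF hF) ⊥

theorem isNExt_chainUnion_coe (i : ι) : IsNExt (F i) (chainUnion R F) :=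
  isNExt_iSup (isNExt_recBotCoe hR hRF hF) i

theorem mem_chainUnion {x : T} : x ∈ chainUnion R F ↔ x ∈ R ∨ ∃ i, x ∈ F i := by
  rw [chainUnion, mem_iSup_iff_of_isNExt (isNExt_recBotCoe hR hRF hF)]
  constructor
  · rintro ⟨i, hi⟩
    induction i using WithBot.recBotCoe with
    | bot => exact Or.inl hi
    | coe i => exact Or.inr ⟨i, hi⟩
  · rintro (h | ⟨i, hi⟩)
    · exact ⟨⊥, h⟩
    · exact ⟨i, hi⟩

theorem mk_chainUnion_le {c : Cardinal} (hc : ℵ₀ ≤ c) (hι : #ι ≤ c) (hRc : #R ≤ c)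
    (h : ∀ i, #(F i) ≤ c) : #(chainUnion R F) ≤ c := by
  refine mk_iSup_le_of_isNExt (isNExt_recBotCoe hR hRF hF) hc ?_ fun i => ?_
  · change #(Option ι) ≤ c
    rw [mk_option]
    exact (add_le_max _ _).trans (max_le (max_le hι (one_le_aleph0.trans hc)) hc)
  · induction i using WithBot.recBotCoe with
    | bot => exact hRc
    | coe i => exact h i

end Bot

variable [IsLocalRing T]

theorem exists_isNExt_chain {ι : Type} [LinearOrder ι] [WellFoundedLT ι]
    (hι : ∀ i : ι, #(Iio i) < smallBound T) (P : ι → Subring T → Subring T → Prop)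
    (step : ∀ i R, IsNSubring R → #R < smallBound T →
      ∃ S, IsNExt R S ∧ #S ≤ max ℵ₀ #R ∧ P i R S)
    {R : Subring T} (hR : IsNSubring R) (hRc : #R < smallBound T) :
    ∃ F : ι → Subring T, (∀ i, IsNExt R (F i)) ∧ (∀ i j, i < j → IsNExt (F i) (F j)) ∧
      (∀ i, #(F i) ≤ max ℵ₀ (max #R #(Iio i))) ∧
      ∀ i, ∃ X, R ≤ X ∧ (∀ j < i, F j ≤ X) ∧ P i X (F i) := by
  classical
  choose! s hs1 hs2 hs3 using step
  let F : ι → Subring T := WellFounded.fix (wellFounded_lt (α := ι)) fun i f =>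
    s i (chainUnion R fun j : Iio i => f j.1 j.2)
  have hFeq : ∀ i, F i = s i (chainUnion R fun j : Iio i => F j.1) := fun i =>
    WellFounded.fix_eq _ _ _
  have hℵ : ℵ₀ < smallBound T := lt_of_lt_of_le (Order.lt_succ _) (le_max_left _ _)
  have key : ∀ i, (∀ j < i, IsNExt (F j) (F i)) ∧ IsNExt R (F i) ∧
      #(F i) ≤ max ℵ₀ (max #R #(Iio i)) ∧
      ∃ X, R ≤ X ∧ (∀ j < i, F j ≤ X) ∧ P i X (F i) := by
    intro i
    induction i using WellFoundedLT.induction with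
    | ind i ih =>
      have h1 : ∀ j : Iio i, IsNExt R (F j.1) := fun j => (ih j.1 j.2).2.1
      have h2 : ∀ j k : Iio i, j < k → IsNExt (F j.1) (F k.1) := fun j k hjk =>
        (ih k.1 k.2).1 j.1 hjk
      have hX := isNExt_chainUnion hR h1 h2
      set X := chainUnion R fun j : Iio i => F j.1 with hXdef
      set c := max ℵ₀ (max #R #(Iio i)) with hc
      have hXc : #X ≤ c := by
        refine mk_chainUnion_le hR h1 h2 (le_max_left _ _)
            ((le_max_right _ _).trans (le_max_right _ _))
          ((le_max_left _ _).trans (le_max_right _ _)) fun j => (ih j.1 j.2).2.2.1.trans ?_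
        exact max_le_max le_rfl (max_le_max le_rfl
          (mk_le_mk_of_subset (Iio_subset_Iio (le_of_lt j.2))))
      have hXs : #X < smallBound T := lt_of_le_of_lt hXc (max_lt hℵ (max_lt hRc (hι i)))
      have hFX : IsNExt X (F i) := hFeq i ▸ hs1 i X hX.isNSubring hXs
      refine ⟨fun j hj => (isNExt_chainUnion_coe hR h1 h2 ⟨j, hj⟩).trans hFX, hX.trans hFX, ?_, X,
          hX.le,
        fun j hj => (isNExt_chainUnion_coe hR h1 h2 ⟨j, hj⟩).le, ?_⟩
      · rw [hFeq i]
        exact (hs2 i X hX.isNSubring hXs).trans (max_le (le_max_left _ _) hXc)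
      · rw [hFeq i]
        exact hs3 i X hX.isNSubring hXs
  exact ⟨F, fun i => (key i).2.1, fun i j h => (key j).1 i h, fun i => (key i).2.2.1,
    fun i => (key i).2.2.2⟩

end Chain

section BaseRing

open Cardinal

variable {T : Type} [CommRing T] [Nontrivial T]

theorem exists_isNSubring_of_natPrime {p : ℕ} [CharP T p] (hp : p.Prime) :
    ∃ R : Subring T, IsNSubring R ∧ #R ≤ ℵ₀ := by
  have : Fact p.Prime := ⟨hp⟩
  have hφ : ∀ b : ZMod p, b ≠ 0 → ZMod.castHom (dvd_refl p) T b ∈ nonZeroDivisors T := fun b hb =>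
    ((isUnit_iff_ne_zero.2 hb).map _).mem_nonZeroDivisors
  refine ⟨_, isNSubring_fracClosure_range hφ fun q hq => absurd ?_ hq.not_isUnit,
    (mk_fracClosure_le _).trans (max_le le_rfl ?_)⟩
  · exact isUnit_iff_ne_zero.2 hq.ne_zero
  · exact mk_le_aleph0_iff.2 (Set.countable_range _).to_subtype

theorem exists_isNSubring_of_charZero (h0 : ∀ z : ℤ, z ≠ 0 → (z : T) ∈ nonZeroDivisors T) :
    ∃ R : Subring T, IsNSubring R ∧ #R ≤ ℵ₀ := by
  have hφ : ∀ b : ℤ, b ≠ 0 → Int.castRingHom T b ∈ nonZeroDivisors T := h0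
  refine ⟨_, isNSubring_fracClosure_range hφ fun p hp => Submonoid.subset_closure
    ⟨le_fracClosure _ ⟨p, rfl⟩, ?_⟩, (mk_fracClosure_le _).trans (max_le le_rfl ?_)⟩
  · by_cases hu : IsUnit (Int.castRingHom T p)
    · exact Or.inl hu
    · refine Or.inr (isStrongPrime_fracClosure_range hφ hp hu fun f hf t ht => ?_)
      obtain ⟨u, v, huv⟩ := (hp.irreducible.coprime_iff_not_dvd).2 hf
      have h1 : t = Int.castRingHom T p * (Int.castRingHom T u * t) +
          Int.castRingHom T v * (Int.castRingHom T f * t) := by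
        have := congrArg (Int.castRingHom T) huv
        rw [map_add, map_mul, map_mul, map_one] at this
        linear_combination -t * this
      rw [h1]
      exact dvd_add (dvd_mul_right _ _) (ht.mul_left _)
  · exact mk_le_aleph0_iff.2 (Set.countable_range _).to_subtype

theorem exists_isNSubring (h : ∀ z : ℤ, (z : T) ≠ 0 → (z : T) ∈ nonZeroDivisors T) :
    ∃ R : Subring T, IsNSubring R ∧ #R ≤ ℵ₀ := by
  obtain ⟨n, hn⟩ := CharP.exists T
  rcases eq_or_ne n 0 with rfl | hn0
  · refine exists_isNSubring_of_charZero fun z hz => h z fun hz0 => hz ?_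
    simpa using (CharP.intCast_eq_zero_iff T 0 z).1 hz0
  · refine exists_isNSubring_of_natPrime (p := n) (Nat.prime_def.2 ⟨?_, fun m hm => ?_⟩)
    · rcases n with _ | _ | n
      · exact absurd rfl hn0
      · exact absurd rfl (CharP.char_ne_one T 1)
      · omega
    · obtain ⟨k, rfl⟩ := hm
      have h0 : (m : T) * (k : T) = 0 := by exact_mod_cast CharP.cast_eq_zero T (m * k)
      have hm0 : 0 < m := Nat.pos_of_ne_zero (left_ne_zero_of_mul hn0)
      have hk0 : 0 < k := Nat.pos_of_ne_zero (right_ne_zero_of_mul hn0)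
      by_cases hmT : (m : T) = 0
      · right
        exact Nat.dvd_antisymm (dvd_mul_right _ _) ((CharP.cast_eq_zero_iff T (m * k) m).1 hmT)
      · left
        have hk : (k : T) = 0 := (mem_nonZeroDivisors_iff.1
          (by simpa using h m (by simpa using hmT))).1 _ h0
        have := Nat.le_of_dvd hk0 ((CharP.cast_eq_zero_iff T (m * k) k).1 hk)
        nlinarith

end BaseRing

section FinalRing

open Cardinal Set

variable {T : Type} [CommRing T] [IsLocalRing T] [IsNoetherianRing T]
  [IsAdicComplete (maximalIdeal T) T] (hM : IsGoodIdeal (maximalIdeal T))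

omit [IsNoetherianRing T] [IsAdicComplete (maximalIdeal T) T] in
theorem aleph0_lt_smallBound : ℵ₀ < smallBound T :=
  lt_of_lt_of_le (Order.lt_succ _) (le_max_left _ _)

include hM

theorem IsNSubring.exists_isNExt_forall_isComb {R : Subring T} (hR : IsNSubring R)
    (hc : #R < smallBound T) :
    ∃ S, IsNExt R S ∧ #S ≤ max ℵ₀ #R ∧
      ∀ l : List T, (∀ a ∈ l, a ∈ R) → ∀ c ∈ R, c ∈ Ideal.ofList l → IsComb S l c := by
  let ι := (max ℵ₀ #R).ord.ToType
  have hι : #ι ≤ max ℵ₀ #R := (mk_ord_toType _).le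
  obtain ⟨e, he⟩ : ∃ e : ι → List R × R, Function.Surjective e := by
    obtain ⟨f⟩ : Nonempty (List R × R ↪ ι) := le_def _ _ |>.1 (by
      rw [mk_ord_toType, mk_prod, lift_id, lift_id]
      refine (mul_le_mul' (mk_list_le_max R) (le_max_right ℵ₀ #R)).trans ?_
      rw [mul_eq_self (le_max_left _ _)])
    exact ⟨Function.invFun f, Function.invFun_surjective f.injective⟩
  have hs : max ℵ₀ #R < smallBound T := max_lt aleph0_lt_smallBound hc
  have hIio : ∀ i : ι, #(Iio i) ≤ max ℵ₀ #R := fun i => (mk_set_le _).trans hι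
  obtain ⟨F, hRF, hF, hFc, hP⟩ := exists_isNExt_chain (ι := ι) (fun i => (hIio i).trans_lt hs)
    (fun i X S => R ≤ X → ((e i).2 : T) ∈ Ideal.ofList ((e i).1.map ((↑) : R → T)) →
      IsComb S ((e i).1.map ((↑) : R → T)) ((e i).2 : T)) (by
      intro i X hX hXc
      by_cases h : R ≤ X ∧ ((e i).2 : T) ∈ Ideal.ofList ((e i).1.map ((↑) : R → T))
      · obtain ⟨S, h1, h2, h3⟩ := IsNSubring.exists_isNExt_isComb hM _ hX hXc rfl
          (l := (e i).1.map ((↑) : R → T)) (by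
            intro a ha
            obtain ⟨b, -, rfl⟩ := List.mem_map.1 ha
            exact h.1 b.2) (h.1 (e i).2.2) h.2
        exact ⟨S, h1, h2, fun _ _ => h3⟩
      · exact ⟨X, hX.isNExt_refl, le_max_right _ _, fun h1 h2 => absurd ⟨h1, h2⟩ h⟩) hR hc
  refine ⟨chainUnion R F, isNExt_chainUnion hR hRF hF, ?_, fun l hl c hcR hcl => ?_⟩
  · exact mk_chainUnion_le hR hRF hF (le_max_left _ _) hι (le_max_right _ _) fun i =>
      (hFc i).trans (max_le (le_max_left _ _) (max_le (le_max_right _ _) (hIio i)))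
  · obtain ⟨l, rfl⟩ : ∃ l' : List R, l'.map ((↑) : R → T) = l := by
      lift l to List R using hl
      exact ⟨l, rfl⟩
    obtain ⟨i, hi⟩ := he (l, ⟨c, hcR⟩)
    obtain ⟨X, hRX, -, hX⟩ := hP i
    simp only [hi] at hX
    exact (hX hRX hcl).mono (isNExt_chainUnion_coe hR hRF hF _).le

theorem exists_isNSubring_final (hZ : ∀ z : ℤ, (z : T) ≠ 0 → (z : T) ∈ nonZeroDivisors T)
    {J : Ideal T} (hJ : IsGoodIdeal J) :
    ∃ A : Subring T, IsNSubring A ∧ (∀ t : T, ∃ a ∈ A, a - t ∈ maximalIdeal T) ∧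
      Ideal.span ((A : Set T) ∩ J) = J ∧
      Ideal.span ((A : Set T) ∩ maximalIdeal T) = maximalIdeal T ∧
      ∀ l : List T, (∀ a ∈ l, a ∈ A) → ∀ c ∈ A, c ∈ Ideal.ofList l → IsComb A l c := by
  obtain ⟨R₀, hR₀, hR₀c⟩ := exists_isNSubring hZ
  obtain ⟨R₁, h₁, h₁c, hJ₁⟩ := hR₀.exists_isNExt_span_eq hM
    (hR₀c.trans_lt aleph0_lt_smallBound) hJ
  replace h₁c := h₁c.trans (max_le le_rfl hR₀c)
  obtain ⟨R, h₂, hRc, hM₂⟩ := h₁.isNSubring.exists_isNExt_span_eq hM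
    (h₁c.trans_lt aleph0_lt_smallBound) hM
  replace hRc := hRc.trans (max_le le_rfl h₁c)
  have hR := h₂.isNSubring
  let ι := (smallBound T).ord.ToType
  have hℵ : ℵ₀ ≤ smallBound T := aleph0_lt_smallBound.le
  have : NoMaxOrder ι := Cardinal.noMaxOrder hℵ
  have hι : #ι = smallBound T := mk_ord_toType _
  have hne : Nonempty ι := mk_ne_zero_iff.1 (by
    rw [hι]; exact (aleph0_pos.trans_le hℵ).ne')
  have hsurj : ∃ u : ι → ResidueField T, Function.Surjective u := by
    obtain ⟨f⟩ : Nonempty (ResidueField T ↪ ι) := le_def _ _ |>.1 (by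
      rw [hι]; exact le_max_right _ _)
    exact ⟨Function.invFun f, Function.invFun_surjective f.injective⟩
  obtain ⟨u, hu⟩ := hsurj
  obtain ⟨v, hv⟩ := (residue_surjective (R := T)).hasRightInverse
  obtain ⟨F, hRF, hF, hFc, hP⟩ := exists_isNExt_chain (ι := ι)
    (fun i => (mk_Iio_lt i (by rw [mk_ord_toType, Ordinal.type_toType])).trans_eq hι)
    (fun i X S => (∃ x ∈ S, x - v (u i) ∈ maximalIdeal T) ∧
      ∀ l : List T, (∀ a ∈ l, a ∈ X) → ∀ c ∈ X, c ∈ Ideal.ofList l → IsComb S l c) (by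
      intro i X hX hXc
      obtain ⟨Y, hY, hYc, x, hx, hxu⟩ := hX.exists_isNExt_sub_mem hM hXc
        (fun Q hQ => hM.not_le_of_mem_badPrimes hX hQ) (v (u i))
      obtain ⟨S, hS, hSc, h⟩ := IsNSubring.exists_isNExt_forall_isComb hM hY.isNSubring
        (hYc.trans_lt (max_lt aleph0_lt_smallBound hXc))
      exact ⟨S, hY.trans hS, hSc.trans (max_le (le_max_left _ _) hYc), ⟨x, hS.le hx, hxu⟩,
        fun l hl c hc => h l (fun a ha => hY.le (hl a ha)) c (hY.le hc)⟩) hR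
    (hRc.trans_lt aleph0_lt_smallBound)
  have hA := isNExt_chainUnion hR hRF hF
  have hle : ∀ i, F i ≤ chainUnion R F := fun i => (isNExt_chainUnion_coe hR hRF hF i).le
  have hFmono : ∀ i j, i ≤ j → F i ≤ F j := fun i j h =>
    h.eq_or_lt.elim (fun h => h ▸ le_rfl) fun h => (hF i j h).le
  have hspan : ∀ {S : Subring T} {I : Ideal T}, S ≤ chainUnion R F →
      Ideal.span ((S : Set T) ∩ I) = I → Ideal.span ((chainUnion R F : Set T) ∩ I) = I := by
    intro S I hS h
    refine le_antisymm (Ideal.span_le.2 inter_subset_right) (h.symm.le.trans (Ideal.span_mono ?_))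
    exact inter_subset_inter_left _ hS
  refine ⟨chainUnion R F, hA.isNSubring, fun t => ?_, hspan (h₂.le.trans hA.le) hJ₁,
    hspan hA.le hM₂, fun l hl c hc hcl => ?_⟩
  · obtain ⟨i, hi⟩ := hu (residue T t)
    obtain ⟨X, -, -, ⟨x, hx, hxu⟩, -⟩ := hP i
    refine ⟨x, hle i hx, ?_⟩
    have h1 : residue T x = residue T (v (u i)) := Ideal.Quotient.eq.2 hxu
    rw [hv, hi] at h1
    exact Ideal.Quotient.eq.1 h1
  · have hbound : ∀ l : List T, (∀ a ∈ l, a ∈ chainUnion R F) → ∃ i, ∀ a ∈ l, a ∈ R ∨ a ∈ F i := by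
      intro l
      induction l with
      | nil => exact fun _ => ⟨hne.some, by simp⟩
      | cons b l ih =>
        intro hl
        obtain ⟨i, hi⟩ := ih fun a ha => hl a (List.mem_cons_of_mem _ ha)
        have hmono : ∀ j, i ≤ j → ∀ a ∈ l, a ∈ R ∨ a ∈ F j := fun j hj a ha =>
          (hi a ha).imp_right fun h => hFmono i j hj h
        rcases (mem_chainUnion hR hRF hF).1 (hl b List.mem_cons_self) with hb | ⟨j, hj⟩
        · exact ⟨i, List.forall_mem_cons.2 ⟨Or.inl hb, hi⟩⟩
        · exact ⟨max i j, List.forall_mem_cons.2 ⟨Or.inr (hFmono _ _ (le_max_right _ _) hj),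
            hmono _ (le_max_left _ _)⟩⟩
    obtain ⟨i, hi⟩ := hbound (c :: l) (List.forall_mem_cons.2 ⟨hc, hl⟩)
    obtain ⟨j, hij⟩ := exists_gt i
    obtain ⟨X, hRX, hX, -, h⟩ := hP j
    have hiX : ∀ a ∈ c :: l, a ∈ X := fun a ha => (hi a ha).elim (fun h => hRX h) fun h =>
        hX i hij h
    exact (h l (fun a ha => hiX a (List.mem_cons_of_mem _ ha)) c (hiX c List.mem_cons_self)
        hcl).mono
      (hle j)

end FinalRing

section Completion

variable {A T : Type} [CommRing A] [CommRing T] [Algebra A T] [IsLocalRing A] [IsLocalRing T]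

theorem exists_sub_mem_maximalIdeal_pow
    (hm : (maximalIdeal A).map (algebraMap A T) = maximalIdeal T)
    (hres : ∀ t : T, ∃ a : A, algebraMap A T a - t ∈ maximalIdeal T) (n : ℕ) (t : T) :
    ∃ a : A, algebraMap A T a - t ∈ maximalIdeal T ^ n := by
  induction n generalizing t with
  | zero => exact ⟨0, by simp⟩
  | succ n ih =>
    obtain ⟨a, ha⟩ := ih t
    have key : ∀ y ∈ maximalIdeal T ^ n, ∃ b : A,
        algebraMap A T b - y ∈ maximalIdeal T ^ (n + 1) := by
      intro y hy
      rw [← hm, ← Ideal.map_pow, Ideal.map] at hy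
      induction hy using Submodule.span_induction with
      | mem x hx =>
        obtain ⟨b, hb, rfl⟩ := hx
        exact ⟨b, by simp⟩
      | zero => exact ⟨0, by simp⟩
      | add x y _ _ hx hy =>
        obtain ⟨b, hb⟩ := hx
        obtain ⟨c, hc⟩ := hy
        refine ⟨b + c, ?_⟩
        convert Ideal.add_mem _ hb hc using 1
        rw [map_add]; ring
      | smul s x hx0 hx =>
        obtain ⟨b, hb⟩ := hx
        obtain ⟨c, hc⟩ := hres s
        refine ⟨c * b, ?_⟩
        have hxn : x ∈ maximalIdeal T ^ n := by
          rw [← hm, ← Ideal.map_pow]; exact hx0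
        have h1 : (algebraMap A T c - s) * x ∈ maximalIdeal T ^ (n + 1) := by
          rw [pow_succ']; exact Ideal.mul_mem_mul hc hxn
        convert Ideal.add_mem _ (Ideal.mul_mem_left _ (algebraMap A T c) hb) h1 using 1
        rw [map_mul, smul_eq_mul]; ring
    obtain ⟨b, hb⟩ := key _ ha
    refine ⟨a - b, ?_⟩
    convert Ideal.neg_mem_iff _ |>.2 hb using 1
    rw [map_sub]; ring

theorem exists_adicCompletion_ringEquiv [IsAdicComplete (maximalIdeal T) T]
    (hm : (maximalIdeal A).map (algebraMap A T) = maximalIdeal T)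
    (hres : ∀ t : T, ∃ a : A, algebraMap A T a - t ∈ maximalIdeal T)
    (hcomap : ∀ I : Ideal A, (I.map (algebraMap A T)).comap (algebraMap A T) = I) :
    ∃ e : AdicCompletion (maximalIdeal A) A ≃+* T, ∀ a,
      e (algebraMap A (AdicCompletion (maximalIdeal A) A) a) = algebraMap A T a := by
  have hpow : ∀ n, (maximalIdeal T ^ n).comap (algebraMap A T) = maximalIdeal A ^ n := fun n => by
    rw [← hm, ← Ideal.map_pow, hcomap]
  let g : ∀ n, AdicCompletion (maximalIdeal A) A →+* T ⧸ maximalIdeal T ^ n := fun n =>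
    (Ideal.quotientMap _ (algebraMap A T) (hpow n).ge).comp
      (AdicCompletion.evalₐ (maximalIdeal A) n).toRingHom
  have hgmk : ∀ n (x : AdicCompletion.AdicCauchySequence (maximalIdeal A) A),
      g n (AdicCompletion.mk _ _ x) = Ideal.Quotient.mk _ (algebraMap A T (x n)) := fun n x => by
    change Ideal.quotientMap _ (algebraMap A T) (hpow n).ge (AdicCompletion.evalₐ (maximalIdeal A) n
      (AdicCompletion.mk _ _ x)) = _
    rw [AdicCompletion.evalₐ_mk, Ideal.quotientMap_mk]
  have hg : ∀ {m n : ℕ} (hle : m ≤ n), (Ideal.Quotient.factorPow (maximalIdeal T) hle).comp (g n) =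
      g m := by
    intro m n hle
    ext x
    induction x using AdicCompletion.induction_on with
    | h x =>
      rw [RingHom.comp_apply, hgmk, hgmk]
      change Ideal.Quotient.mk _ _ = _
      rw [Ideal.Quotient.eq, ← map_sub, ← Ideal.mem_comap, hpow, ← Ideal.Quotient.eq]
      exact AdicCompletion.Ideal.mk_eq_mk _ hle x
  let φ := IsAdicComplete.liftRingHom (maximalIdeal T) g hg
  have hφ : ∀ n x, Ideal.Quotient.mk (maximalIdeal T ^ n) (φ x) = g n x := fun n x =>
    IsAdicComplete.mk_liftRingHom _ g hg n x
  have hT : ∀ x : T, (∀ n, x ∈ maximalIdeal T ^ n) → x = 0 := fun x hx =>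
    IsHausdorff.haus (I := maximalIdeal T) inferInstance x fun n => by
      rw [SModEq.zero, smul_eq_mul, Ideal.mul_top]; exact hx n
  have hinj : Function.Injective φ := by
    rw [injective_iff_map_eq_zero]
    intro x hx
    induction x using AdicCompletion.induction_on with
    | h x =>
      refine AdicCompletion.ext_evalₐ fun n => ?_
      have h1 := hφ n (AdicCompletion.mk _ _ x)
      rw [hx, hgmk, map_zero, eq_comm, Ideal.Quotient.eq_zero_iff_mem, ← Ideal.mem_comap,
        hpow] at h1
      rw [AdicCompletion.evalₐ_mk, map_zero]
      exact Ideal.Quotient.eq_zero_iff_mem.2 h1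
  have hsurj : Function.Surjective φ := by
    intro t
    choose a ha using fun n => exists_sub_mem_maximalIdeal_pow hm hres n t
    let x : AdicCompletion.AdicCauchySequence (maximalIdeal A) A :=
      AdicCompletion.AdicCauchySequence.mk _ _ a fun n => by
        rw [SModEq.sub_mem, smul_eq_mul, Ideal.mul_top, ← hpow, Ideal.mem_comap, map_sub]
        convert Ideal.sub_mem _ (ha n) (Ideal.pow_le_pow_right n.le_succ (ha (n + 1))) using 1
        ring
    refine ⟨AdicCompletion.mk _ _ x, sub_eq_zero.1 (hT _ fun n => ?_)⟩
    rw [← Ideal.Quotient.eq, hφ, hgmk, Ideal.Quotient.eq]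
    exact ha n
  refine ⟨RingEquiv.ofBijective φ ⟨hinj, hsurj⟩, fun a => sub_eq_zero.1 (hT _ fun n => ?_)⟩
  rw [← Ideal.Quotient.eq]
  refine (hφ n _).trans ?_
  change Ideal.quotientMap _ (algebraMap A T) (hpow n).ge
    (AdicCompletion.evalₐ _ n (algebraMap A (AdicCompletion (maximalIdeal A) A) a)) = _
  rw [AlgHom.commutes]
  rfl

omit [IsLocalRing T] in
theorem flat_of_adicCompletion_ringEquiv [IsNoetherianRing A]
    (e : AdicCompletion (maximalIdeal A) A ≃+* T)
    (he : ∀ a, e (algebraMap A (AdicCompletion (maximalIdeal A) A) a) = algebraMap A T a) :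
    Module.Flat A T := by
  let e' : AdicCompletion (maximalIdeal A) A ≃ₗ[A] T :=
    { e with
      map_smul' := fun a x => by
        rw [Algebra.smul_def, Algebra.smul_def]
        exact (map_mul e _ _).trans (by rw [he]; rfl) }
  exact Module.Flat.of_linearEquiv e'.symm

end Completion

theorem coheight_le_of_forall_covChain {α : Type*} [PartialOrder α] [WellFoundedLT α]
    {t : α} (ht : ∀ x, x ≤ t) [WellFoundedGT α] {k : ℕ} {p : α}
    (h : ∀ n, CovChain n p t → n ≤ k) : Order.coheight p ≤ k := by
  induction k generalizing p with
  | zero =>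
    have hp : p = t := by
      obtain ⟨n, hn⟩ := exists_covChain (ht p)
      obtain rfl := Nat.le_zero.1 (h n hn)
      cases hn
      rfl
    rw [Order.coheight_le_coe_iff]
    intro y hy
    exact absurd (ht y) (hp ▸ hy).not_ge
  | succ k ih =>
    rw [Order.coheight_le_coe_iff]
    intro y hy
    obtain ⟨x, hpx, hxy⟩ := exists_covBy_le_of_lt hy
    have hx : Order.coheight x ≤ k := ih fun n hn => Nat.le_of_succ_le_succ (h _ (.head hpx hn))
    refine ((Order.coheight_anti hxy).trans hx).trans_lt ?_
    exact_mod_cast Nat.lt_succ_self k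

theorem CovChain.eq_of_isCatenary {A : Type} [CommRing A] (hA : IsCatenary A) {n m : ℕ}
    {p q : PrimeSpectrum A} (h : CovChain n p q) (h' : CovChain m p q) : n = m := by
  obtain ⟨f, hf, hf0, hf1⟩ := h.exists_fun
  obtain ⟨g, hg, hg0, hg1⟩ := h'.exists_fun
  exact hA n m f g hf hg (hf0.trans hg0.symm) (hf1.trans hg1.symm)

theorem ringKrullDim_le_of_isCatenary {A : Type} [CommRing A] [IsDomain A] [IsLocalRing A]
    [IsNoetherianRing A] (hA : IsCatenary A) {n : ℕ}
    (h : CovChain n (⟨⊥, Ideal.isPrime_bot⟩ : PrimeSpectrum A) (closedPoint A)) :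
    ringKrullDim A ≤ n := by
  have h1 := coheight_le_of_forall_covChain (t := closedPoint A)
    (fun x => show x.asIdeal ≤ maximalIdeal A from le_maximalIdeal x.2.ne_top)
    (p := ⟨⊥, Ideal.isPrime_bot⟩) fun m hm => (hm.eq_of_isCatenary hA h).le
  change Order.krullDim _ ≤ _
  rw [← Order.coheight_bot_eq_krullDim]
  exact_mod_cast h1

theorem CovChain.natCast_le_height {A : Type} [CommRing A] {n : ℕ} {p q : PrimeSpectrum A}
    (h : CovChain n p q) : n ≤ q.asIdeal.height := by
  suffices h : n + p.asIdeal.height ≤ q.asIdeal.height from le_self_add.trans h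
  induction h with
  | refl p => simp
  | head hpq _ ih =>
    refine le_trans ?_ ih
    rw [Nat.cast_succ, add_assoc, add_comm 1]
    exact add_le_add_right (Ideal.height_add_one_le_of_lt_of_isPrime hpq.1) _

section Flat

variable {A T : Type} [CommRing A] [IsDomain A] [IsLocalRing A] [IsNoetherianRing A] [CommRing T]
  [IsLocalRing T] [IsNoetherianRing T] [Algebra A T] [Module.Flat A T]

theorem not_isCatenary_of_flat
    (hm : (maximalIdeal A).map (algebraMap A T) = maximalIdeal T)
    (hcomap : ∀ I : Ideal A, (I.map (algebraMap A T)).comap (algebraMap A T) = I)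
    {J : Ideal T} [hJp : J.IsPrime] (hJ : (J.comap (algebraMap A T)).map (algebraMap A T) = J)
    (hJM : J ≠ maximalIdeal T)
    (hcov : ∀ Q : Ideal T, Q.IsPrime → J ≤ Q → Q = J ∨ Q = maximalIdeal T)
    (hdim : (J.height + 1 : WithBot ℕ∞) < ringKrullDim T) : ¬ IsCatenary A := by
  intro hA
  obtain ⟨p, hp⟩ : ∃ p, p = J.comap (algebraMap A T) := ⟨_, rfl⟩
  have hpp : p.IsPrime := hp ▸ Ideal.comap_isPrime _ _
  have : J.LiesOver p := ⟨hp⟩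
  rw [← hp] at hJ
  have hpJ : p.height ≤ J.height := by
    rw [Ideal.height_eq_height_add_of_liesOver_of_hasGoingDown p J]
    exact le_self_add
  have hml : (maximalIdeal T).LiesOver (maximalIdeal A) := ⟨by
    rw [Ideal.under, ← hm, hcomap]⟩
  have hmm : (maximalIdeal T).height = (maximalIdeal A).height := by
    rw [Ideal.height_eq_height_add_of_liesOver_of_hasGoingDown (maximalIdeal A) (maximalIdeal T),
        hm,
      Ideal.map_quotient_self, Ideal.height_bot, add_zero]
  have hpm : (⟨p, hpp⟩ : PrimeSpectrum A) ⋖ closedPoint A := by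
    refine ⟨lt_of_le_of_ne (le_maximalIdeal hpp.ne_top) fun h => hJM (hJ.symm.trans ?_),
        fun q hpq hqm => hqm.ne ?_⟩
    · exact (congrArg (fun x : PrimeSpectrum A => x.asIdeal.map (algebraMap A T)) h).trans hm
    · have hle : p ≤ q.asIdeal := hpq.le
      obtain ⟨a, haq, hap⟩ : ∃ a ∈ q.asIdeal, a ∉ p :=
          SetLike.exists_of_lt (show p < q.asIdeal from hpq)
      have hrad : (q.asIdeal.map (algebraMap A T)).radical = maximalIdeal T := by
        rw [Ideal.radical_eq_sInf]
        have hset : {Q : Ideal T | q.asIdeal.map (algebraMap A T) ≤ Q ∧ Q.IsPrime} =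
            {maximalIdeal T} := by
          ext Q
          rw [Set.mem_ofPred_eq, Set.mem_singleton_iff]
          constructor
          · rintro ⟨hQ, hQp⟩
            refine (hcov Q hQp (hJ ▸ (Ideal.map_mono hle).trans hQ)).resolve_left ?_
            rintro rfl
            refine hap (hp ▸ hQ (Ideal.mem_map_of_mem _ haq))
          · rintro rfl
            exact ⟨hm ▸ Ideal.map_mono (le_maximalIdeal q.2.ne_top), inferInstance⟩
        rw [hset, sInf_singleton]
      refine PrimeSpectrum.ext (le_antisymm (le_maximalIdeal q.2.ne_top) fun x hx => ?_)
      have hx' : algebraMap A T x ∈ maximalIdeal T := hm ▸ Ideal.mem_map_of_mem _ hx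
      rw [← hrad] at hx'
      obtain ⟨n, hn⟩ := hx'
      rw [← map_pow, ← Ideal.mem_comap, hcomap] at hn
      exact q.2.mem_of_pow_mem n hn
  obtain ⟨n, hn⟩ := exists_covChain (show (⟨⊥, Ideal.isPrime_bot⟩ : PrimeSpectrum A) ≤ ⟨p, hpp⟩ from
    bot_le (a := p))
  have h1 := ringKrullDim_le_of_isCatenary hA (hn.trans (.head hpm (.refl _)))
  have h2 := hn.natCast_le_height
  have h3 : ringKrullDim T ≤ (n + 1 : ℕ) := by
    rw [← maximalIdeal_height_eq_ringKrullDim, hmm, maximalIdeal_height_eq_ringKrullDim]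
    exact h1
  have h4 : ((n + 1 : ℕ) : WithBot ℕ∞) ≤ J.height + 1 := by
    exact_mod_cast add_le_add_left (h2.trans hpJ) 1
  exact absurd hdim (h3.trans h4).not_gt

end Flat

section Ring

variable {T : Type} [CommRing T] {A : Subring T}

theorem mem_ofList_of_isComb {l : List A} {c : A} (h : IsComb A (l.map ((↑) : A → T)) (c : T)) :
    c ∈ Ideal.ofList l := by
  induction l generalizing c with
  | nil => rw [Ideal.ofList_nil, Submodule.mem_bot]; exact Subtype.ext h
  | cons a l ih =>
    obtain ⟨x, hx, h⟩ := h
    have h1 : c - a * ⟨x, hx⟩ ∈ Ideal.ofList l := ih (by simpa using h)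
    rw [Ideal.ofList_cons, Submodule.mem_sup]
    exact ⟨a * ⟨x, hx⟩, Ideal.mul_mem_right _ _ (Ideal.mem_span_singleton_self a), _, h1, by ring⟩

variable (hcomb : ∀ l : List T, (∀ a ∈ l, a ∈ A) → ∀ c ∈ A, c ∈ Ideal.ofList l → IsComb A l c)
  [IsNoetherianRing T]

include hcomb

theorem exists_list_of_isComb (I : Ideal A) :
    ∃ l : List A, (∀ a ∈ l, a ∈ I) ∧ ∀ c : A, (c : T) ∈ I.map (algebraMap A T) →
        c ∈ Ideal.ofList l := by
  classical
  obtain ⟨s, hs, hspan⟩ := (Submodule.fg_span_iff_fg_span_finset_subset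
    ((algebraMap A T) '' (I : Set A))).1 (IsNoetherian.noetherian (I.map (algebraMap A T)))
  obtain ⟨l, hl⟩ : ∃ l : List A, l.map ((↑) : A → T) = s.toList ∧ ∀ a ∈ l, a ∈ I := by
    have hA : ∀ x ∈ s.toList, x ∈ A := fun x hx => by
      obtain ⟨a, -, rfl⟩ := hs (Finset.mem_toList.1 hx)
      exact a.2
    obtain ⟨l, hl⟩ : ∃ l : List A, l.map ((↑) : A → T) = s.toList := by
      generalize s.toList = m at hA
      lift m to List A using hA
      exact ⟨m, rfl⟩
    refine ⟨l, hl, fun a ha => ?_⟩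
    have h1 : (a : T) ∈ s.toList := hl ▸ List.mem_map_of_mem ha
    obtain ⟨b, hb, hba⟩ := hs (Finset.mem_toList.1 h1)
    exact (Subtype.ext hba : b = a) ▸ hb
  refine ⟨l, hl.2, fun c hc => mem_ofList_of_isComb (hcomb _ ?_ c c.2 ?_)⟩
  · intro a ha
    obtain ⟨b, -, rfl⟩ := List.mem_map.1 ha
    exact b.2
  · rw [hl.1, Ideal.ofList]
    have h1 : Ideal.span {x | x ∈ s.toList} = I.map (algebraMap A T) := by
      rw [Ideal.map, Ideal.span, Ideal.span, hspan]
      congr 1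
      ext x
      simp
    rw [h1]
    exact hc

theorem comap_map_of_isComb (I : Ideal A) :
    (I.map (algebraMap A T)).comap (algebraMap A T) = I := by
  refine le_antisymm (fun c hc => ?_) Ideal.le_comap_map
  obtain ⟨l, hl, h⟩ := exists_list_of_isComb hcomb I
  exact Ideal.span_le.2 hl (h c hc)

theorem isNoetherianRing_of_isComb : IsNoetherianRing A := by
  refine ⟨fun I => ?_⟩
  classical
  obtain ⟨l, hl, h⟩ := exists_list_of_isComb hcomb I
  refine ⟨l.toFinset, le_antisymm (Submodule.span_le.2 fun x hx => hl x (by simpa using hx)) ?_⟩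
  intro c hc
  have h1 := h c (Ideal.mem_map_of_mem (algebraMap A T) hc)
  have h2 : ((l.toFinset : Finset A) : Set A) = {x | x ∈ l} := by
    ext x
    simp
  rw [h2]
  exact h1

end Ring

theorem exists_noncatenary_of_isGoodIdeal {T : Type} [CommRing T] [IsLocalRing T]
    [IsNoetherianRing T] [IsAdicComplete (maximalIdeal T) T]
    (hZ : ∀ z : ℤ, (z : T) ≠ 0 → (z : T) ∈ nonZeroDivisors T)
    (hM : IsGoodIdeal (maximalIdeal T)) {J : Ideal T} [hJp : J.IsPrime] (hJ : IsGoodIdeal J)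
    (hJM : J ≠ maximalIdeal T)
    (hcov : ∀ Q : Ideal T, Q.IsPrime → J ≤ Q → Q = J ∨ Q = maximalIdeal T)
    (hdim : (J.height + 1 : WithBot ℕ∞) < ringKrullDim T) :
    ∃ (A : Type) (_ : CommRing A) (_ : IsDomain A) (_ : IsLocalRing A) (_ : IsNoetherianRing A)
      (_ : UniqueFactorizationMonoid A),
      ¬ IsCatenary A ∧ Nonempty (AdicCompletion (maximalIdeal A) A ≃+* T) := by
  obtain ⟨A, hA, hres, hJA, hMA, hcomb⟩ := exists_isNSubring_final hM hZ hJ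
  have hdom : IsDomain A := hA.isDomain
  have hlocal : IsLocalRing A := IsLocalRing.of_nonunits_add fun a b ha hb => by
    rw [mem_nonunits_iff, hA.isUnit_iff] at ha hb ⊢
    exact IsLocalRing.nonunits_add ha hb
  have hnoeth := isNoetherianRing_of_isComb hcomb
  have hspan : ∀ {I : Ideal T}, Ideal.span ((A : Set T) ∩ I) = I →
      (I.comap (algebraMap A T)).map (algebraMap A T) = I := fun {I} h => by
    refine le_antisymm Ideal.map_comap_le (h.symm.le.trans (Ideal.span_le.2 ?_))
    rintro x ⟨hxA, hxI⟩
    have h1 : (⟨x, hxA⟩ : A) ∈ I.comap (algebraMap A T) := hxI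
    exact Ideal.mem_map_of_mem (algebraMap A T) h1
  have hm : (maximalIdeal A).map (algebraMap A T) = maximalIdeal T := by
    have h1 : (maximalIdeal T).comap (algebraMap A T) = maximalIdeal A := by
      ext a
      rw [Ideal.mem_comap, mem_maximalIdeal, mem_maximalIdeal, mem_nonunits_iff, mem_nonunits_iff,
        hA.isUnit_iff]
      rfl
    rw [← h1]
    exact hspan hMA
  have hcomap := comap_map_of_isComb hcomb
  obtain ⟨e, he⟩ := exists_adicCompletion_ringEquiv hm (fun t => by
    obtain ⟨a, ha, h⟩ := hres t
    exact ⟨⟨a, ha⟩, h⟩) hcomap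
  have := flat_of_adicCompletion_ringEquiv e he
  exact ⟨A, inferInstance, hdom, hlocal, hnoeth, hA.uniqueFactorizationMonoid,
    not_isCatenary_of_flat hm hcomap (hspan hJA) hJM hcov hdim, ⟨e⟩⟩

section Good

variable {T : Type} [CommRing T]

theorem mem_assPrimes_of_mem {r t : T} {Q : Ideal T} (hQ : Q ∈ assPrimes r)
    (hr : r ∈ nonZeroDivisors T) (htQ : t ∈ Q) (ht : t ∈ nonZeroDivisors T) : Q ∈ assPrimes t := by
  obtain ⟨hQp, w, hw⟩ := hQ
  obtain ⟨u, hu⟩ := (hw t).1 htQ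
  refine ⟨hQp, u, fun a => (hw a).trans ⟨?_, ?_⟩⟩
  · rintro ⟨b, hb⟩
    refine ⟨b, sub_eq_zero.1 ((mem_nonZeroDivisors_iff.1 hr).1 _ ?_)⟩
    linear_combination t * hb - a * hu
  · rintro ⟨b, hb⟩
    refine ⟨b, sub_eq_zero.1 ((mem_nonZeroDivisors_iff.1 ht).1 _ ?_)⟩
    linear_combination r * hb + a * hu

theorem notMem_of_mem_assPrimes_zero {t : T} (ht : t ∈ nonZeroDivisors T) {Q : Ideal T}
    (hQ : Q ∈ assPrimes (0 : T)) : t ∉ Q := fun h => by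
  obtain ⟨hQp, w, hw⟩ := hQ
  have h1 : w = 0 := (mem_nonZeroDivisors_iff.1 ht).1 _ (zero_dvd_iff.1 ((hw t).1 h))
  exact hQp.ne_top ((Ideal.eq_top_iff_one Q).2 ((hw 1).2 (by rw [h1, mul_zero])))

theorem isGoodIdeal_of_mem {J : Ideal T} {t : T} (htJ : t ∈ J) (ht : t ∈ nonZeroDivisors T)
    (h : ∀ Q ∈ assPrimes t, ¬ J ≤ Q) : IsGoodIdeal J := by
  rintro r (rfl | hr) Q hQ hJQ
  · exact notMem_of_mem_assPrimes_zero ht hQ (hJQ htJ)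
  · exact h Q (mem_assPrimes_of_mem hQ hr (hJQ htJ) ht) hJQ

theorem isGoodIdeal_maximalIdeal_of_one_lt_ringDepth [IsLocalRing T] (h : 1 < ringDepth T) :
    IsGoodIdeal (maximalIdeal T) := by
  obtain ⟨_, ⟨rs, rfl, hrs, hreg⟩, hlen⟩ := lt_sSup_iff.1 h
  match rs with
  | [] => simp at hlen
  | [_] => simp at hlen
  | x :: y :: rs =>
    have h2 : RingTheory.Sequence.IsWeaklyRegular T [x, y] := by
      have h1 := hreg.toIsWeaklyRegular
      rw [show x :: y :: rs = [x, y] ++ rs from rfl,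
        RingTheory.Sequence.isWeaklyRegular_append_iff] at h1
      exact h1.1
    rw [isWeaklyRegular_pair_iff] at h2
    refine isGoodIdeal_of_mem (hrs x (by simp)) (mem_nonZeroDivisors_iff_left.2 h2.1) ?_
    rintro Q ⟨hQp, w, hw⟩ hQ
    have h3 := h2.2 w (Ideal.mem_span_singleton.2 ((hw y).1 (hQ (hrs y (by simp)))))
    exact hQp.ne_top ((Ideal.eq_top_iff_one Q).2 ((hw 1).2
      (by rw [one_mul]; exact Ideal.mem_span_singleton.1 h3)))

end Good

theorem eq_of_mem_minimalPrimes_sup_span_singleton {R : Type*} [CommRing R] [IsNoetherianRing R]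
    {I p q : Ideal R} (hI : I.IsPrime) (hp : p.IsPrime) {x : R}
    (hq : q ∈ (I ⊔ Ideal.span {x}).minimalPrimes) (hIp : I < p) (hpq : p ≤ q) : p = q := by
  by_contra hne
  have hqp : q.IsPrime := hq.1.1
  have hlt : p < q := lt_of_le_of_ne hpq hne
  have h1 := Ideal.map_height_le_one_of_mem_minimalPrimes hq
  have hmap : ∀ r : Ideal R, r.IsPrime → I ≤ r → (r.map (Ideal.Quotient.mk I)).IsPrime :=
    fun r hr h => Ideal.map_isPrime_of_surjective Ideal.Quotient.mk_surjective
      (by rwa [Ideal.mk_ker])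
  have hcomap : ∀ r : Ideal R, I ≤ r → (r.map (Ideal.Quotient.mk I)).comap (Ideal.Quotient.mk I) =
      r :=
    fun r h => by
      rw [Ideal.comap_map_of_surjective _ Ideal.Quotient.mk_surjective, ← RingHom.ker_eq_comap_bot,
        Ideal.mk_ker, sup_eq_left.2 h]
  have hlt' : ∀ r s : Ideal R, I ≤ r → r < s →
      r.map (Ideal.Quotient.mk I) < s.map (Ideal.Quotient.mk I) := fun r s hr hrs =>
    lt_of_le_of_ne (Ideal.map_mono hrs.le) fun h => hrs.ne (by
      rw [← hcomap r hr, h, hcomap s (hr.trans hrs.le)])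
  have := hmap I hI le_rfl
  have := hmap p hp hIp.le
  have := hmap q hqp (hIp.le.trans hpq)
  have h2 := Ideal.height_add_one_le_of_lt_of_isPrime (hlt' I p le_rfl hIp)
  have h3 := Ideal.height_add_one_le_of_lt_of_isPrime (hlt' p q hIp.le hlt)
  have h4 : (0 + 1 + 1 : ℕ∞) ≤ 1 :=
    (add_le_add_left ((add_le_add_left (by simp) 1).trans h2) 1).trans (h3.trans h1)
  exact absurd h4 (by decide)

theorem covBy_maximalIdeal_of_forall_mem {R : Type*} [CommRing R] [IsLocalRing R]
    [IsNoetherianRing R] {J : Ideal R} (hJ : J.IsPrime) {a : R} (ha : a ∈ maximalIdeal R)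
    (haJ : a ∉ J) (h : ∀ Q : Ideal R, Q.IsPrime → J < Q → a ∈ Q) (Q : Ideal R) (hQ : Q.IsPrime)
    (hJQ : J ≤ Q) : Q = J ∨ Q = maximalIdeal R := by
  by_contra! hne
  have hJlt : J < Q := lt_of_le_of_ne hJQ hne.1.symm
  have hJM : J ≤ maximalIdeal R := le_maximalIdeal hJ.ne_top
  have hlt : ∀ q ∈ (J ⊔ Ideal.span {a}).minimalPrimes, J < q := fun q hq =>
    lt_of_le_of_ne (le_sup_left.trans hq.1.2) fun h =>
      haJ (h ▸ hq.1.2 (Ideal.mem_sup_right (Ideal.mem_span_singleton_self a)))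
  obtain ⟨b, hbM, hb⟩ := exists_mem_forall_notMem
    (Ideal.finite_minimalPrimes_of_isNoetherianRing R (J ⊔ Ideal.span {a})) (fun q hq => hq.1.1)
    (I := maximalIdeal R) fun q hq hMq => by
      have hqM : q = maximalIdeal R := le_antisymm (le_maximalIdeal hq.1.1.ne_top) hMq
      exact hne.2 ((eq_of_mem_minimalPrimes_sup_span_singleton hJ hQ hq hJlt
        (hqM ▸ le_maximalIdeal hQ.ne_top)).trans hqM)
  have hle : J ⊔ Ideal.span {b} ≤ maximalIdeal R :=
    sup_le hJM ((Ideal.span_singleton_le_iff_mem _).2 hbM)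
  obtain ⟨q, hq, -⟩ := Ideal.exists_minimalPrimes_le hle
  have hbq : b ∈ q := hq.1.2 (Ideal.mem_sup_right (Ideal.mem_span_singleton_self b))
  have hJq : J ≤ q := le_sup_left.trans hq.1.2
  have hJb : b ∉ J := fun hbJ => by
    have hle : J ⊔ Ideal.span {a} ≤ maximalIdeal R :=
      sup_le hJM ((Ideal.span_singleton_le_iff_mem _).2 ha)
    obtain ⟨q', hq', -⟩ := Ideal.exists_minimalPrimes_le hle
    exact hb q' hq' ((hlt q' hq').le hbJ)
  have haq : a ∈ q := h q hq.1.1 (lt_of_le_of_ne hJq fun h => hJb (h ▸ hbq))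
  have hqp : q.IsPrime := hq.1.1
  obtain ⟨q', hq', hq'q⟩ := Ideal.exists_minimalPrimes_le (I := J ⊔ Ideal.span {a})
    (sup_le hJq ((Ideal.span_singleton_le_iff_mem _).2 haq))
  exact hb q' hq' (eq_of_mem_minimalPrimes_sup_span_singleton hJ hq'.1.1 hq (hlt q' hq') hq'q ▸ hbq)

theorem exists_lt_lt_of_two_le_ringKrullDim_quotient {R : Type*} [CommRing R] {I : Ideal R}
    (h : 2 ≤ ringKrullDim (R ⧸ I)) :
    ∃ q₀ q₁ q₂ : Ideal R, q₀.IsPrime ∧ q₁.IsPrime ∧ q₂.IsPrime ∧ I ≤ q₀ ∧ q₀ < q₁ ∧ q₁ < q₂ := by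
  rw [ringKrullDim_quotient] at h
  obtain ⟨l, hl⟩ := (Order.le_krullDim_iff (n := 2)).1 (by exact_mod_cast h)
  have hlt : ∀ i j : Fin (l.length + 1), i < j →
      (l i).1.asIdeal < (l j).1.asIdeal := fun i j hij => l.strictMono hij
  exact ⟨(l ⟨0, by omega⟩).1.asIdeal, (l ⟨1, by omega⟩).1.asIdeal, (l ⟨2, by omega⟩).1.asIdeal,
    inferInstance, inferInstance, inferInstance, (l ⟨0, by omega⟩).2,
    hlt _ _ (Fin.mk_lt_mk.2 one_pos), hlt _ _ (Fin.mk_lt_mk.2 one_lt_two)⟩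

theorem two_le_ringKrullDim_quotient_sup {R : Type} [CommRing R] [IsLocalRing R]
    [IsNoetherianRing R] {P : Ideal R} (hP : P.IsPrime) {t : R} (ht : t ∈ maximalIdeal R)
    (h : 2 < ringKrullDim (R ⧸ P)) : 2 ≤ ringKrullDim (R ⧸ (P ⊔ Ideal.span {t})) := by
  have : IsLocalRing (R ⧸ P) := IsLocalRing.of_surjective' (Ideal.Quotient.mk P)
      Ideal.Quotient.mk_surjective
  have htP : Ideal.Quotient.mk P t ∈ maximalIdeal (R ⧸ P) := by
    rw [mem_maximalIdeal, mem_nonunits_iff]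
    intro hu
    have : IsLocalHom (Ideal.Quotient.mk P) := .of_surjective _ Ideal.Quotient.mk_surjective
    exact (mem_nonunits_iff.1 ht) (isUnit_of_map_unit _ t hu)
  have h1 := dim_le_dim_quotient_add_one htP
  rw [ringKrullDim_eq_of_ringEquiv (e := (Ideal.quotEquivOfEq
      (by rw [Ideal.map_span, Set.image_singleton])).trans
          (DoubleQuot.quotQuotEquivQuotSup P (Ideal.span {t})))] at h1
  have hne : P ⊔ Ideal.span {t} ≠ ⊤ := ne_top_of_le_ne_top (maximalIdeal.isMaximal R).ne_top
    (sup_le (le_maximalIdeal hP.ne_top) ((Ideal.span_singleton_le_iff_mem _).2 ht))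
  have : Nontrivial (R ⧸ (P ⊔ Ideal.span {t})) := Ideal.Quotient.nontrivial_iff.2 hne
  have : IsLocalRing (R ⧸ (P ⊔ Ideal.span {t})) :=
    IsLocalRing.of_surjective' (Ideal.Quotient.mk _) Ideal.Quotient.mk_surjective
  obtain ⟨d, hd⟩ := exists_ringKrullDim_eq_natCast (R ⧸ (P ⊔ Ideal.span {t}))
  have h2 := h.trans_le h1
  rw [hd] at h2 ⊢
  have h3 : 2 < d + 1 := by exact_mod_cast h2
  exact_mod_cast Nat.lt_succ_iff.1 h3

theorem height_add_one_le_ringKrullDim_quotient {R : Type*} [CommRing R] [IsLocalRing R]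
    [IsNoetherianRing R] {J P : Ideal R} (hJ : J.IsPrime) (hJM : J ≠ maximalIdeal R)
    (h : ∀ Q : Ideal R, Q.IsPrime → Q ≤ J → P ≤ Q) :
    (J.height + 1 : WithBot ℕ∞) ≤ ringKrullDim (R ⧸ P) := by
  obtain ⟨n, hn⟩ := ENat.ne_top_iff_exists.1 (Ideal.height_ne_top hJ.ne_top)
  obtain ⟨l, hl, hlen⟩ := Order.exists_series_of_height_eq_coe (⟨J, hJ⟩ : PrimeSpectrum R) (n := n)
    (by rw [← PrimeSpectrum.height_eq_orderHeight]; exact hn.symm)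
  have hlt : l.last < closedPoint R := by
    rw [hl]
    exact lt_of_le_of_ne (show J ≤ maximalIdeal R from le_maximalIdeal hJ.ne_top)
      fun h => hJM (congrArg PrimeSpectrum.asIdeal h)
  rw [ringKrullDim_quotient, ← hn]
  let s : LTSeries (PrimeSpectrum R) := l.snoc (closedPoint R) hlt
  have hhead : s 0 = l.head := RelSeries.head_snoc l _ hlt
  have hmem : ∀ i, P ≤ (s i).asIdeal := fun i =>
    (h l.head.asIdeal inferInstance (show l.head ≤ ⟨J, hJ⟩ from hl ▸ l.head_le_last)).trans
      (hhead ▸ s.monotone (Fin.zero_le i) : l.head ≤ s i)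
  exact (Order.le_krullDim_iff (n := n + 1)).2
    ⟨⟨s.length, fun i => ⟨s i, hmem i⟩, fun i => s.step i⟩, by simp [s, hlen]⟩

theorem exists_isGoodIdeal_prime {T : Type} [CommRing T] [IsLocalRing T] [IsNoetherianRing T]
    (hM : IsGoodIdeal (maximalIdeal T)) {P : Ideal T} (hP : P ∈ minimalPrimes T)
    (h2 : 2 < ringKrullDim (T ⧸ P)) (hlt : ringKrullDim (T ⧸ P) < ringKrullDim T) :
    ∃ J : Ideal T, J.IsPrime ∧ IsGoodIdeal J ∧ J ≠ maximalIdeal T ∧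
      (∀ Q : Ideal T, Q.IsPrime → J ≤ Q → Q = J ∨ Q = maximalIdeal T) ∧
      (J.height + 1 : WithBot ℕ∞) < ringKrullDim T := by
  have hPp : P.IsPrime := hP.1.1
  have hmin : (minimalPrimes T).Finite := minimalPrimes.finite_of_isNoetherianRing T
  set S : Set (Ideal T) := ⋃ P' ∈ minimalPrimes T \ {P}, (P ⊔ P').minimalPrimes \ {maximalIdeal T}
    with hS
  have hSfin : S.Finite := (hmin.subset Set.sdiff_subset).biUnion fun P' _ =>
    (Ideal.finite_minimalPrimes_of_isNoetherianRing T _).subset Set.sdiff_subset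
  obtain ⟨t, htM, ht⟩ := exists_mem_forall_notMem (s := assPrimes (0 : T) ∪ S)
    ((finite_assPrimes 0).union hSfin) (I := maximalIdeal T)
    (by
      rintro q (hq | hq)
      · exact hq.1
      · obtain ⟨P', -, hq⟩ := Set.mem_iUnion₂.1 hq
        exact hq.1.1.1)
    (by
      rintro q (hq | hq) hMq
      · exact hM 0 (Or.inl rfl) q hq hMq
      · obtain ⟨P', -, hq⟩ := Set.mem_iUnion₂.1 hq
        exact hq.2 (le_antisymm (le_maximalIdeal hq.1.1.1.ne_top) hMq))
  have htreg : t ∈ nonZeroDivisors T := mem_nonZeroDivisors_iff_right.2 fun x hx =>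
    zero_dvd_iff.1 (dvd_of_dvd_mul_of_forall_notMem (y := t) (fun Q hQ => ht Q (Or.inl hQ))
      (zero_dvd_iff.2 (by rw [mul_comm, hx])))
  obtain ⟨q₀, q₁, q₂, hq₀, hq₁, hq₂, hle₀, h01, h12⟩ :=
    exists_lt_lt_of_two_le_ringKrullDim_quotient (two_le_ringKrullDim_quotient_sup hPp htM h2)
  obtain ⟨N, hN, hNq₀⟩ := Ideal.exists_minimalPrimes_le hle₀
  have hNp : N.IsPrime := hN.1.1
  have htN : t ∈ N := hN.1.2 (Ideal.mem_sup_right (Ideal.mem_span_singleton_self t))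
  have hPN : P ≤ N := le_sup_left.trans hN.1.2
  have hNq₁ : N < q₁ := hNq₀.trans_lt h01
  have hq₁M : q₁ < maximalIdeal T := h12.trans_le (le_maximalIdeal hq₂.ne_top)
  have hNP' : ∀ P' ∈ minimalPrimes T \ {P}, ¬ P' ≤ N := by
    rintro P' hP' hP'N
    obtain ⟨Q, hQ, hQN⟩ := Ideal.exists_minimalPrimes_le (sup_le hPN hP'N)
    have hPQ : P < Q := lt_of_le_of_ne (le_sup_left.trans hQ.1.2) fun h =>
      hP'.2 <| by
        have hP'P : P' ≤ P := h ▸ le_sup_right.trans hQ.1.2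
        exact le_antisymm hP'P (hP.2 hP'.1.1 hP'P)
    have hQN' : Q = N := eq_of_mem_minimalPrimes_sup_span_singleton hPp hQ.1.1 hN hPQ hQN
    exact ht Q (Or.inr (Set.mem_iUnion₂.2 ⟨P', hP', hQ, fun h =>
      (hNq₁.trans hq₁M).ne (hQN' ▸ h)⟩)) (hQN' ▸ htN)
  set F : Set (Ideal T) := (minimalPrimes T \ {P}) ∪ ({Q ∈ assPrimes t | N < Q} ∪ {maximalIdeal T})
    with hF
  have hFfin : F.Finite := (hmin.subset Set.sdiff_subset).union
    (((finite_assPrimes t).subset fun _ h => h.1).union (Set.finite_singleton _))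
  have hFN : ∀ Q ∈ F, ¬ Q ≤ N := by
    rintro Q (hQ | hQ | hQ)
    · exact hNP' Q hQ
    · exact hQ.2.not_ge
    · exact hQ ▸ (hNq₁.trans hq₁M).not_ge
  obtain ⟨a, haF, haN⟩ : ∃ a, (∀ Q ∈ F, a ∈ Q) ∧ a ∉ N := by
    have h : ¬ hFfin.toFinset.inf id ≤ N := fun h => by
      obtain ⟨Q, hQ, hQN⟩ := (Ideal.IsPrime.inf_le' hNp).1 h
      exact hFN Q (hFfin.mem_toFinset.1 hQ) hQN
    obtain ⟨a, ha, haN⟩ := Set.not_subset.1 h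
    exact ⟨a, fun Q hQ => (Finset.inf_le (f := id) (hFfin.mem_toFinset.2 hQ) : _ ≤ Q) ha, haN⟩
  have haM : a ∈ maximalIdeal T := haF _ (Or.inr (Or.inr rfl))
  obtain ⟨⟨J, hJ⟩, ⟨hNJ, haJ⟩, hJmax⟩ := wellFounded_gt.has_min
    {p : PrimeSpectrum T | N ≤ p.asIdeal ∧ a ∉ p.asIdeal} ⟨⟨N, hNp⟩, le_rfl, haN⟩
  have hup : ∀ Q : Ideal T, Q.IsPrime → J < Q → a ∈ Q := fun Q hQ hJQ => by
    by_contra haQ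
    exact hJmax ⟨Q, hQ⟩ ⟨hNJ.trans hJQ.le, haQ⟩ hJQ
  have hcov := covBy_maximalIdeal_of_forall_mem hJ haM haJ hup
  have hJM : J ≠ maximalIdeal T := fun h => haJ (h ▸ haM)
  have hNJ' : N < J := lt_of_le_of_ne hNJ fun h => by
    subst h
    rcases hcov q₁ hq₁ hNq₁.le with h | h
    · exact hNq₁.ne' h
    · exact hq₁M.ne h
  refine ⟨J, hJ, isGoodIdeal_of_mem (hNJ htN) htreg fun Q hQ hJQ => ?_, hJM, hcov, ?_⟩
  · rcases hcov Q hQ.1 hJQ with rfl | rfl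
    · exact haJ (haF _ (Or.inr (Or.inl ⟨hQ, hNJ'⟩)))
    · exact hM t (Or.inr htreg) _ hQ le_rfl
  · refine (height_add_one_le_ringKrullDim_quotient hJ hJM fun Q hQ hQJ => ?_).trans_lt hlt
    obtain ⟨P', hP', hP'Q⟩ := Ideal.exists_minimalPrimes_le (bot_le : ⊥ ≤ Q)
    by_contra hPQ
    exact haJ (hQJ (hP'Q (haF P' (Or.inl ⟨hP', fun h => hPQ (h ▸ hP'Q)⟩))))

/-- Characterization of completions of noncatenary local UFDs: a complete Noetherian
local ring `(T,M)` is the completion of a noncatenary Noetherian local UFD iff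
(i) no nonzero integer of `T` is a zerodivisor, (ii) `depth T > 1`, and (iii) there is a
minimal prime `P` of `T` with `2 < dim (T/P) < dim T`. -/
theorem stmt13 (T : Type) [CommRing T] [IsLocalRing T] [IsNoetherianRing T]
    [IsAdicComplete (maximalIdeal T) T] :
    (∃ (A : Type) (_ : CommRing A) (_ : IsDomain A) (_ : IsLocalRing A)
        (_ : IsNoetherianRing A) (_ : UniqueFactorizationMonoid A), ¬ IsCatenary A ∧
        Nonempty (AdicCompletion (maximalIdeal A) A ≃+* T)) ↔
      ((∀ z : ℤ, (z : T) ≠ 0 → (z : T) ∈ nonZeroDivisors T) ∧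
        1 < ringDepth T ∧
        ∃ P ∈ minimalPrimes T,
          2 < ringKrullDim (T ⧸ P) ∧ ringKrullDim (T ⧸ P) < ringKrullDim T) := by
  constructor
  · rintro ⟨A, _, _, _, _, _, hA, ⟨e⟩⟩
    exact conditions_of_completion T A hA e
  · rintro ⟨hZ, hd, P, hP, h2, hlt⟩
    have hM := isGoodIdeal_maximalIdeal_of_one_lt_ringDepth hd
    obtain ⟨J, hJp, hJ, hJM, hcov, hdim⟩ := exists_isGoodIdeal_prime hM hP h2 hlt
    exact exists_noncatenary_of_isGoodIdeal hZ hM hJ hJM hcov hdim
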